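/- Generalized Calabi rigidity theorem: let N ⊆ ℝ^n be a nonempty open set and u : N → ℝ a smooth strictly convex function (positive definite Hessian) solving the weighted Monge–Ampère equation log det (u_{,ij}) = −v_j x^j + u_{,i} ξ^i + c on N. If the Hessian metric g = D²u is complete on N, then N = ℝ^n and u is a quadratic polynomial: there exist a symmetric positive definite n×n matrix A, a vector b ∈ ℝ^n and a constant a₀ ∈ ℝ such that u(x) = (1/2) xᵀ A x + bᵀ x + a₀ for all x ∈ ℝ^n. -/

import Mathlib

open scoped BigOperators
noncomputable section

namespace KRS

variable {n : ℕ}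

/-- Partial derivative of `f` in the `i`-th coordinate direction. -/
def pd (i : Fin n) (f : (Fin n → ℝ) → ℝ) : (Fin n → ℝ) → ℝ :=
  fun x => fderiv ℝ f x (Pi.single i 1)

/-- The Hessian matrix `g(x)` of `u`, with entries `g_{ij} = ∂²u/∂x^i∂x^j`. -/
def hessian (u : (Fin n → ℝ) → ℝ) (x : Fin n → ℝ) : Matrix (Fin n) (Fin n) ℝ :=
  Matrix.of fun i j => pd i (pd j u) x

/-- The inverse matrix `g(x)⁻¹`, with entries `g^{ij}`. -/
def ginv (u : (Fin n → ℝ) → ℝ) (x : Fin n → ℝ) : Matrix (Fin n) (Fin n) ℝ :=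
  (hessian u x)⁻¹

/-- Third iterated partial derivative `u_{,ijk}`. -/
def d3 (u : (Fin n → ℝ) → ℝ) (i j k : Fin n) : (Fin n → ℝ) → ℝ :=
  pd i (pd j (pd k u))

/-- Fourth iterated partial derivative `u_{,ijkl}`. -/
def d4 (u : (Fin n → ℝ) → ℝ) (i j k l : Fin n) : (Fin n → ℝ) → ℝ :=
  pd i (pd j (pd k (pd l u)))

/-- Christoffel symbols `Γ^k_{ij} = (1/2) g^{kl}(∂_i g_{jl} + ∂_j g_{il} − ∂_l g_{ij})`. -/
def Christoffel (u : (Fin n → ℝ) → ℝ) (k i j : Fin n) : (Fin n → ℝ) → ℝ :=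
  fun x => (1/2) * ∑ l, ginv u x k l * (d3 u i j l x + d3 u j i l x - d3 u l i j x)

/-- Riemann curvature tensor
`Rm_{ijkl} = g_{is}(∂_k Γ^s_{lj} − ∂_l Γ^s_{kj} + Γ^s_{kp} Γ^p_{lj} − Γ^s_{lp} Γ^p_{kj})`. -/
def Rm (u : (Fin n → ℝ) → ℝ) (i j k l : Fin n) : (Fin n → ℝ) → ℝ :=
  fun x => ∑ s, hessian u x i s *
    (pd k (Christoffel u s l j) x - pd l (Christoffel u s k j) x
      + ∑ p, Christoffel u s k p x * Christoffel u p l j x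
      - ∑ p, Christoffel u s l p x * Christoffel u p k j x)

/-- Ricci tensor `Ric_{ij} = ∂_k Γ^k_{ij} − ∂_j Γ^k_{ik} + Γ^k_{kp} Γ^p_{ij} − Γ^k_{jp} Γ^p_{ik}`. -/
def Ricci (u : (Fin n → ℝ) → ℝ) (i j : Fin n) : (Fin n → ℝ) → ℝ :=
  fun x => (∑ k, pd k (Christoffel u k i j) x) - (∑ k, pd j (Christoffel u k i k) x)
    + (∑ k, ∑ p, Christoffel u k k p x * Christoffel u p i j x)
    - (∑ k, ∑ p, Christoffel u k j p x * Christoffel u p i k x)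

/-- Scalar curvature `s = g^{ij} Ric_{ij}`. -/
def scalarCurv (u : (Fin n → ℝ) → ℝ) : (Fin n → ℝ) → ℝ :=
  fun x => ∑ i, ∑ j, ginv u x i j * Ricci u i j x

/-- Covariant Hessian `(∇²φ)_{ij} = φ_{,ij} − Γ^k_{ij} φ_{,k}`. -/
def covHess (u φ : (Fin n → ℝ) → ℝ) (i j : Fin n) : (Fin n → ℝ) → ℝ :=
  fun x => pd i (pd j φ) x - ∑ k, Christoffel u k i j x * pd k φ x

/-- Laplace–Beltrami operator `Δφ = g^{ij} (∇²φ)_{ij}`. -/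
def laplacian (u φ : (Fin n → ℝ) → ℝ) : (Fin n → ℝ) → ℝ :=
  fun x => ∑ i, ∑ j, ginv u x i j * covHess u φ i j x

/-- Weighted (drift) Laplacian `Δ_φ F = ΔF − g^{ij} φ_{,i} F_{,j}`. -/
def driftLap (u φ F : (Fin n → ℝ) → ℝ) : (Fin n → ℝ) → ℝ :=
  fun x => laplacian u F x - ∑ i, ∑ j, ginv u x i j * pd i φ x * pd j F x

/-- Bakry–Émery Ricci tensor `(Ric_φ)_{ij} = Ric_{ij} + (∇²φ)_{ij}`. -/
def ricciPhi (u φ : (Fin n → ℝ) → ℝ) (i j : Fin n) : (Fin n → ℝ) → ℝ :=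
  fun x => Ricci u i j x + covHess u φ i j x

/-- Pointwise squared `g`-norm of the third derivative tensor:
`|u_{,ijk}|²_g = g^{ip} g^{jq} g^{kr} u_{,ijk} u_{,pqr}`. -/
def norm3 (u : (Fin n → ℝ) → ℝ) : (Fin n → ℝ) → ℝ :=
  fun x => ∑ i, ∑ j, ∑ k, ∑ p, ∑ q, ∑ r,
    ginv u x i p * ginv u x j q * ginv u x k r * d3 u i j k x * d3 u p q r x

/-- The canonical weight function `φ = (1/2)(u_{,p} ξ^p + v_q x^q)`. -/
def weight (u : (Fin n → ℝ) → ℝ) (ξ v : Fin n → ℝ) : (Fin n → ℝ) → ℝ :=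
  fun x => (1/2) * ((∑ p, pd p u x * ξ p) + ∑ q, v q * x q)

/-- `u` solves the weighted Monge–Ampère equation
`log det g(x) = −v_p x^p + u_{,q}(x) ξ^q + c` on `N`. -/
def MAeq (u : (Fin n → ℝ) → ℝ) (N : Set (Fin n → ℝ)) (v ξ : Fin n → ℝ) (c : ℝ) : Prop :=
  ∀ x ∈ N, Real.log (hessian u x).det = -(∑ p, v p * x p) + (∑ q, pd q u x * ξ q) + c

/-- Covariant derivative of the third derivative tensor:
`(∇T)_{lijk} = u_{,ijkl} − Γ^s_{li} u_{,sjk} − Γ^s_{lj} u_{,isk} − Γ^s_{lk} u_{,ijs}`. -/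
def covT (u : (Fin n → ℝ) → ℝ) (l i j k : Fin n) : (Fin n → ℝ) → ℝ :=
  fun x => d4 u i j k l x - (∑ s, Christoffel u s l i x * d3 u s j k x)
    - (∑ s, Christoffel u s l j x * d3 u i s k x)
    - (∑ s, Christoffel u s l k x * d3 u i j s x)

/-- Completeness of the Hessian metric `g = D²u` on `N`: every C¹ curve
`γ : [0,1) → N` that eventually leaves every compact subset of `N`
has infinite `g`-length. -/
def HessComplete (u : (Fin n → ℝ) → ℝ) (N : Set (Fin n → ℝ)) : Prop :=
  ∀ γ : ℝ → (Fin n → ℝ),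
    ContDiffOn ℝ 1 γ (Set.Ico (0:ℝ) 1) →
    (∀ t ∈ Set.Ico (0:ℝ) 1, γ t ∈ N) →
    (∀ K : Set (Fin n → ℝ), IsCompact K → K ⊆ N →
      ∃ tK ∈ Set.Ico (0:ℝ) 1, ∀ t ∈ Set.Ioo tK 1, γ t ∉ K) →
    ∫⁻ t in Set.Ioo (0:ℝ) 1,
      ENNReal.ofReal (Real.sqrt (∑ i, ∑ j,
        hessian u (γ t) i j * deriv γ t i * deriv γ t j)) = ⊤

section LinearODE

open Set MeasureTheory

variable {F : Type*} [NormedAddCommGroup F] [NormedSpace ℝ F]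

/-- The successive terms of the Picard series of the linear equation `x' = A x`, `x 0 = x₀`. -/
def picardTerm (A : ℝ → F →L[ℝ] F) (x₀ : F) : ℕ → ℝ → F
  | 0 => fun _ => x₀
  | k + 1 => fun t => ∫ s in (0 : ℝ)..t, A s (picardTerm A x₀ k s)

variable [CompleteSpace F] {A : ℝ → F →L[ℝ] F}

theorem picardTerm_hasDerivAt (hA : Continuous A) (x₀ : F) (k : ℕ) :
    Continuous (picardTerm A x₀ k) ∧
      ∀ t, HasDerivAt (picardTerm A x₀ (k + 1)) (A t (picardTerm A x₀ k t)) t := by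
  induction k with
  | zero =>
    refine ⟨continuous_const, fun t => ?_⟩
    have hc : Continuous fun s => A s (picardTerm A x₀ 0 s) := hA.clm_apply continuous_const
    exact (hc.integral_hasStrictDerivAt 0 t).hasDerivAt
  | succ k ih =>
    have h1 : Continuous (picardTerm A x₀ (k + 1)) :=
      continuous_iff_continuousAt.2 fun t => (ih.2 t).continuousAt
    refine ⟨h1, fun t => ?_⟩
    have hc : Continuous fun s => A s (picardTerm A x₀ (k + 1) s) := hA.clm_apply h1
    exact (hc.integral_hasStrictDerivAt 0 t).hasDerivAt

theorem norm_picardTerm_le (hA : Continuous A) (x₀ : F) {m C : ℝ} (hC : 0 ≤ C)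
    (hAC : ∀ t, |t| ≤ m → ‖A t‖ ≤ C) (k : ℕ) :
    ∀ t, |t| ≤ m → ‖picardTerm A x₀ k t‖ ≤ C ^ k * |t| ^ k / k.factorial * ‖x₀‖ := by
  induction k with
  | zero => intro t _; simp [picardTerm]
  | succ k ih =>
    intro t ht
    have hc : Continuous fun s => A s (picardTerm A x₀ k s) :=
      hA.clm_apply (picardTerm_hasDerivAt hA x₀ k).1
    have hg : Continuous fun s : ℝ => C ^ (k + 1) / k.factorial * ‖x₀‖ * |s - 0| ^ k := by
      fun_prop
    calc ‖picardTerm A x₀ (k + 1) t‖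
        ≤ ∫ s in uIoc 0 t, ‖A s (picardTerm A x₀ k s)‖ :=
          intervalIntegral.norm_integral_le_integral_norm_uIoc
      _ ≤ ∫ s in uIoc 0 t, C ^ (k + 1) / k.factorial * ‖x₀‖ * |s - 0| ^ k := by
          refine setIntegral_mono_on ?_ ?_ measurableSet_uIoc ?_
          · exact (intervalIntegrable_iff.1 (hc.norm.intervalIntegrable 0 t))
          · exact (intervalIntegrable_iff.1 (hg.intervalIntegrable 0 t))
          · intro s hs
            have hs' : |s| ≤ m := by
              rw [mem_uIoc] at hs
              rw [abs_le] at ht ⊢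
              rcases hs with hs | hs <;> constructor <;> linarith
            calc ‖A s (picardTerm A x₀ k s)‖ ≤ ‖A s‖ * ‖picardTerm A x₀ k s‖ :=
                  (A s).le_opNorm _
              _ ≤ C * (C ^ k * |s| ^ k / k.factorial * ‖x₀‖) :=
                  mul_le_mul (hAC s hs') (ih s hs') (norm_nonneg _) hC
              _ = _ := by rw [sub_zero]; ring
      _ = _ := by
          rw [integral_const_mul, integral_pow_abs_sub_uIoc, Nat.factorial_succ]
          push_cast
          have : (k.factorial : ℝ) ≠ 0 := by positivity
          rw [sub_zero]
          field_simp

/-- Global existence for linear ordinary differential equations. -/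
theorem exists_linear_ode (hA : Continuous A) (x₀ : F) :
    ∃ x : ℝ → F, x 0 = x₀ ∧ ∀ t, HasDerivAt x (A t (x t)) t := by
  have key : ∀ t, Summable (fun k => picardTerm A x₀ k t) ∧
      HasDerivAt (fun z => ∑' k, picardTerm A x₀ k z) (A t (∑' k, picardTerm A x₀ k t)) t := by
    intro t
    obtain ⟨m, hm, htm⟩ : ∃ m : ℝ, 0 ≤ m ∧ |t| < m := ⟨|t| + 1, by positivity, by simp⟩
    obtain ⟨C, hC⟩ := (isCompact_Icc (a := -m) (b := m)).exists_bound_of_continuousOn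
      hA.continuousOn
    have hAC : ∀ s, |s| ≤ m → ‖A s‖ ≤ max C 0 := fun s hs =>
      (hC s (abs_le.1 hs)).trans (le_max_left _ _)
    have hC0 : (0 : ℝ) ≤ max C 0 := le_max_right _ _
    generalize max C 0 = D at hAC hC0
    have hb := norm_picardTerm_le hA x₀ hC0 hAC
    have hexp : Summable fun k : ℕ => (D * m) ^ k / k.factorial * ‖x₀‖ :=
      (Real.summable_pow_div_factorial (D * m)).mul_right _
    have hbm : ∀ k s, |s| ≤ m → ‖picardTerm A x₀ k s‖ ≤ (D * m) ^ k / k.factorial * ‖x₀‖ := by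
      intro k s hs
      refine (hb k s hs).trans ?_
      rw [mul_pow]
      gcongr
    have hsum : ∀ s, |s| ≤ m → Summable (fun k => picardTerm A x₀ k s) := fun s hs =>
      Summable.of_norm_bounded hexp fun k => hbm k s hs
    refine ⟨hsum t htm.le, ?_⟩
    have hd : ∀ (k : ℕ) (y : ℝ), y ∈ Ioo (-m) m → HasDerivAt (picardTerm A x₀ k)
        (Nat.casesOn k 0 fun j => A y (picardTerm A x₀ j y)) y := by
      intro k y _
      cases k with
      | zero => exact hasDerivAt_const y x₀
      | succ j => exact (picardTerm_hasDerivAt hA x₀ j).2 y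
    have hu : Summable (fun k : ℕ => (Nat.casesOn k 0
        fun j => D * ((D * m) ^ j / j.factorial * ‖x₀‖) : ℝ)) := by
      rw [← summable_nat_add_iff 1]
      exact hexp.mul_left D
    have hmain := hasDerivAt_tsum_of_isPreconnected hu isOpen_Ioo isPreconnected_Ioo hd
      (y₀ := t) (y := t) ?_ (abs_lt.1 htm) (hsum t htm.le) (abs_lt.1 htm)
    · have hs := (A t).hasSum (hsum t htm.le).hasSum
      convert hmain using 1
      refine Eq.symm ((Summable.tsum_eq_zero_add ?_).trans ?_)
      · rw [← summable_nat_add_iff 1]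
        exact hs.summable
      · exact (zero_add _).trans hs.tsum_eq
    · intro k y hy
      have hy' : |y| ≤ m := (abs_lt.2 hy).le
      cases k with
      | zero => simp
      | succ j =>
        exact ((A y).le_opNorm _).trans
          (mul_le_mul (hAC y hy') (hbm j y hy') (norm_nonneg _) hC0)
  refine ⟨fun t => ∑' k, picardTerm A x₀ k t, ?_, fun t => (key t).2⟩
  show ∑' k, picardTerm A x₀ k 0 = x₀
  rw [(key 0).1.tsum_eq_zero_add]
  simp [picardTerm]

end LinearODE

section Tensors

open Set Filter Topology

variable {E : Type*} [NormedAddCommGroup E] [NormedSpace ℝ E]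

/-- Continuous linear forms on `E`, with its operator norm. -/
def L1 (E : Type*) [NormedAddCommGroup E] [NormedSpace ℝ E] := E →L[ℝ] ℝ

instance : NormedAddCommGroup (L1 E) := inferInstanceAs (NormedAddCommGroup (E →L[ℝ] ℝ))
instance : NormedSpace ℝ (L1 E) := inferInstanceAs (NormedSpace ℝ (E →L[ℝ] ℝ))

/-- Continuous bilinear forms on `E`, with its operator norm. -/
def L2 (E : Type*) [NormedAddCommGroup E] [NormedSpace ℝ E] := E →L[ℝ] L1 E

instance : NormedAddCommGroup (L2 E) := inferInstanceAs (NormedAddCommGroup (E →L[ℝ] L1 E))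
instance : NormedSpace ℝ (L2 E) := inferInstanceAs (NormedSpace ℝ (E →L[ℝ] L1 E))

/-- Continuous trilinear forms on `E`, with its operator norm. -/
def L3 (E : Type*) [NormedAddCommGroup E] [NormedSpace ℝ E] := E →L[ℝ] L2 E

instance : NormedAddCommGroup (L3 E) := inferInstanceAs (NormedAddCommGroup (E →L[ℝ] L2 E))
instance : NormedSpace ℝ (L3 E) := inferInstanceAs (NormedSpace ℝ (E →L[ℝ] L2 E))

/-- Continuous quadrilinear forms on `E`, with its operator norm. -/
def L4 (E : Type*) [NormedAddCommGroup E] [NormedSpace ℝ E] := E →L[ℝ] L3 E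

instance : NormedAddCommGroup (L4 E) := inferInstanceAs (NormedAddCommGroup (E →L[ℝ] L3 E))
instance : NormedSpace ℝ (L4 E) := inferInstanceAs (NormedSpace ℝ (E →L[ℝ] L3 E))

/-- Unfolding linear forms, as a linear map. -/
def L1.linL (E : Type*) [NormedAddCommGroup E] [NormedSpace ℝ E] : L1 E →L[ℝ] (E →L[ℝ] ℝ) :=
  ContinuousLinearMap.id ℝ (E →L[ℝ] ℝ)

/-- Unfolding bilinear forms, as a linear map. -/
def L2.linL (E : Type*) [NormedAddCommGroup E] [NormedSpace ℝ E] : L2 E →L[ℝ] (E →L[ℝ] L1 E) :=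
  ContinuousLinearMap.id ℝ (E →L[ℝ] L1 E)

/-- Unfolding trilinear forms, as a linear map. -/
def L3.linL (E : Type*) [NormedAddCommGroup E] [NormedSpace ℝ E] : L3 E →L[ℝ] (E →L[ℝ] L2 E) :=
  ContinuousLinearMap.id ℝ (E →L[ℝ] L2 E)

/-- Unfolding quadrilinear forms, as a linear map. -/
def L4.linL (E : Type*) [NormedAddCommGroup E] [NormedSpace ℝ E] : L4 E →L[ℝ] (E →L[ℝ] L3 E) :=
  ContinuousLinearMap.id ℝ (E →L[ℝ] L3 E)

variable (u : E → ℝ)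

/-- First derivative. -/
def u1 : E → L1 E := fun x => fderiv ℝ u x

/-- Second derivative. -/
def u2 : E → L2 E := fun x => fderiv ℝ (u1 u) x

/-- Third derivative. -/
def u3 : E → L3 E := fun x => fderiv ℝ (u2 u) x

/-- Fourth derivative. -/
def u4 : E → L4 E := fun x => fderiv ℝ (u3 u) x

/-- Fifth derivative. -/
def u5 : E → E →L[ℝ] L4 E := fun x => fderiv ℝ (u4 u) x

/-- Evaluation of linear forms. -/
def ev1 (f : L1 E) (a : E) : ℝ := L1.linL E f a

/-- Evaluation of bilinear forms. -/
def ev2 (f : L2 E) (a b : E) : ℝ := ev1 (L2.linL E f a) b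

/-- Evaluation of trilinear forms. -/
def ev3 (f : L3 E) (a b c : E) : ℝ := ev2 (L3.linL E f a) b c

/-- Evaluation of quadrilinear forms. -/
def ev4 (f : L4 E) (a b c d : E) : ℝ := ev3 (L4.linL E f a) b c d

/-- The Hessian of `u`. -/
def G (x a b : E) : ℝ := ev2 (u2 u x) a b

/-- The third derivative of `u`. -/
def T (x a b c : E) : ℝ := ev3 (u3 u x) a b c

/-- The fourth derivative of `u`. -/
def Q (x a b c d : E) : ℝ := ev4 (u4 u x) a b c d

/-- The fifth derivative of `u`. -/
def P (x a b c d e : E) : ℝ := ev4 (u5 u x a) b c d e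

/-- `u` is smooth with positive definite Hessian on the open set `N`. -/
structure HessianMetric (N : Set E) (u : E → ℝ) : Prop where
  isOpen : IsOpen N
  smooth : ContDiffOn ℝ (⊤ : ℕ∞) u N
  pos : ∀ x ∈ N, ∀ a, a ≠ 0 → 0 < G u x a a

theorem ev1_add (f f' : L1 E) (a : E) : ev1 (f + f') a = ev1 f a + ev1 f' a := by simp [ev1]
theorem ev2_add (f f' : L2 E) (a b : E) : ev2 (f + f') a b = ev2 f a b + ev2 f' a b := by
  simp [ev2, ev1]
theorem ev3_add (f f' : L3 E) (a b c : E) : ev3 (f + f') a b c = ev3 f a b c + ev3 f' a b c := by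
  simp [ev3, ev2, ev1]

section Linear

variable (x a b c d a' b' c' d' : E) (r : ℝ) {ι : Type*} (s : Finset ι) (f : ι → E)

theorem G_add₁ : G u x (a + a') b = G u x a b + G u x a' b := by simp [G, ev2, ev1]
theorem G_add₂ : G u x a (b + b') = G u x a b + G u x a b' := by simp [G, ev2, ev1]
theorem G_smul₁ : G u x (r • a) b = r * G u x a b := by simp [G, ev2, ev1]
theorem G_smul₂ : G u x a (r • b) = r * G u x a b := by simp [G, ev2, ev1]
theorem G_sum₁ : G u x (∑ i ∈ s, f i) b = ∑ i ∈ s, G u x (f i) b := by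
  simp [G, ev2, ev1, map_sum]
theorem G_sum₂ : G u x a (∑ i ∈ s, f i) = ∑ i ∈ s, G u x a (f i) := by
  simp [G, ev2, ev1, map_sum]

theorem T_add₃ : T u x a b (c + c') = T u x a b c + T u x a b c' := by simp [T, ev3, ev2, ev1]
theorem T_smul₁ : T u x (r • a) b c = r * T u x a b c := by simp [T, ev3, ev2, ev1]
theorem T_smul₂ : T u x a (r • b) c = r * T u x a b c := by simp [T, ev3, ev2, ev1]
theorem T_smul₃ : T u x a b (r • c) = r * T u x a b c := by simp [T, ev3, ev2, ev1]
theorem T_sum₁ : T u x (∑ i ∈ s, f i) b c = ∑ i ∈ s, T u x (f i) b c := by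
  simp [T, ev3, ev2, ev1, map_sum]
theorem T_sum₂ : T u x a (∑ i ∈ s, f i) c = ∑ i ∈ s, T u x a (f i) c := by
  simp [T, ev3, ev2, ev1, map_sum]
theorem T_sum₃ : T u x a b (∑ i ∈ s, f i) = ∑ i ∈ s, T u x a b (f i) := by
  simp [T, ev3, ev2, ev1, map_sum]

theorem Q_smul₁ : Q u x (r • a) b c d = r * Q u x a b c d := by
  simp [Q, ev4, ev3, ev2, ev1]
theorem Q_smul₂ : Q u x a (r • b) c d = r * Q u x a b c d := by
  simp [Q, ev4, ev3, ev2, ev1]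
theorem Q_smul₃ : Q u x a b (r • c) d = r * Q u x a b c d := by
  simp [Q, ev4, ev3, ev2, ev1]
theorem Q_smul₄ : Q u x a b c (r • d) = r * Q u x a b c d := by
  simp [Q, ev4, ev3, ev2, ev1]
theorem Q_sum₂ : Q u x a (∑ i ∈ s, f i) c d = ∑ i ∈ s, Q u x a (f i) c d := by
  simp [Q, ev4, ev3, ev2, ev1, map_sum]
theorem Q_sum₃ : Q u x a b (∑ i ∈ s, f i) d = ∑ i ∈ s, Q u x a b (f i) d := by
  simp [Q, ev4, ev3, ev2, ev1, map_sum]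
theorem Q_sum₄ : Q u x a b c (∑ i ∈ s, f i) = ∑ i ∈ s, Q u x a b c (f i) := by
  simp [Q, ev4, ev3, ev2, ev1, map_sum]

end Linear

theorem G_zero₁ (u : E → ℝ) (x b : E) : G u x 0 b = 0 := by simpa using G_smul₁ u x 0 b 0
theorem G_zero₂ (u : E → ℝ) (x a : E) : G u x a 0 = 0 := by simpa using G_smul₂ u x a 0 0
theorem T_zero₁ (u : E → ℝ) (x b c : E) : T u x 0 b c = 0 := by simpa using T_smul₁ u x 0 b c 0
theorem T_zero₂ (u : E → ℝ) (x a c : E) : T u x a 0 c = 0 := by simpa using T_smul₂ u x a 0 c 0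
theorem T_zero₃ (u : E → ℝ) (x a b : E) : T u x a b 0 = 0 := by simpa using T_smul₃ u x a b 0 0
theorem Q_zero₁ (u : E → ℝ) (x b c d : E) : Q u x 0 b c d = 0 := by
  simpa using Q_smul₁ u x 0 b c d 0
theorem Q_zero₂ (u : E → ℝ) (x a c d : E) : Q u x a 0 c d = 0 := by
  simpa using Q_smul₂ u x a 0 c d 0

section Derivatives

variable {u} {N : Set E} {x : E}

theorem contDiffAt_fderiv_of_smooth {V : Type*} [NormedAddCommGroup V] [NormedSpace ℝ V]
    {f : E → V} (hf : ContDiffAt ℝ (⊤ : ℕ∞) f x) :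
    ContDiffAt ℝ (⊤ : ℕ∞) (fun y => fderiv ℝ f y) x :=
  hf.fderiv_right (m := (⊤ : ℕ∞)) (by simp)

namespace HessianMetric

theorem contDiffAt_u (h : HessianMetric N u) (hx : x ∈ N) : ContDiffAt ℝ (⊤ : ℕ∞) u x :=
  h.smooth.contDiffAt (h.isOpen.mem_nhds hx)

theorem contDiffAt_u1 (h : HessianMetric N u) (hx : x ∈ N) : ContDiffAt ℝ (⊤ : ℕ∞) (u1 u) x :=
  contDiffAt_fderiv_of_smooth (h.contDiffAt_u hx)

theorem contDiffAt_u2 (h : HessianMetric N u) (hx : x ∈ N) : ContDiffAt ℝ (⊤ : ℕ∞) (u2 u) x :=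
  contDiffAt_fderiv_of_smooth (h.contDiffAt_u1 hx)

theorem contDiffAt_u3 (h : HessianMetric N u) (hx : x ∈ N) : ContDiffAt ℝ (⊤ : ℕ∞) (u3 u) x :=
  contDiffAt_fderiv_of_smooth (h.contDiffAt_u2 hx)

theorem contDiffAt_u4 (h : HessianMetric N u) (hx : x ∈ N) : ContDiffAt ℝ (⊤ : ℕ∞) (u4 u) x :=
  contDiffAt_fderiv_of_smooth (h.contDiffAt_u3 hx)

end HessianMetric

section Eval

variable {X : Type*} [NormedAddCommGroup X] [NormedSpace ℝ X] {y : X}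
  {k : WithTop ℕ∞} {a b c d : X → E}

theorem contDiffAt_ev1 {f : X → L1 E} (hf : ContDiffAt ℝ k f y)
    (ha : ContDiffAt ℝ k a y) : ContDiffAt ℝ k (fun z => ev1 (f z) (a z)) y :=
  ((L1.linL E).contDiff.contDiffAt.comp y hf).clm_apply ha

theorem contDiffAt_ev2 {f : X → L2 E} (hf : ContDiffAt ℝ k f y)
    (ha : ContDiffAt ℝ k a y) (hb : ContDiffAt ℝ k b y) :
    ContDiffAt ℝ k (fun z => ev2 (f z) (a z) (b z)) y :=
  contDiffAt_ev1 (((L2.linL E).contDiff.contDiffAt.comp y hf).clm_apply ha) hb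

theorem contDiffAt_ev3 {f : X → L3 E} (hf : ContDiffAt ℝ k f y)
    (ha : ContDiffAt ℝ k a y) (hb : ContDiffAt ℝ k b y) (hc : ContDiffAt ℝ k c y) :
    ContDiffAt ℝ k (fun z => ev3 (f z) (a z) (b z) (c z)) y :=
  contDiffAt_ev2 (((L3.linL E).contDiff.contDiffAt.comp y hf).clm_apply ha) hb hc

theorem contDiffAt_ev4 {f : X → L4 E} (hf : ContDiffAt ℝ k f y)
    (ha : ContDiffAt ℝ k a y) (hb : ContDiffAt ℝ k b y) (hc : ContDiffAt ℝ k c y)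
    (hd : ContDiffAt ℝ k d y) :
    ContDiffAt ℝ k (fun z => ev4 (f z) (a z) (b z) (c z) (d z)) y :=
  contDiffAt_ev3 (((L4.linL E).contDiff.contDiffAt.comp y hf).clm_apply ha) hb hc hd

end Eval

section EvalDeriv

variable {t : ℝ} {a b c d : ℝ → E} {a' b' c' d' : E}

theorem hasDerivAt_ev1 {f : ℝ → L1 E} {f' : L1 E} (hf : HasDerivAt f f' t)
    (ha : HasDerivAt a a' t) :
    HasDerivAt (fun s => ev1 (f s) (a s)) (ev1 f' (a t) + ev1 (f t) a') t :=
  (((L1.linL E).hasFDerivAt.comp_hasDerivAt t hf)).clm_apply ha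

theorem hasDerivAt_ev2 {f : ℝ → L2 E} {f' : L2 E} (hf : HasDerivAt f f' t)
    (ha : HasDerivAt a a' t) (hb : HasDerivAt b b' t) :
    HasDerivAt (fun s => ev2 (f s) (a s) (b s))
      (ev2 f' (a t) (b t) + ev2 (f t) a' (b t) + ev2 (f t) (a t) b') t := by
  have h := hasDerivAt_ev1 (((L2.linL E).hasFDerivAt.comp_hasDerivAt t hf).clm_apply ha) hb
  rw [ev1_add] at h
  exact h

theorem hasDerivAt_ev3 {f : ℝ → L3 E} {f' : L3 E} (hf : HasDerivAt f f' t)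
    (ha : HasDerivAt a a' t) (hb : HasDerivAt b b' t) (hc : HasDerivAt c c' t) :
    HasDerivAt (fun s => ev3 (f s) (a s) (b s) (c s))
      (ev3 f' (a t) (b t) (c t) + ev3 (f t) a' (b t) (c t) + ev3 (f t) (a t) b' (c t)
        + ev3 (f t) (a t) (b t) c') t := by
  have h := hasDerivAt_ev2 (((L3.linL E).hasFDerivAt.comp_hasDerivAt t hf).clm_apply ha) hb hc
  rw [ev2_add] at h
  exact h

theorem hasDerivAt_ev4 {f : ℝ → L4 E} {f' : L4 E} (hf : HasDerivAt f f' t)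
    (ha : HasDerivAt a a' t) (hb : HasDerivAt b b' t) (hc : HasDerivAt c c' t)
    (hd : HasDerivAt d d' t) :
    HasDerivAt (fun s => ev4 (f s) (a s) (b s) (c s) (d s))
      (ev4 f' (a t) (b t) (c t) (d t) + ev4 (f t) a' (b t) (c t) (d t)
        + ev4 (f t) (a t) b' (c t) (d t) + ev4 (f t) (a t) (b t) c' (d t)
        + ev4 (f t) (a t) (b t) (c t) d') t := by
  have h := hasDerivAt_ev3 (((L4.linL E).hasFDerivAt.comp_hasDerivAt t hf).clm_apply ha) hb hc hd
  rw [ev3_add] at h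
  exact h

end EvalDeriv

namespace HessianMetric

section Smooth

variable {X : Type*} [NormedAddCommGroup X] [NormedSpace ℝ X] {y : X} {p a b c d : X → E}

theorem contDiffAt_G (h : HessianMetric N u) (hy : p y ∈ N) (hp : ContDiffAt ℝ (⊤ : ℕ∞) p y)
    (ha : ContDiffAt ℝ (⊤ : ℕ∞) a y) (hb : ContDiffAt ℝ (⊤ : ℕ∞) b y) :
    ContDiffAt ℝ (⊤ : ℕ∞) (fun z => G u (p z) (a z) (b z)) y :=
  contDiffAt_ev2 ((h.contDiffAt_u2 hy).comp y hp) ha hb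

theorem contDiffAt_T (h : HessianMetric N u) (hy : p y ∈ N) (hp : ContDiffAt ℝ (⊤ : ℕ∞) p y)
    (ha : ContDiffAt ℝ (⊤ : ℕ∞) a y) (hb : ContDiffAt ℝ (⊤ : ℕ∞) b y)
    (hc : ContDiffAt ℝ (⊤ : ℕ∞) c y) :
    ContDiffAt ℝ (⊤ : ℕ∞) (fun z => T u (p z) (a z) (b z) (c z)) y :=
  contDiffAt_ev3 ((h.contDiffAt_u3 hy).comp y hp) ha hb hc

theorem contDiffAt_Q (h : HessianMetric N u) (hy : p y ∈ N) (hp : ContDiffAt ℝ (⊤ : ℕ∞) p y)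
    (ha : ContDiffAt ℝ (⊤ : ℕ∞) a y) (hb : ContDiffAt ℝ (⊤ : ℕ∞) b y)
    (hc : ContDiffAt ℝ (⊤ : ℕ∞) c y) (hd : ContDiffAt ℝ (⊤ : ℕ∞) d y) :
    ContDiffAt ℝ (⊤ : ℕ∞) (fun z => Q u (p z) (a z) (b z) (c z) (d z)) y :=
  contDiffAt_ev4 ((h.contDiffAt_u4 hy).comp y hp) ha hb hc hd

end Smooth

section Curves

variable {γ : ℝ → E} {γ' : E} {t : ℝ} {a b c d : ℝ → E} {a' b' c' d' : E}

theorem hasDerivAt_G (h : HessianMetric N u) (hγ : HasDerivAt γ γ' t) (hx : γ t ∈ N)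
    (ha : HasDerivAt a a' t) (hb : HasDerivAt b b' t) :
    HasDerivAt (fun s => G u (γ s) (a s) (b s))
      (T u (γ t) γ' (a t) (b t) + G u (γ t) a' (b t) + G u (γ t) (a t) b') t :=
  hasDerivAt_ev2 (((h.contDiffAt_u2 hx).differentiableAt (by simp)).hasFDerivAt.comp_hasDerivAt t hγ) ha hb

theorem hasDerivAt_T (h : HessianMetric N u) (hγ : HasDerivAt γ γ' t) (hx : γ t ∈ N)
    (ha : HasDerivAt a a' t) (hb : HasDerivAt b b' t) (hc : HasDerivAt c c' t) :
    HasDerivAt (fun s => T u (γ s) (a s) (b s) (c s))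
      (Q u (γ t) γ' (a t) (b t) (c t) + T u (γ t) a' (b t) (c t) + T u (γ t) (a t) b' (c t)
        + T u (γ t) (a t) (b t) c') t :=
  hasDerivAt_ev3 (((h.contDiffAt_u3 hx).differentiableAt (by simp)).hasFDerivAt.comp_hasDerivAt t hγ) ha hb hc

theorem hasDerivAt_Q (h : HessianMetric N u) (hγ : HasDerivAt γ γ' t) (hx : γ t ∈ N)
    (ha : HasDerivAt a a' t) (hb : HasDerivAt b b' t) (hc : HasDerivAt c c' t)
    (hd : HasDerivAt d d' t) :
    HasDerivAt (fun s => Q u (γ s) (a s) (b s) (c s) (d s))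
      (P u (γ t) γ' (a t) (b t) (c t) (d t) + Q u (γ t) a' (b t) (c t) (d t)
        + Q u (γ t) (a t) b' (c t) (d t) + Q u (γ t) (a t) (b t) c' (d t)
        + Q u (γ t) (a t) (b t) (c t) d') t :=
  hasDerivAt_ev4 (((h.contDiffAt_u4 hx).differentiableAt (by simp)).hasFDerivAt.comp_hasDerivAt t hγ)
    ha hb hc hd

end Curves

end HessianMetric

theorem hasDerivAt_line (x w : E) (t : ℝ) : HasDerivAt (fun s : ℝ => x + s • w) w t := by
  simpa using ((hasDerivAt_id t).smul_const w).const_add x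

theorem fderiv_fderiv_symm {V : Type*} [NormedAddCommGroup V] [NormedSpace ℝ V] {f : E → V}
    (hf : ContDiffAt ℝ (⊤ : ℕ∞) f x) (a b : E) :
    fderiv ℝ (fun y => fderiv ℝ f y) x a b = fderiv ℝ (fun y => fderiv ℝ f y) x b a :=
  hf.isSymmSndFDerivAt (by simp; exact WithTop.coe_le_coe.2 le_top) a b

namespace HessianMetric

theorem eventually_line_mem (h : HessianMetric N u) (hx : x ∈ N) (w : E) :
    ∀ᶠ s : ℝ in 𝓝 0, x + s • w ∈ N := by
  have : ContinuousAt (fun s : ℝ => x + s • w) 0 := by fun_prop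
  exact this.eventually_mem (h.isOpen.mem_nhds (by simpa using hx))

theorem G_symm (h : HessianMetric N u) (hx : x ∈ N) (a b : E) : G u x a b = G u x b a :=
  fderiv_fderiv_symm (h.contDiffAt_u hx) a b

theorem T_symm₁₂ (h : HessianMetric N u) (hx : x ∈ N) (a b c : E) :
    T u x a b c = T u x b a c :=
  congrArg (fun f : L1 E => ev1 f c) (fderiv_fderiv_symm (h.contDiffAt_u1 hx) a b)

theorem Q_symm₁₂ (h : HessianMetric N u) (hx : x ∈ N) (a b c d : E) :
    Q u x a b c d = Q u x b a c d :=
  congrArg (fun f : L2 E => ev2 f c d) (fderiv_fderiv_symm (h.contDiffAt_u2 hx) a b)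

theorem P_symm₁₂ (h : HessianMetric N u) (hx : x ∈ N) (a b c d e : E) :
    P u x a b c d e = P u x b a c d e :=
  congrArg (fun f : L3 E => ev3 f c d e) (fderiv_fderiv_symm (h.contDiffAt_u3 hx) a b)


theorem T_symm₂₃ (h : HessianMetric N u) (hx : x ∈ N) (w a b : E) :
    T u x w a b = T u x w b a := by
  have hx' : x + (0 : ℝ) • w ∈ N := by simpa using hx
  have h1 := h.hasDerivAt_G (hasDerivAt_line x w 0) hx' (hasDerivAt_const 0 a) (hasDerivAt_const 0 b)
  have h2 := h.hasDerivAt_G (hasDerivAt_line x w 0) hx' (hasDerivAt_const 0 b) (hasDerivAt_const 0 a)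
  have h3 := h1.unique (h2.congr_of_eventuallyEq ((h.eventually_line_mem hx w).mono
    fun s hs => h.G_symm hs a b))
  simpa [G_zero₁, G_zero₂] using h3

theorem hasDerivAt_T_line (h : HessianMetric N u) (hx : x ∈ N) (w a b c : E) :
    HasDerivAt (fun s : ℝ => T u (x + s • w) a b c) (Q u x w a b c) 0 := by
  have hx' : x + (0 : ℝ) • w ∈ N := by simpa using hx
  simpa [T, ev3, ev2, ev1] using h.hasDerivAt_T (hasDerivAt_line x w 0) hx' (hasDerivAt_const 0 a)
    (hasDerivAt_const 0 b) (hasDerivAt_const 0 c)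

theorem hasDerivAt_Q_line (h : HessianMetric N u) (hx : x ∈ N) (w a b c d : E) :
    HasDerivAt (fun s : ℝ => Q u (x + s • w) a b c d) (P u x w a b c d) 0 := by
  have hx' : x + (0 : ℝ) • w ∈ N := by simpa using hx
  simpa [Q, ev4, ev3, ev2, ev1] using h.hasDerivAt_Q (hasDerivAt_line x w 0) hx'
    (hasDerivAt_const 0 a) (hasDerivAt_const 0 b) (hasDerivAt_const 0 c) (hasDerivAt_const 0 d)

theorem Q_symm₃₄ (h : HessianMetric N u) (hx : x ∈ N) (w a b c : E) :
    Q u x w a b c = Q u x w a c b :=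
  (h.hasDerivAt_T_line hx w a b c).unique ((h.hasDerivAt_T_line hx w a c b).congr_of_eventuallyEq
    ((h.eventually_line_mem hx w).mono fun _ hs => h.T_symm₂₃ hs a b c))

theorem Q_symm₂₃ (h : HessianMetric N u) (hx : x ∈ N) (w a b c : E) :
    Q u x w a b c = Q u x w b a c :=
  (h.hasDerivAt_T_line hx w a b c).unique ((h.hasDerivAt_T_line hx w b a c).congr_of_eventuallyEq
    ((h.eventually_line_mem hx w).mono fun _ hs => h.T_symm₁₂ hs a b c))

theorem P_symm₂₃ (h : HessianMetric N u) (hx : x ∈ N) (w a b c d : E) :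
    P u x w a b c d = P u x w b a c d :=
  (h.hasDerivAt_Q_line hx w a b c d).unique
    ((h.hasDerivAt_Q_line hx w b a c d).congr_of_eventuallyEq
      ((h.eventually_line_mem hx w).mono fun _ hs => h.Q_symm₁₂ hs a b c d))

theorem P_symm₃₄ (h : HessianMetric N u) (hx : x ∈ N) (w a b c d : E) :
    P u x w a b c d = P u x w a c b d :=
  (h.hasDerivAt_Q_line hx w a b c d).unique
    ((h.hasDerivAt_Q_line hx w a c b d).congr_of_eventuallyEq
      ((h.eventually_line_mem hx w).mono fun _ hs => h.Q_symm₂₃ hs a b c d))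

theorem P_symm₄₅ (h : HessianMetric N u) (hx : x ∈ N) (w a b c d : E) :
    P u x w a b c d = P u x w a b d c :=
  (h.hasDerivAt_Q_line hx w a b c d).unique
    ((h.hasDerivAt_Q_line hx w a b d c).congr_of_eventuallyEq
      ((h.eventually_line_mem hx w).mono fun _ hs => h.Q_symm₃₄ hs a b c d))

end HessianMetric

end Derivatives

end Tensors

section Frames

open Set Filter Topology

variable {E : Type*} [NormedAddCommGroup E] [NormedSpace ℝ E]

/-- `e` is an orthonormal family for the Hessian metric of `u` at `x`. -/
def IsFrame {ι : Type*} [DecidableEq ι] (u : E → ℝ) (x : E) (e : ι → E) : Prop :=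
  ∀ a b, G u x (e a) (e b) = if a = b then 1 else 0

variable [FiniteDimensional ℝ E] {ι : Type*} [Fintype ι] [DecidableEq ι]
variable {N : Set E} {u : E → ℝ} {x : E}

theorem IsFrame.expand {e : ι → E} (he : IsFrame u x e)
    (hι : Fintype.card ι = Module.finrank ℝ E) (w : E) : w = ∑ a, G u x (e a) w • e a := by
  have hli : LinearIndependent ℝ e := by
    rw [Fintype.linearIndependent_iff]
    intro c hc a
    have := congrArg (G u x (e a)) hc
    simpa [G_sum₂, G_smul₂, G_zero₂, he a] using this
  rcases isEmpty_or_nonempty ι with hem | hne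
  · have : Module.finrank ℝ E = 0 := by rw [← hι]; simp
    have := Module.finrank_zero_iff.1 this
    exact Subsingleton.elim _ _
  · let b := basisOfLinearIndependentOfCardEqFinrank hli hι
    have hb : ∀ a, b a = e a := fun a => by simp [b]
    have hw := b.sum_repr w
    simp only [hb] at hw
    have hc : ∀ a, G u x (e a) w = b.repr w a := by
      intro a
      conv_lhs => rw [← hw]
      simp [G_sum₂, G_smul₂, he a]
    simp only [hc, hw]

namespace HessianMetric

theorem exists_frame (h : HessianMetric N u) (hx : x ∈ N)
    (hι : Fintype.card ι = Module.finrank ℝ E) : ∃ e : ι → E, IsFrame u x e := by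
  let B : LinearMap.BilinForm ℝ E := LinearMap.mk₂ ℝ (fun a b => G u x a b)
    (fun _ _ _ => G_add₁ ..) (fun _ _ _ => G_smul₁ ..) (fun _ _ _ => G_add₂ ..)
    (fun _ _ _ => G_smul₂ ..)
  have hB : ∀ a b, B a b = G u x a b := fun a b => rfl
  obtain ⟨v, hv⟩ := LinearMap.BilinForm.exists_orthogonal_basis (B := B)
    ⟨fun a b => h.G_symm hx a b⟩
  let σ : ι ≃ Fin (Module.finrank ℝ E) := Fintype.equivFinOfCardEq hι
  have hpos : ∀ k, 0 < G u x (v k) (v k) := fun k => h.pos x hx _ (v.ne_zero k)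
  refine ⟨fun a => (√(G u x (v (σ a)) (v (σ a))))⁻¹ • v (σ a), fun a b => ?_⟩
  simp only [G_smul₁, G_smul₂]
  split_ifs with hab
  · subst hab
    have h1 := Real.mul_self_sqrt (hpos (σ a)).le
    have h2 := (Real.sqrt_pos.2 (hpos (σ a))).ne'
    field_simp
    linarith
  · have h3 : G u x (v (σ a)) (v (σ b)) = 0 := hv (fun hh => hab (σ.injective hh))
    rw [h3]; simp

end HessianMetric

/-- The Hessian as a linear map to the dual space. -/
def gl (u : E → ℝ) (x : E) : E →L[ℝ] (E →L[ℝ] ℝ) := (L1.linL E).comp (L2.linL E (u2 u x))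

/-- The derivative of the Hessian as a linear map to the dual space. -/
def tl (u : E → ℝ) (x w : E) : E →L[ℝ] (E →L[ℝ] ℝ) :=
  (L1.linL E).comp (L2.linL E (L3.linL E (u3 u x) w))

namespace HessianMetric

/-- The metric is an isomorphism onto the dual space. -/
theorem exists_equiv (h : HessianMetric N u) (hx : x ∈ N) :
    ∃ φ : E ≃L[ℝ] (E →L[ℝ] ℝ), (φ : E →L[ℝ] E →L[ℝ] ℝ) = gl u x := by
  have hinj : Function.Injective (gl u x : E →ₗ[ℝ] E →L[ℝ] ℝ) := by
    rw [← LinearMap.ker_eq_bot, LinearMap.ker_eq_bot']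
    intro a ha
    by_contra hne
    have := h.pos x hx a hne
    have h2 : G u x a a = 0 := congrArg (fun f : E →L[ℝ] ℝ => f a) ha
    rw [h2] at this
    simp at this
  have hfr : Module.finrank ℝ E = Module.finrank ℝ (E →L[ℝ] ℝ) := by
    rw [← (LinearMap.toContinuousLinearMap : (E →ₗ[ℝ] ℝ) ≃ₗ[ℝ] (E →L[ℝ] ℝ)).finrank_eq]
    exact (Subspace.dual_finrank_eq).symm
  refine ⟨(LinearEquiv.ofInjectiveOfFinrankEq _ hinj hfr).toContinuousLinearEquiv, ?_⟩
  ext a b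
  rfl

/-- Parallel transport of orthonormal frames along a `C¹` curve. -/
theorem exists_parallel_frame (h : HessianMetric N u)
    (hι : Fintype.card ι = Module.finrank ℝ E) {γ γ' : ℝ → E}
    (hγ : ∀ t, HasDerivAt γ (γ' t) t) (hγ' : Continuous γ') (hN : ∀ t, γ t ∈ N)
    {e₀ : ι → E} (he₀ : IsFrame u (γ 0) e₀) :
    ∃ e : ι → ℝ → E, (∀ a, e a 0 = e₀ a) ∧ (∀ t, IsFrame u (γ t) fun a => e a t) ∧
      ∀ a t, HasDerivAt (e a) (∑ b, (-(1 / 2 : ℝ) * T u (γ t) (γ' t) (e a t) (e b t)) • e b t) t := by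
  have hγc : Continuous γ := continuous_iff_continuousAt.2 fun t => (hγ t).continuousAt
  let A : ℝ → E →L[ℝ] E := fun t =>
    -(1 / 2 : ℝ) • (ContinuousLinearMap.inverse (gl u (γ t))).comp (tl u (γ t) (γ' t))
  have hAg : ∀ t a b, G u (γ t) (A t a) b = -(1 / 2) * T u (γ t) (γ' t) a b := by
    intro t a b
    obtain ⟨φ, hφ⟩ := h.exists_equiv (hN t)
    have : gl u (γ t) (ContinuousLinearMap.inverse (gl u (γ t)) (tl u (γ t) (γ' t) a))
        = tl u (γ t) (γ' t) a := by
      rw [← hφ, ContinuousLinearMap.inverse_equiv]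
      simp
    have h2 : G u (γ t) (ContinuousLinearMap.inverse (gl u (γ t)) (tl u (γ t) (γ' t) a)) b
        = T u (γ t) (γ' t) a b := congrArg (fun f : E →L[ℝ] ℝ => f b) this
    simp only [A, smul_apply, ContinuousLinearMap.comp_apply, G_smul₁, h2]
  have hA : Continuous A := by
    have h1 : Continuous fun t => ContinuousLinearMap.inverse (gl u (γ t)) := by
      rw [continuous_iff_continuousAt]
      intro t
      obtain ⟨φ, hφ⟩ := h.exists_equiv (hN t)
      have h2 : ContinuousAt ContinuousLinearMap.inverse (gl u (γ t)) := by
        rw [← hφ]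
        exact (contDiffAt_map_inverse (n := 1) φ).continuousAt
      have h4 : ContinuousAt (fun t => L2.linL E (u2 u (γ t))) t :=
        (L2.linL E).continuous.continuousAt.comp
          (ContinuousAt.comp (f := γ) (h.contDiffAt_u2 (hN t)).continuousAt hγc.continuousAt)
      exact ContinuousAt.comp (f := fun t => gl u (γ t)) h2 (continuousAt_const.clm_comp h4)
    have h3 : Continuous fun t => tl u (γ t) (γ' t) := by
      have h4 : Continuous fun t => L3.linL E (u3 u (γ t)) := by
        rw [continuous_iff_continuousAt]
        intro t
        exact (L3.linL E).continuous.continuousAt.comp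
          (ContinuousAt.comp (f := γ) (h.contDiffAt_u3 (hN t)).continuousAt hγc.continuousAt)
      exact continuous_const.clm_comp ((L2.linL E).continuous.comp (h4.clm_apply hγ'))
    exact (h1.clm_comp h3).const_smul (-(1 / 2 : ℝ))
  have : CompleteSpace E := FiniteDimensional.complete ℝ E
  choose e he0 hed using fun a => exists_linear_ode hA (e₀ a)
  have hframe : ∀ t, IsFrame u (γ t) fun a => e a t := by
    intro t a b
    have hd : ∀ s, HasDerivAt (fun s => G u (γ s) (e a s) (e b s)) 0 s := by
      intro s
      convert h.hasDerivAt_G (hγ s) (hN s) (hed a s) (hed b s) using 1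
      rw [hAg, h.G_symm (hN s) (e a s), hAg, h.T_symm₂₃ (hN s) _ (e b s)]
      ring
    have hc := is_const_of_deriv_eq_zero (fun s => (hd s).differentiableAt)
      (fun s => (hd s).deriv) t 0
    simp only [hc, he0]
    exact he₀ a b
  refine ⟨e, he0, hframe, fun a t => ?_⟩
  convert hed a t using 1
  conv_rhs => rw [(hframe t).expand hι (A t (e a t))]
  refine Finset.sum_congr rfl fun b _ => ?_
  rw [h.G_symm (hN t), hAg]

end HessianMetric

end Frames

section Identities

open Set Filter Topology

variable {E : Type*} [NormedAddCommGroup E] [NormedSpace ℝ E]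
variable {ι : Type*} [Fintype ι] [DecidableEq ι]

/-- `u` solves the (differentiated) weighted Monge-Ampère equation on `N`. -/
structure IsSoliton (ι : Type*) [Fintype ι] [DecidableEq ι] (N : Set E) (u : E → ℝ)
    (α : E →L[ℝ] ℝ) (ξ : E) : Prop extends HessianMetric N u where
  card_eq : Fintype.card ι = Module.finrank ℝ E
  trace_eq : ∀ x ∈ N, ∀ e : ι → E, IsFrame u x e → ∀ w,
    ∑ a, T u x w (e a) (e a) = α w + G u x ξ w

variable [FiniteDimensional ℝ E]
variable {N : Set E} {u : E → ℝ} {x : E} {α : E →L[ℝ] ℝ} {ξ : E} {e : ι → E}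

theorem HessianMetric.exists_frame_curve (h : HessianMetric N u)
    (hι : Fintype.card ι = Module.finrank ℝ E) (hx : x ∈ N) (he : IsFrame u x e) (w : E) :
    ∃ (γ : ℝ → E) (f : ι → ℝ → E), γ 0 = x ∧ HasDerivAt γ w 0 ∧ (∀ t, γ t ∈ N) ∧
      (∀ t, IsFrame u (γ t) fun a => f a t) ∧ (∀ a, f a 0 = e a) ∧
      ∀ a, HasDerivAt (f a) (∑ b, (-(1 / 2 : ℝ) * T u x w (e a) (e b)) • e b) 0 := by
  obtain ⟨r, hr, hrN⟩ := Metric.eventually_nhds_iff.1 (h.eventually_line_mem hx w)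
  have hr2 : 0 < r / 2 := by positivity
  let γ : ℝ → E := fun s => x + (r / 2 * Real.sin (s / (r / 2))) • w
  have hγ : ∀ t, HasDerivAt γ (Real.cos (t / (r / 2)) • w) t := by
    intro t
    have h1 : HasDerivAt (fun s => r / 2 * Real.sin (s / (r / 2))) (Real.cos (t / (r / 2))) t := by
      have := (((hasDerivAt_id t).div_const (r / 2)).sin).const_mul (r / 2)
      exact this.congr_deriv (by simp only [id]; field_simp)
    exact (h1.smul_const w).const_add x
  have h0 : γ 0 = x := by simp [γ]
  have hN : ∀ t, γ t ∈ N := by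
    intro t
    apply hrN
    rw [Real.dist_eq, sub_zero, abs_mul, abs_of_pos hr2]
    have := Real.abs_sin_le_one (t / (r / 2))
    nlinarith
  obtain ⟨f, hf0, hf, hfd⟩ := h.exists_parallel_frame hι hγ (by fun_prop) hN (h0.symm ▸ he)
  have hγ0 := hγ 0
  simp only [zero_div, Real.cos_zero, one_smul] at hγ0
  refine ⟨γ, f, h0, hγ0, hN, hf, hf0, fun a => ?_⟩
  have := hfd a 0
  simpa only [h0, hf0, zero_div, Real.cos_zero, one_smul] using this

omit [DecidableEq ι] in
theorem trace_cubic_identity (V W Z A B : ι → ι → ℝ) (hV : ∀ a b, V a b = V b a)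
    (hW : ∀ a b, W a b = W b a) (hZ : ∀ a b, Z a b = Z b a) :
    ∑ a, ∑ b, ((A a b + ∑ c, -(1 / 2 : ℝ) * V a c * Z c b + ∑ c, -(1 / 2 : ℝ) * V b c * Z a c)
        * W a b
      + Z a b * (B a b + ∑ c, -(1 / 2 : ℝ) * V a c * W c b + ∑ c, -(1 / 2 : ℝ) * V b c * W a c))
      = ∑ a, ∑ b, (W a b * A a b + Z a b * B a b)
        - 2 * ∑ a, ∑ b, ∑ c, V a b * W b c * Z c a := by
  have s1 : ∀ F : ι → ι → ι → ℝ, ∑ a, ∑ b, ∑ c, F a b c = ∑ a, ∑ b, ∑ c, F a c b := fun F =>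
    Finset.sum_congr rfl fun a _ => Finset.sum_comm
  have s2 : ∀ F : ι → ι → ι → ℝ, ∑ a, ∑ b, ∑ c, F a b c = ∑ a, ∑ b, ∑ c, F b a c := fun F =>
    Finset.sum_comm
  have hs : ∀ F : ι → ι → ι → ℝ, ∑ a, ∑ b, ∑ c, -(1 / 2) * F a b c
      = -(1 / 2) * ∑ a, ∑ b, ∑ c, F a b c := fun F => by simp only [Finset.mul_sum]
  have e1 : ∑ a, ∑ b, (∑ c, -(1 / 2 : ℝ) * V a c * Z c b) * W a b
      = -(1 / 2) * ∑ a, ∑ b, ∑ c, V a b * W b c * Z c a := by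
    rw [s2, s1, ← hs]
    simp only [Finset.sum_mul]
    refine Finset.sum_congr rfl fun a _ => Finset.sum_congr rfl fun b _ =>
      Finset.sum_congr rfl fun c _ => ?_
    rw [hV a c, hW a b, hZ c b]; ring
  have e2 : ∑ a, ∑ b, (∑ c, -(1 / 2 : ℝ) * V b c * Z a c) * W a b
      = -(1 / 2) * ∑ a, ∑ b, ∑ c, V a b * W b c * Z c a := by
    rw [s1, s2, s1, ← hs]
    simp only [Finset.sum_mul]
    refine Finset.sum_congr rfl fun a _ => Finset.sum_congr rfl fun b _ =>
      Finset.sum_congr rfl fun c _ => ?_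
    rw [hV b c, hW b a]; ring
  have e3 : ∑ a, ∑ b, Z a b * ∑ c, -(1 / 2 : ℝ) * V a c * W c b
      = -(1 / 2) * ∑ a, ∑ b, ∑ c, V a b * W b c * Z c a := by
    rw [s1, ← hs]
    simp only [Finset.mul_sum]
    refine Finset.sum_congr rfl fun a _ => Finset.sum_congr rfl fun b _ =>
      Finset.sum_congr rfl fun c _ => ?_
    rw [hZ a b]; ring
  have e4 : ∑ a, ∑ b, Z a b * ∑ c, -(1 / 2 : ℝ) * V b c * W a c
      = -(1 / 2) * ∑ a, ∑ b, ∑ c, V a b * W b c * Z c a := by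
    rw [s1, s2, ← hs]
    simp only [Finset.mul_sum]
    refine Finset.sum_congr rfl fun a _ => Finset.sum_congr rfl fun b _ =>
      Finset.sum_congr rfl fun c _ => ?_
    rw [hZ a b, hW a c]; ring
  simp only [add_mul, mul_add, Finset.sum_add_distrib] at e1 e2 e3 e4 ⊢
  simp only [mul_comm (W _ _) (A _ _)]
  linarith

namespace IsSoliton

theorem trace_Q (h : IsSoliton ι N u α ξ) (hx : x ∈ N) (he : IsFrame u x e) (w z : E) :
    ∑ a, Q u x w z (e a) (e a)
      = ∑ a, ∑ b, T u x z (e a) (e b) * T u x w (e a) (e b) + T u x w z ξ := by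
  obtain ⟨γ, f, h0, hγ, hN, hf, hf0, hfd⟩ := h.exists_frame_curve h.card_eq hx he w
  have h1 : HasDerivAt (fun s => ∑ a, T u (γ s) z (f a s) (f a s)) _ 0 :=
    HasDerivAt.fun_sum fun a _ =>
      h.hasDerivAt_T hγ (hN 0) (hasDerivAt_const 0 z) (hfd a) (hfd a)
  have h2 : HasDerivAt (fun s => α z + G u (γ s) ξ z) _ 0 :=
    (h.hasDerivAt_G hγ (hN 0) (hasDerivAt_const 0 ξ) (hasDerivAt_const 0 z)).const_add _
  have h3 := h1.unique (h2.congr_of_eventuallyEq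
    (Eventually.of_forall fun s => h.trace_eq _ (hN s) _ (hf s) z))
  simp only [h0, hf0, G_zero₁, G_zero₂, T_zero₁, T_sum₂, T_sum₃, T_smul₂, T_smul₃,
    Finset.sum_add_distrib, add_zero] at h3
  have h4 : ∀ a b, T u x z (e b) (e a) = T u x z (e a) (e b) := fun a b => h.T_symm₂₃ hx _ _ _
  simp only [h4, mul_assoc, ← Finset.mul_sum] at h3
  have h5 : ∀ a b, T u x z (e a) (e b) * T u x w (e a) (e b)
      = T u x w (e a) (e b) * T u x z (e a) (e b) := fun a b => mul_comm _ _
  simp only [h5]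
  rw [h.T_symm₂₃ hx w z]
  linarith

theorem trace_P (h : IsSoliton ι N u α ξ) (hx : x ∈ N) (he : IsFrame u x e) (v w z : E) :
    ∑ a, P u x v w z (e a) (e a)
      = ∑ a, ∑ b, (T u x v (e a) (e b) * Q u x w z (e a) (e b)
          + T u x w (e a) (e b) * Q u x v z (e a) (e b)
          + T u x z (e a) (e b) * Q u x v w (e a) (e b))
        - 2 * ∑ a, ∑ b, ∑ c, T u x v (e a) (e b) * T u x w (e b) (e c) * T u x z (e c) (e a)
        + Q u x v w z ξ := by
  obtain ⟨γ, f, h0, hγ, hN, hf, hf0, hfd⟩ := h.exists_frame_curve h.card_eq hx he v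
  have h1 : HasDerivAt (fun s => ∑ a, Q u (γ s) w z (f a s) (f a s)) _ 0 :=
    HasDerivAt.fun_sum fun a _ =>
      h.hasDerivAt_Q hγ (hN 0) (hasDerivAt_const 0 w) (hasDerivAt_const 0 z) (hfd a) (hfd a)
  have h2 : HasDerivAt (fun s => ∑ a, ∑ b, T u (γ s) z (f a s) (f b s) * T u (γ s) w (f a s) (f b s)
      + T u (γ s) w z ξ) _ 0 :=
    (HasDerivAt.fun_sum fun a _ => HasDerivAt.fun_sum fun b _ =>
      (h.hasDerivAt_T hγ (hN 0) (hasDerivAt_const 0 z) (hfd a) (hfd b)).mul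
        (h.hasDerivAt_T hγ (hN 0) (hasDerivAt_const 0 w) (hfd a) (hfd b))).add
    (h.hasDerivAt_T hγ (hN 0) (hasDerivAt_const 0 w) (hasDerivAt_const 0 z) (hasDerivAt_const 0 ξ))
  have h3 := h1.unique (h2.congr_of_eventuallyEq
    (Eventually.of_forall fun s => h.trace_Q (hN s) (hf s) w z))
  simp only [h0, hf0, T_zero₁, T_zero₂, T_zero₃, Q_zero₂, Q_zero₁, T_sum₂, T_sum₃, T_smul₂,
    T_smul₃, Q_sum₃, Q_sum₄, Q_smul₃, Q_smul₄, add_zero] at h3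
  have hT : ∀ w a b, T u x w (e b) (e a) = T u x w (e a) (e b) := fun _ a b => h.T_symm₂₃ hx _ _ _
  have hQ : ∀ a b, Q u x w z (e b) (e a) = Q u x w z (e a) (e b) :=
    fun a b => h.Q_symm₃₄ hx _ _ _ _
  have h4 := trace_cubic_identity (fun a b => T u x v (e a) (e b)) (fun a b => T u x w (e a) (e b))
    (fun a b => T u x z (e a) (e b)) (fun a b => Q u x v z (e a) (e b))
    (fun a b => Q u x v w (e a) (e b)) (fun a b => hT v b a) (fun a b => hT w b a)
    (fun a b => hT z b a)
  simp only [Finset.sum_add_distrib] at h3 h4 ⊢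
  simp only [hQ, mul_assoc, ← Finset.mul_sum] at h3 h4 ⊢
  linarith

end IsSoliton

end Identities

section CubicNorm

open Set Filter Topology

variable {E : Type*} [NormedAddCommGroup E] [NormedSpace ℝ E] [FiniteDimensional ℝ E]
variable {ι : Type*} [Fintype ι] [DecidableEq ι]
variable {N : Set E} {u : E → ℝ} {x : E} {e f : ι → E}

/-- `e` and `f` are dual families for the Hessian metric of `u` at `x`. -/
def IsDual (u : E → ℝ) (x : E) (e f : ι → E) : Prop :=
  ∀ a b, G u x (e a) (f b) = if a = b then 1 else 0

omit [FiniteDimensional ℝ E] [Fintype ι] in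
theorem IsFrame.isDual (he : IsFrame u x e) : IsDual u x e e := he

theorem IsDual.expand (he : IsDual u x e f)
    (hι : Fintype.card ι = Module.finrank ℝ E) (w : E) : w = ∑ a, G u x w (f a) • e a := by
  have hli : LinearIndependent ℝ e := by
    rw [Fintype.linearIndependent_iff]
    intro c hc a
    have := congrArg (fun z => G u x z (f a)) hc
    simpa [G_sum₁, G_smul₁, G_zero₁, he _ a] using this
  rcases isEmpty_or_nonempty ι with hem | hne
  · have : Module.finrank ℝ E = 0 := by rw [← hι]; simp
    have := Module.finrank_zero_iff.1 this
    exact Subsingleton.elim _ _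
  · let b := basisOfLinearIndependentOfCardEqFinrank hli hι
    have hb : ∀ a, b a = e a := fun a => by simp [b]
    have hw := b.sum_repr w
    simp only [hb] at hw
    have hc : ∀ a, G u x w (f a) = b.repr w a := by
      intro a
      conv_lhs => rw [← hw]
      simp [G_sum₁, G_smul₁, he _ a]
    simp only [hc, hw]

/-- The trace of a bilinear form can be computed in any pair of dual bases. -/
theorem trace_dual {k : ι → E}
    (hι : Fintype.card ι = Module.finrank ℝ E) (he : IsDual u x e f) (hk : IsFrame u x k)
    {B : E → E → ℝ} (h1 : ∀ (c : ι → ℝ) (v : ι → E) b, B (∑ i, c i • v i) b = ∑ i, c i * B (v i) b)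
    (h2 : ∀ (c : ι → ℝ) (v : ι → E) a, B a (∑ i, c i • v i) = ∑ i, c i * B a (v i)) :
    ∑ a, B (e a) (f a) = ∑ a, B (k a) (k a) := by
  calc ∑ a, B (e a) (f a) = ∑ a, B (e a) (∑ p, G u x (k p) (f a) • k p) := by
        refine Finset.sum_congr rfl fun a _ => ?_
        rw [← hk.expand hι (f a)]
    _ = ∑ p, B (∑ a, G u x (k p) (f a) • e a) (k p) := by
        simp only [h1, h2]
        exact Finset.sum_comm
    _ = ∑ a, B (k a) (k a) := by
        refine Finset.sum_congr rfl fun p _ => ?_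
        rw [← he.expand hι (k p)]

theorem trace_dual_T {k : ι → E}
    (hι : Fintype.card ι = Module.finrank ℝ E) (he : IsDual u x e f) (hk : IsFrame u x k) :
    ∑ a, ∑ b, ∑ c, T u x (e a) (e b) (e c) * T u x (f a) (f b) (f c)
      = ∑ a, ∑ b, ∑ c, T u x (k a) (k b) (k c) ^ 2 := by
  have e1 : ∀ a b, ∑ c, T u x (e a) (e b) (e c) * T u x (f a) (f b) (f c)
      = ∑ c, T u x (e a) (e b) (k c) * T u x (f a) (f b) (k c) := fun a b =>
    trace_dual hι he hk (B := fun v w => T u x (e a) (e b) v * T u x (f a) (f b) w)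
      (by intro c v b; simp only [T_sum₃, T_smul₃, Finset.sum_mul, mul_assoc])
      (by intro c v b; simp only [T_sum₃, T_smul₃, Finset.mul_sum, mul_left_comm])
  have e2 : ∀ a c, ∑ b, T u x (e a) (e b) (k c) * T u x (f a) (f b) (k c)
      = ∑ b, T u x (e a) (k b) (k c) * T u x (f a) (k b) (k c) := fun a c =>
    trace_dual hι he hk (B := fun v w => T u x (e a) v (k c) * T u x (f a) w (k c))
      (by intro c v b; simp only [T_sum₂, T_smul₂, Finset.sum_mul, mul_assoc])
      (by intro c v b; simp only [T_sum₂, T_smul₂, Finset.mul_sum, mul_left_comm])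
  have e3 : ∀ b c, ∑ a, T u x (e a) (k b) (k c) * T u x (f a) (k b) (k c)
      = ∑ a, T u x (k a) (k b) (k c) * T u x (k a) (k b) (k c) := fun b c =>
    trace_dual hι he hk (B := fun v w => T u x v (k b) (k c) * T u x w (k b) (k c))
      (by intro c v b; simp only [T_sum₁, T_smul₁, Finset.sum_mul, mul_assoc])
      (by intro c v b; simp only [T_sum₁, T_smul₁, Finset.mul_sum, mul_left_comm])
  simp only [e1]
  have s1 : ∀ F : ι → ι → ι → ℝ, ∑ a, ∑ b, ∑ c, F a b c = ∑ a, ∑ c, ∑ b, F a b c := fun F =>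
    Finset.sum_congr rfl fun a _ => Finset.sum_comm
  have s2 : ∀ F : ι → ι → ι → ℝ, ∑ a, ∑ b, ∑ c, F a b c = ∑ b, ∑ c, ∑ a, F a b c := fun F => by
    rw [Finset.sum_comm]; exact Finset.sum_congr rfl fun a _ => Finset.sum_comm
  rw [s1]
  simp only [e2]
  rw [← s1, s2]
  simp only [e3]
  rw [← s2]
  simp only [sq]

variable (ι) in
/-- The squared norm of the third derivative of `u` for its Hessian metric. -/
def cubicNorm (u : E → ℝ) (x : E) : ℝ :=
  open Classical in
  if h : ∃ k : ι → E, IsFrame u x k then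
    ∑ a, ∑ b, ∑ c, T u x (h.choose a) (h.choose b) (h.choose c) ^ 2 else 0

theorem HessianMetric.cubicNorm_eq_dual (h : HessianMetric N u) (hx : x ∈ N)
    (hι : Fintype.card ι = Module.finrank ℝ E) (he : IsDual u x e f) :
    cubicNorm ι u x = ∑ a, ∑ b, ∑ c, T u x (e a) (e b) (e c) * T u x (f a) (f b) (f c) := by
  have hk : ∃ k : ι → E, IsFrame u x k := h.exists_frame hx hι
  rw [trace_dual_T hι he hk.choose_spec, cubicNorm, dif_pos hk]

theorem HessianMetric.cubicNorm_eq (h : HessianMetric N u) (hx : x ∈ N)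
    (hι : Fintype.card ι = Module.finrank ℝ E) (he : IsFrame u x e) :
    cubicNorm ι u x = ∑ a, ∑ b, ∑ c, T u x (e a) (e b) (e c) ^ 2 := by
  rw [h.cubicNorm_eq_dual hx hι he.isDual]
  simp only [sq]

omit [FiniteDimensional ℝ E] in
theorem cubicNorm_nonneg : 0 ≤ cubicNorm ι u x := by
  rw [cubicNorm]
  split_ifs
  · positivity
  · exact le_rfl

theorem HessianMetric.contDiffAt_cubicNorm (h : HessianMetric N u) (hx : x ∈ N)
    (hι : Fintype.card ι = Module.finrank ℝ E) : ContDiffAt ℝ (⊤ : ℕ∞) (cubicNorm ι u) x := by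
  obtain ⟨e, he⟩ : ∃ k : ι → E, IsFrame u x k := h.exists_frame hx hι
  let f : ι → E → E := fun a y => ContinuousLinearMap.inverse (gl u y) (gl u x (e a))
  have hf : ∀ a, ContDiffAt ℝ (⊤ : ℕ∞) (f a) x := by
    intro a
    obtain ⟨φ, hφ⟩ := h.exists_equiv hx
    have : CompleteSpace E := FiniteDimensional.complete ℝ E
    have h1 : ContDiffAt ℝ (⊤ : ℕ∞) ContinuousLinearMap.inverse (gl u x) := by
      rw [← hφ]
      exact contDiffAt_map_inverse φ
    have h2 : ContDiffAt ℝ (⊤ : ℕ∞) (gl u) x :=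
      contDiffAt_const.clm_comp ((L2.linL E).contDiff.contDiffAt.comp x (h.contDiffAt_u2 hx))
    exact (ContDiffAt.comp x h1 h2).clm_apply contDiffAt_const
  have hdual : ∀ y ∈ N, IsDual u y e fun a => f a y := by
    intro y hy a b
    obtain ⟨φ, hφ⟩ := h.exists_equiv hy
    have : gl u y (f b y) = gl u x (e b) := by
      simp only [f]
      rw [← hφ, ContinuousLinearMap.inverse_equiv]
      simp
    have h2 : G u y (f b y) (e a) = G u x (e b) (e a) :=
      congrArg (fun f : E →L[ℝ] ℝ => f (e a)) this
    rw [h.G_symm hy, h2, he]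
    simp only [eq_comm]
  have heq : cubicNorm ι u =ᶠ[𝓝 x] fun y =>
      ∑ a, ∑ b, ∑ c, T u y (e a) (e b) (e c) * T u y (f a y) (f b y) (f c y) := by
    filter_upwards [h.isOpen.mem_nhds hx] with y hy
    exact h.cubicNorm_eq_dual hy hι (hdual y hy)
  refine ContDiffAt.congr_of_eventuallyEq ?_ heq
  refine ContDiffAt.sum fun a _ => ContDiffAt.sum fun b _ => ContDiffAt.sum fun c _ => ?_
  exact (h.contDiffAt_T (p := fun y => y) hx contDiffAt_id contDiffAt_const contDiffAt_const
      contDiffAt_const).mul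
    (h.contDiffAt_T (p := fun y => y) hx contDiffAt_id (hf a) (hf b) (hf c))

end CubicNorm

section CalabiAlgebra

variable {ι : Type*} [Fintype ι]

theorem sum_cyclic (F : ι → ι → ι → ℝ) : ∑ a, ∑ b, ∑ c, F a b c = ∑ a, ∑ b, ∑ c, F b c a := by
  calc ∑ a, ∑ b, ∑ c, F a b c = ∑ a, ∑ c, ∑ b, F a b c :=
        Finset.sum_congr rfl fun a _ => Finset.sum_comm
    _ = ∑ c, ∑ a, ∑ b, F a b c := Finset.sum_comm

theorem sum_swap₁₂ (F : ι → ι → ι → ℝ) : ∑ a, ∑ b, ∑ c, F a b c = ∑ a, ∑ b, ∑ c, F b a c :=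
  Finset.sum_comm

theorem sum_swap₂₃ (F : ι → ι → ι → ℝ) : ∑ a, ∑ b, ∑ c, F a b c = ∑ a, ∑ b, ∑ c, F a c b :=
  Finset.sum_congr rfl fun _ _ => Finset.sum_comm

/-- Contracting a symmetric matrix with one index of a trilinear form. -/
def contr (ω : ι → ι → ℝ) (τ : ι → ι → ι → ℝ) (b c d : ι) : ℝ := ∑ m, ω b m * τ m c d

/-- The sum of the contractions of a matrix with all indices of a trilinear form. -/
def contrSum (ω : ι → ι → ℝ) (τ : ι → ι → ι → ℝ) (b c d : ι) : ℝ :=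
  contr ω τ b c d + contr ω τ c b d + contr ω τ d b c

/-- Full contraction of trilinear forms. -/
def dot₃ (τ κ : ι → ι → ι → ℝ) : ℝ := ∑ b, ∑ c, ∑ d, τ b c d * κ b c d

/-- Total symmetry of a trilinear form. -/
def Sym₃ (τ : ι → ι → ι → ℝ) : Prop :=
  (∀ b c d, τ b c d = τ c b d) ∧ ∀ b c d, τ b c d = τ b d c

theorem dot₃_comm (τ κ : ι → ι → ι → ℝ) : dot₃ τ κ = dot₃ κ τ := by
  simp only [dot₃, mul_comm]

theorem dot₃_add (τ κ κ' : ι → ι → ι → ℝ) :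
    dot₃ τ (fun b c d => κ b c d + κ' b c d) = dot₃ τ κ + dot₃ τ κ' := by
  simp only [dot₃, mul_add, Finset.sum_add_distrib]

theorem dot₃_smul (τ κ : ι → ι → ι → ℝ) (r : ℝ) :
    dot₃ τ (fun b c d => r * κ b c d) = r * dot₃ τ κ := by
  simp only [dot₃, Finset.mul_sum, mul_left_comm]

theorem dot₃_add_left (τ κ κ' : ι → ι → ι → ℝ) :
    dot₃ (fun b c d => κ b c d + κ' b c d) τ = dot₃ κ τ + dot₃ κ' τ := by
  simp only [dot₃, add_mul, Finset.sum_add_distrib]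

theorem dot₃_smul_left (τ κ : ι → ι → ι → ℝ) (r : ℝ) :
    dot₃ (fun b c d => r * κ b c d) τ = r * dot₃ κ τ := by
  simp only [dot₃, Finset.mul_sum, mul_assoc]

theorem dot₃_contrSum {ω : ι → ι → ℝ} {τ κ : ι → ι → ι → ℝ} (hκ : Sym₃ κ) :
    dot₃ κ (contrSum ω τ) = 3 * dot₃ κ (contr ω τ) := by
  have h1 : dot₃ κ (fun b c d => contr ω τ c b d) = dot₃ κ (contr ω τ) := by
    unfold dot₃
    rw [sum_swap₁₂]
    refine Finset.sum_congr rfl fun b _ => Finset.sum_congr rfl fun c _ =>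
      Finset.sum_congr rfl fun d _ => ?_
    rw [hκ.1]
  have h2 : dot₃ κ (fun b c d => contr ω τ d b c) = dot₃ κ (contr ω τ) := by
    unfold dot₃
    rw [sum_cyclic]
    refine Finset.sum_congr rfl fun b _ => Finset.sum_congr rfl fun c _ =>
      Finset.sum_congr rfl fun d _ => ?_
    rw [hκ.2, hκ.1]
  have h3 : contrSum ω τ = fun b c d => contr ω τ b c d + contr ω τ c b d + contr ω τ d b c := rfl
  rw [h3, dot₃_add κ (fun b c d => contr ω τ b c d + contr ω τ c b d), dot₃_add, h1, h2]
  ring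

theorem contr_adjoint {ω : ι → ι → ℝ} (hω : ∀ a b, ω a b = ω b a) (τ κ : ι → ι → ι → ℝ) :
    dot₃ τ (contr ω κ) = dot₃ (contr ω τ) κ := by
  have e1 : dot₃ τ (contr ω κ) = ∑ b, ∑ c, ∑ d, ∑ m, τ b c d * (ω b m * κ m c d) := by
    simp only [dot₃, contr, Finset.mul_sum]
  have e2 : dot₃ (contr ω τ) κ = ∑ b, ∑ c, ∑ d, ∑ m, ω b m * τ m c d * κ b c d := by
    simp only [dot₃, contr, Finset.sum_mul]
  have s : ∀ F : ι → ι → ι → ι → ℝ, ∑ b, ∑ c, ∑ d, ∑ m, F b c d m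
      = ∑ b, ∑ c, ∑ d, ∑ m, F m c d b := by
    intro F
    calc ∑ b, ∑ c, ∑ d, ∑ m, F b c d m = ∑ b, ∑ c, ∑ m, ∑ d, F b c d m :=
          Finset.sum_congr rfl fun _ _ => Finset.sum_congr rfl fun _ _ => Finset.sum_comm
      _ = ∑ b, ∑ m, ∑ c, ∑ d, F b c d m := Finset.sum_congr rfl fun _ _ => Finset.sum_comm
      _ = ∑ m, ∑ b, ∑ c, ∑ d, F b c d m := Finset.sum_comm
      _ = ∑ m, ∑ c, ∑ b, ∑ d, F b c d m := Finset.sum_congr rfl fun _ _ => Finset.sum_comm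
      _ = ∑ m, ∑ c, ∑ d, ∑ b, F b c d m :=
          Finset.sum_congr rfl fun _ _ => Finset.sum_congr rfl fun _ _ => Finset.sum_comm
  rw [e1, e2, s]
  refine Finset.sum_congr rfl fun b _ => Finset.sum_congr rfl fun c _ =>
    Finset.sum_congr rfl fun d _ => Finset.sum_congr rfl fun m _ => ?_
  rw [hω m b]; ring

theorem contr_add_left (ω ω' : ι → ι → ℝ) (τ : ι → ι → ι → ℝ) :
    contr (fun b m => ω b m + ω' b m) τ = fun b c d => contr ω τ b c d + contr ω' τ b c d := by
  funext b c d
  simp only [contr, add_mul, Finset.sum_add_distrib]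

theorem contr_contr (ω : ι → ι → ℝ) (τ : ι → ι → ι → ℝ) :
    contr (fun b m => -∑ k, ω b k * ω k m) τ = fun b c d => -contr ω (contr ω τ) b c d := by
  funext b c d
  simp only [contr, neg_mul, Finset.sum_neg_distrib, Finset.sum_mul, Finset.mul_sum]
  rw [Finset.sum_comm]
  simp only [mul_assoc]

/-- The algebraic part of the second derivative of the squared norm of a trilinear form. -/
theorem second_variation_algebra {ω ρ : ι → ι → ℝ} {τ q p : ι → ι → ι → ℝ}
    (hω : ∀ a b, ω a b = ω b a) (hτ : Sym₃ τ) (hq : Sym₃ q) :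
    2 * (dot₃ (fun b c d => q b c d + -(1 / 2) * contrSum ω τ b c d) q
        + dot₃ τ (fun b c d => p b c d + -(1 / 2) * contrSum ω q b c d))
      - 3 * (dot₃ (fun b c d => q b c d + -(1 / 2) * contrSum ω τ b c d) (contr ω τ)
        + dot₃ τ (fun b c d =>
          contr (fun b m => ρ b m + -∑ k, ω b k * ω k m) τ b c d
          + contr ω (fun b c d => q b c d + -(1 / 2) * contrSum ω τ b c d) b c d))
      = 2 * dot₃ q q - 12 * dot₃ q (contr ω τ) + 2 * dot₃ τ p - 3 * dot₃ τ (contr ρ τ)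
        + 6 * dot₃ (contr ω τ) (contr ω τ)
        + 6 * dot₃ (contr ω τ) (fun b c d => contr ω τ c b d) := by
  have hadj := contr_adjoint hω
  have h1 : dot₃ (contr ω τ) (fun b c d => contr ω τ d b c)
      = dot₃ (contr ω τ) (fun b c d => contr ω τ c b d) := by
    unfold dot₃
    rw [sum_swap₂₃]
    refine Finset.sum_congr rfl fun b _ => Finset.sum_congr rfl fun c _ =>
      Finset.sum_congr rfl fun d _ => ?_
    congr 1
    simp only [contr]
    exact Finset.sum_congr rfl fun m _ => by rw [hτ.2 m c d]
  have h2 : dot₃ (contr ω τ) (contrSum ω τ) = dot₃ (contr ω τ) (contr ω τ)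
      + 2 * dot₃ (contr ω τ) (fun b c d => contr ω τ c b d) := by
    have h3 : contrSum ω τ
      = fun b c d => contr ω τ b c d + contr ω τ c b d + contr ω τ d b c := rfl
    rw [h3, dot₃_add _ (fun b c d => contr ω τ b c d + contr ω τ c b d), dot₃_add, h1]
    ring
  have h4 : dot₃ τ (fun b c d => -contr ω (contr ω τ) b c d)
      = - dot₃ (contr ω τ) (contr ω τ) := by
    rw [← hadj τ]
    simp only [dot₃, mul_neg, Finset.sum_neg_distrib]
  have h5 : dot₃ τ (contr ω q) = dot₃ q (contr ω τ) := by rw [hadj, dot₃_comm]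
  have h6 : dot₃ τ (contr ω (fun b c d => q b c d + -(1 / 2) * contrSum ω τ b c d))
      = dot₃ q (contr ω τ) - 1 / 2 * dot₃ (contr ω τ) (contrSum ω τ) := by
    rw [hadj, dot₃_add, dot₃_smul, dot₃_comm q]; ring
  rw [dot₃_add τ (contr (fun b m => ρ b m + -∑ k, ω b k * ω k m) τ), h6, contr_add_left, contr_contr,
    dot₃_add τ (contr ρ τ), h4, dot₃_add_left, dot₃_add_left, dot₃_add τ p, dot₃_smul,
    dot₃_smul_left, dot₃_smul_left, dot₃_contrSum hτ, dot₃_comm (contrSum ω τ) q,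
    dot₃_contrSum hq, dot₃_comm (contrSum ω τ), h2, h5]
  ring

end CalabiAlgebra

section Calabi

open Set Filter Topology

variable {E : Type*} [NormedAddCommGroup E] [NormedSpace ℝ E] [FiniteDimensional ℝ E]
variable {ι : Type*} [Fintype ι] [DecidableEq ι]
variable {N : Set E} {u : E → ℝ} {x : E} {e : ι → E}

omit [FiniteDimensional ℝ E] [Fintype ι] [DecidableEq ι] in
theorem HessianMetric.sym₃_T (h : HessianMetric N u) (hx : x ∈ N) (e : ι → E) :
    Sym₃ fun b c d => T u x (e b) (e c) (e d) :=
  ⟨fun _ _ _ => h.T_symm₁₂ hx _ _ _, fun _ _ _ => h.T_symm₂₃ hx _ _ _⟩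

omit [FiniteDimensional ℝ E] [Fintype ι] [DecidableEq ι] in
theorem HessianMetric.sym₃_Q (h : HessianMetric N u) (hx : x ∈ N) (w : E) (e : ι → E) :
    Sym₃ fun b c d => Q u x w (e b) (e c) (e d) :=
  ⟨fun _ _ _ => h.Q_symm₂₃ hx _ _ _ _, fun _ _ _ => h.Q_symm₃₄ hx _ _ _ _⟩

omit [FiniteDimensional ℝ E] [DecidableEq ι] in
/-- The covariant derivative of the third derivative of `u`. -/
theorem HessianMetric.hasDerivAt_T_frame (h : HessianMetric N u) {γ : ℝ → E} {f : ι → ℝ → E}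
    {w : E} (h0 : γ 0 = x) (hγ : HasDerivAt γ w 0) (hN : ∀ t, γ t ∈ N) (hf0 : ∀ a, f a 0 = e a)
    (hfd : ∀ a, HasDerivAt (f a) (∑ b, (-(1 / 2 : ℝ) * T u x w (e a) (e b)) • e b) 0) (b c d : ι) :
    HasDerivAt (fun s => T u (γ s) (f b s) (f c s) (f d s))
      (Q u x w (e b) (e c) (e d) + -(1 / 2) * contrSum (fun b m => T u x w (e b) (e m))
        (fun b c d => T u x (e b) (e c) (e d)) b c d) 0 := by
  have hx : x ∈ N := h0 ▸ hN 0
  refine (h.hasDerivAt_T hγ (hN 0) (hfd b) (hfd c) (hfd d)).congr_deriv ?_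
  simp only [h0, hf0, T_sum₁, T_sum₂, T_sum₃, T_smul₁, T_smul₂, T_smul₃, contrSum, contr,
    mul_assoc, ← Finset.mul_sum]
  have e1 : ∀ m, T u x (e b) (e m) (e d) = T u x (e m) (e b) (e d) := fun m => h.T_symm₁₂ hx ..
  have e2 : ∀ m, T u x (e b) (e c) (e m) = T u x (e m) (e b) (e c) := fun m => by
    rw [h.T_symm₂₃ hx, h.T_symm₁₂ hx]
  simp only [e1, e2]
  ring

omit [FiniteDimensional ℝ E] [DecidableEq ι] in
theorem HessianMetric.hasDerivAt_Q_frame (h : HessianMetric N u) {γ : ℝ → E} {f : ι → ℝ → E}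
    {w : E} (z : E) (h0 : γ 0 = x) (hγ : HasDerivAt γ w 0) (hN : ∀ t, γ t ∈ N)
    (hf0 : ∀ a, f a 0 = e a)
    (hfd : ∀ a, HasDerivAt (f a) (∑ b, (-(1 / 2 : ℝ) * T u x w (e a) (e b)) • e b) 0) (b c d : ι) :
    HasDerivAt (fun s => Q u (γ s) z (f b s) (f c s) (f d s))
      (P u x w z (e b) (e c) (e d) + -(1 / 2) * contrSum (fun b m => T u x w (e b) (e m))
        (fun b c d => Q u x z (e b) (e c) (e d)) b c d) 0 := by
  have hx : x ∈ N := h0 ▸ hN 0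
  refine (h.hasDerivAt_Q hγ (hN 0) (hasDerivAt_const 0 z) (hfd b) (hfd c) (hfd d)).congr_deriv ?_
  simp only [h0, hf0, Q_sum₂, Q_sum₃, Q_sum₄, Q_smul₂, Q_smul₃, Q_smul₄, contrSum, contr,
    mul_assoc, ← Finset.mul_sum, Q_zero₁, add_zero]
  have e1 : ∀ m, Q u x z (e b) (e m) (e d) = Q u x z (e m) (e b) (e d) := fun m => h.Q_symm₂₃ hx ..
  have e2 : ∀ m, Q u x z (e b) (e c) (e m) = Q u x z (e m) (e b) (e c) := fun m => by
    rw [h.Q_symm₃₄ hx, h.Q_symm₂₃ hx]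
  simp only [e1, e2]
  ring

end Calabi

section CalabiAlgebraSum

variable {ι : Type*} [Fintype ι]

theorem sum₄_swap₂₃ (F : ι → ι → ι → ι → ℝ) :
    ∑ a, ∑ b, ∑ c, ∑ d, F a b c d = ∑ a, ∑ b, ∑ c, ∑ d, F a c b d :=
  Finset.sum_congr rfl fun _ _ => Finset.sum_comm

theorem sum₄_swap₃₄ (F : ι → ι → ι → ι → ℝ) :
    ∑ a, ∑ b, ∑ c, ∑ d, F a b c d = ∑ a, ∑ b, ∑ c, ∑ d, F a b d c :=
  Finset.sum_congr rfl fun _ _ => Finset.sum_congr rfl fun _ _ => Finset.sum_comm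

theorem sum₄_cycle (F : ι → ι → ι → ι → ℝ) :
    ∑ a, ∑ b, ∑ c, ∑ d, F a b c d = ∑ b, ∑ c, ∑ d, ∑ a, F a b c d := by
  rw [Finset.sum_comm]
  refine Finset.sum_congr rfl fun b _ => ?_
  rw [Finset.sum_comm]
  exact Finset.sum_congr rfl fun c _ => Finset.sum_comm

theorem sum₅_cycle (F : ι → ι → ι → ι → ι → ℝ) :
    ∑ a, ∑ b, ∑ c, ∑ d, ∑ m, F a b c d m = ∑ b, ∑ c, ∑ d, ∑ m, ∑ a, F a b c d m := by
  rw [Finset.sum_comm]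
  exact Finset.sum_congr rfl fun b _ => sum₄_cycle _

theorem sum₆_cycle (F : ι → ι → ι → ι → ι → ι → ℝ) :
    ∑ a, ∑ b, ∑ c, ∑ d, ∑ m, ∑ p, F a b c d m p
      = ∑ b, ∑ c, ∑ d, ∑ m, ∑ p, ∑ a, F a b c d m p := by
  rw [Finset.sum_comm]
  exact Finset.sum_congr rfl fun b _ => sum₅_cycle _

/-- The square of a trilinear form, contracted over one index. -/
def csq (τ : ι → ι → ι → ℝ) (a b c d : ι) : ℝ := contr (τ a) τ b c d

theorem csq_symm₃₄ {τ : ι → ι → ι → ℝ} (hτ : Sym₃ τ) (a b c d : ι) :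
    csq τ a b c d = csq τ a b d c :=
  Finset.sum_congr rfl fun m _ => by rw [hτ.2 m c d]

/-- The Gram matrix of a trilinear form. -/
def gram₃ (τ : ι → ι → ι → ℝ) (b m : ι) : ℝ := ∑ c, ∑ d, τ b c d * τ m c d

theorem sum_csq_sq {τ : ι → ι → ι → ℝ} (hτ : Sym₃ τ) :
    ∑ a, ∑ b, ∑ c, ∑ d, csq τ a b c d ^ 2 = ∑ m, ∑ p, gram₃ τ m p ^ 2 := by
  have e1 : ∑ m, ∑ p, gram₃ τ m p ^ 2
      = ∑ m, ∑ p, ∑ a, ∑ b, ∑ c, ∑ d, τ m a b * τ p a b * (τ m c d * τ p c d) := by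
    simp only [gram₃, sq, Finset.sum_mul]
    simp only [Finset.mul_sum]
  have e2 : ∑ a, ∑ b, ∑ c, ∑ d, csq τ a b c d ^ 2
      = ∑ a, ∑ b, ∑ c, ∑ d, ∑ m, ∑ p, τ a b m * τ m c d * (τ a b p * τ p c d) := by
    simp only [csq, contr, sq, Finset.sum_mul_sum]
  rw [e1, e2, sum₆_cycle (fun m p a b c d => τ m a b * τ p a b * (τ m c d * τ p c d)),
    sum₆_cycle (fun p a b c d m => τ m a b * τ p a b * (τ m c d * τ p c d))]
  refine Finset.sum_congr rfl fun a _ => Finset.sum_congr rfl fun b _ =>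
    Finset.sum_congr rfl fun c _ => Finset.sum_congr rfl fun d _ => Finset.sum_congr rfl fun m _ =>
    Finset.sum_congr rfl fun p _ => ?_
  rw [hτ.2 a b m, hτ.1 a m b, hτ.2 a b p, hτ.1 a p b]
  ring

theorem sum_csq_cross {τ : ι → ι → ι → ℝ} (hτ : Sym₃ τ) :
    dot₃ τ (fun b c d => ∑ i, ∑ j, ∑ k, τ b i j * τ c j k * τ d k i)
      = ∑ a, ∑ b, ∑ c, ∑ d, csq τ a b c d * csq τ a c b d := by
  have e1 : ∑ a, ∑ b, ∑ c, ∑ d, csq τ a b c d * csq τ a c b d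
      = ∑ a, ∑ b, ∑ c, ∑ d, ∑ m, ∑ p, τ a b m * τ m c d * (τ a c p * τ p b d) := by
    simp only [csq, contr, Finset.sum_mul_sum]
  rw [e1]
  simp only [dot₃, Finset.mul_sum]
  refine Finset.sum_congr rfl fun a _ => Finset.sum_congr rfl fun b _ => ?_
  have s : ∀ F : ι → ι → ι → ι → ℝ, ∑ c, ∑ d, ∑ m, ∑ p, F c d m p
      = ∑ m, ∑ c, ∑ p, ∑ d, F c d m p := by
    intro F
    calc ∑ c, ∑ d, ∑ m, ∑ p, F c d m p = ∑ c, ∑ m, ∑ d, ∑ p, F c d m p :=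
          Finset.sum_congr rfl fun _ _ => Finset.sum_comm
      _ = ∑ m, ∑ c, ∑ d, ∑ p, F c d m p := Finset.sum_comm
      _ = _ := Finset.sum_congr rfl fun _ _ => Finset.sum_congr rfl fun _ _ => Finset.sum_comm
  rw [s fun c d m p => τ a b m * τ m c d * (τ a c p * τ p b d)]
  refine Finset.sum_congr rfl fun m _ => Finset.sum_congr rfl fun c _ =>
    Finset.sum_congr rfl fun p _ => Finset.sum_congr rfl fun d _ => ?_
  rw [hτ.1 p b d, hτ.2 m c d]
  ring

/-- Total symmetry of a quadrilinear form. -/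
def Sym₄ (q : ι → ι → ι → ι → ℝ) : Prop :=
  (∀ a b c d, q a b c d = q b a c d) ∧ ∀ a, Sym₃ (q a)

theorem sum_csq_dot {τ : ι → ι → ι → ℝ} (hτ : Sym₃ τ) (q : ι → ι → ι → ι → ℝ) :
    dot₃ τ (fun b c d => ∑ i, ∑ j, (τ b i j * q c d i j + τ c i j * q b d i j + τ d i j * q b c i j))
      = 3 * ∑ a, dot₃ (q a) (contr (τ a) τ) := by
  have h1 : dot₃ τ (fun b c d => ∑ i, ∑ j, τ b i j * q c d i j)
      = ∑ a, dot₃ (q a) (contr (τ a) τ) := by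
    simp only [dot₃, contr, Finset.mul_sum]
    rw [sum₅_cycle]
    refine Finset.sum_congr rfl fun b _ => Finset.sum_congr rfl fun c _ =>
      Finset.sum_congr rfl fun d _ => Finset.sum_congr rfl fun m _ =>
      Finset.sum_congr rfl fun p _ => ?_
    rw [hτ.1 p b c, hτ.2 b p c]
    ring
  have h2 : dot₃ τ (fun b c d => ∑ i, ∑ j, τ c i j * q b d i j)
      = dot₃ τ (fun b c d => ∑ i, ∑ j, τ b i j * q c d i j) := by
    unfold dot₃
    rw [sum_swap₁₂]
    refine Finset.sum_congr rfl fun b _ => Finset.sum_congr rfl fun c _ =>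
      Finset.sum_congr rfl fun d _ => ?_
    rw [hτ.1]
  have h3 : dot₃ τ (fun b c d => ∑ i, ∑ j, τ d i j * q b c i j)
      = dot₃ τ (fun b c d => ∑ i, ∑ j, τ b i j * q c d i j) := by
    unfold dot₃
    rw [sum_cyclic]
    refine Finset.sum_congr rfl fun b _ => Finset.sum_congr rfl fun c _ =>
      Finset.sum_congr rfl fun d _ => ?_
    rw [hτ.2, hτ.1]
  simp only [Finset.sum_add_distrib]
  rw [dot₃_add τ (fun b c d => ∑ i, ∑ j, τ b i j * q c d i j + ∑ i, ∑ j, τ c i j * q b d i j),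
    dot₃_add, h2, h3, h1]
  ring

theorem sum_csq_lower {τ : ι → ι → ι → ℝ} (hτ : Sym₃ τ) {q : ι → ι → ι → ι → ℝ} (hq : Sym₄ q) :
    (∑ a, ∑ b, ∑ c, ∑ d, csq τ a b c d ^ 2) / 2 ≤
      2 * ∑ a, ∑ b, ∑ c, ∑ d, q a b c d ^ 2 - 6 * ∑ a, ∑ b, ∑ c, ∑ d, q a b c d * csq τ a b c d
        + 3 * ∑ a, ∑ b, ∑ c, ∑ d, csq τ a b c d ^ 2
        + 2 * ∑ a, ∑ b, ∑ c, ∑ d, csq τ a b c d * csq τ a c b d := by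
  have hs := csq_symm₃₄ hτ
  generalize csq τ = k at hs ⊢
  have hX : ∑ a, ∑ b, ∑ c, ∑ d, k a b c d * k a c b d
      ≤ ∑ a, ∑ b, ∑ c, ∑ d, k a b c d ^ 2 := by
    have h1 : 0 ≤ ∑ a, ∑ b, ∑ c, ∑ d, (k a b c d - k a c b d) ^ 2 := by positivity
    have h2 : ∀ a b c d, (k a b c d - k a c b d) ^ 2
      = k a b c d ^ 2 + k a c b d ^ 2 - 2 * (k a b c d * k a c b d) := by
      intros; ring
    simp only [h2, Finset.sum_sub_distrib, Finset.sum_add_distrib, ← Finset.mul_sum] at h1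
    rw [sum₄_swap₂₃ fun a b c d => k a c b d ^ 2] at h1
    linarith
  have h1 : 0 ≤ ∑ a, ∑ b, ∑ c, ∑ d,
      2 * (q a b c d - 1 / 2 * (k a b c d + k a c b d + k a d b c)) ^ 2 :=
    Finset.sum_nonneg fun a _ => Finset.sum_nonneg fun b _ => Finset.sum_nonneg fun c _ =>
      Finset.sum_nonneg fun d _ => mul_nonneg zero_le_two (sq_nonneg _)
  have h2 : ∀ a b c d,
      2 * (q a b c d - 1 / 2 * (k a b c d + k a c b d + k a d b c)) ^ 2
      = 2 * q a b c d ^ 2 - 2 * (q a b c d * k a b c d) - 2 * (q a b c d * k a c b d)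
        - 2 * (q a b c d * k a d b c) + 1 / 2 * k a b c d ^ 2 + 1 / 2 * k a c b d ^ 2
        + 1 / 2 * k a d b c ^ 2 + k a b c d * k a c b d
        + k a b c d * k a d b c + k a c b d * k a d b c := by
    intros; ring
  simp only [h2, Finset.sum_sub_distrib, Finset.sum_add_distrib, ← Finset.mul_sum] at h1
  have q1 : ∑ a, ∑ b, ∑ c, ∑ d, q a b c d * k a c b d
      = ∑ a, ∑ b, ∑ c, ∑ d, q a b c d * k a b c d := by
    rw [sum₄_swap₂₃]
    refine Finset.sum_congr rfl fun a _ => Finset.sum_congr rfl fun b _ =>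
      Finset.sum_congr rfl fun c _ => Finset.sum_congr rfl fun d _ => ?_
    rw [(hq.2 a).1]
  have q2 : ∑ a, ∑ b, ∑ c, ∑ d, q a b c d * k a d b c
      = ∑ a, ∑ b, ∑ c, ∑ d, q a b c d * k a c b d := by
    rw [sum₄_swap₃₄]
    refine Finset.sum_congr rfl fun a _ => Finset.sum_congr rfl fun b _ =>
      Finset.sum_congr rfl fun c _ => Finset.sum_congr rfl fun d _ => ?_
    rw [(hq.2 a).2]
  have n1 : ∑ a, ∑ b, ∑ c, ∑ d, k a c b d ^ 2 = ∑ a, ∑ b, ∑ c, ∑ d, k a b c d ^ 2 :=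
    sum₄_swap₂₃ _
  have n2 : ∑ a, ∑ b, ∑ c, ∑ d, k a d b c ^ 2 = ∑ a, ∑ b, ∑ c, ∑ d, k a c b d ^ 2 :=
    sum₄_swap₃₄ _
  have x1 : ∑ a, ∑ b, ∑ c, ∑ d, k a b c d * k a d b c
      = ∑ a, ∑ b, ∑ c, ∑ d, k a b c d * k a c b d := by
    rw [sum₄_swap₃₄]
    refine Finset.sum_congr rfl fun a _ => Finset.sum_congr rfl fun b _ =>
      Finset.sum_congr rfl fun c _ => Finset.sum_congr rfl fun d _ => ?_
    rw [hs a b d c]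
  have x2 : ∑ a, ∑ b, ∑ c, ∑ d, k a c b d * k a d b c
      = ∑ a, ∑ b, ∑ c, ∑ d, k a b c d * k a d b c := by
    rw [sum₄_swap₂₃]
    refine Finset.sum_congr rfl fun a _ => Finset.sum_congr rfl fun b _ =>
      Finset.sum_congr rfl fun c _ => Finset.sum_congr rfl fun d _ => ?_
    rw [hs a d c b]
  rw [q2, q1, n2, n1, x2, x1] at h1
  linarith

theorem dot₃_self_sq_le {τ : ι → ι → ι → ℝ} :
    dot₃ τ τ ^ 2 ≤ Fintype.card ι * ∑ m, ∑ p, gram₃ τ m p ^ 2 := by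
  have h1 : dot₃ τ τ = ∑ m, gram₃ τ m m := rfl
  have h2 := sq_sum_le_card_mul_sum_sq (s := (Finset.univ : Finset ι)) (f := fun m => gram₃ τ m m)
  rw [h1]
  refine h2.trans ?_
  rw [Finset.card_univ]
  gcongr with m _
  exact Finset.single_le_sum (f := fun p => gram₃ τ m p ^ 2) (fun _ _ => sq_nonneg _)
    (Finset.mem_univ m)

end CalabiAlgebraSum

section CalabiInequality

open Set Filter Topology

variable {E : Type*} [NormedAddCommGroup E] [NormedSpace ℝ E] [FiniteDimensional ℝ E]
variable {ι : Type*} [Fintype ι] [DecidableEq ι]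
variable {N : Set E} {u : E → ℝ} {x : E} {e : ι → E} {α : E →L[ℝ] ℝ} {ξ : E}

omit [DecidableEq ι] in
theorem hasDerivAt_dot₃ {τ κ : ℝ → ι → ι → ι → ℝ} {τ' κ' : ι → ι → ι → ℝ} {t : ℝ}
    (hτ : ∀ b c d, HasDerivAt (fun s => τ s b c d) (τ' b c d) t)
    (hκ : ∀ b c d, HasDerivAt (fun s => κ s b c d) (κ' b c d) t) :
    HasDerivAt (fun s => dot₃ (τ s) (κ s)) (dot₃ τ' (κ t) + dot₃ (τ t) κ') t := by
  have : HasDerivAt (fun s => dot₃ (τ s) (κ s))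
      (∑ b, ∑ c, ∑ d, (τ' b c d * κ t b c d + τ t b c d * κ' b c d)) t :=
    HasDerivAt.fun_sum fun b _ => HasDerivAt.fun_sum fun c _ => HasDerivAt.fun_sum fun d _ =>
      (hτ b c d).mul (hκ b c d)
  refine this.congr_deriv ?_
  simp only [dot₃, Finset.sum_add_distrib]

omit [DecidableEq ι] in
theorem hasDerivAt_contr {ω : ℝ → ι → ι → ℝ} {ω' : ι → ι → ℝ} {τ : ℝ → ι → ι → ι → ℝ}
    {τ' : ι → ι → ι → ℝ} {t : ℝ} (hω : ∀ b m, HasDerivAt (fun s => ω s b m) (ω' b m) t)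
    (hτ : ∀ b c d, HasDerivAt (fun s => τ s b c d) (τ' b c d) t) (b c d : ι) :
    HasDerivAt (fun s => contr (ω s) (τ s) b c d)
      (contr ω' (τ t) b c d + contr (ω t) τ' b c d) t := by
  have : HasDerivAt (fun s => contr (ω s) (τ s) b c d)
      (∑ m, (ω' b m * τ t m c d + ω t b m * τ' m c d)) t :=
    HasDerivAt.fun_sum fun m _ => (hω b m).mul (hτ m c d)
  refine this.congr_deriv ?_
  simp only [contr, Finset.sum_add_distrib]

theorem HessianMetric.fderiv_cubicNorm (h : HessianMetric N u)
    (hι : Fintype.card ι = Module.finrank ℝ E) (hx : x ∈ N) (he : IsFrame u x e) (w : E) :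
    fderiv ℝ (cubicNorm ι u) x w
      = 2 * dot₃ (fun b c d => T u x (e b) (e c) (e d)) (fun b c d => Q u x w (e b) (e c) (e d))
        - 3 * dot₃ (fun b c d => T u x (e b) (e c) (e d))
          (contr (fun b m => T u x w (e b) (e m)) fun b c d => T u x (e b) (e c) (e d)) := by
  obtain ⟨γ, f, h0, hγ, hN, hf, hf0, hfd⟩ := h.exists_frame_curve hι hx he w
  have hS : HasFDerivAt (cubicNorm ι u) (fderiv ℝ (cubicNorm ι u) x) (γ 0) := by
    rw [h0]
    exact ((h.contDiffAt_cubicNorm hx hι).differentiableAt (by simp)).hasFDerivAt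
  have h1 := hS.comp_hasDerivAt 0 hγ
  have hT := fun b c d => h.hasDerivAt_T_frame h0 hγ hN hf0 hfd b c d
  have h2 := hasDerivAt_dot₃ (τ := fun s b c d => T u (γ s) (f b s) (f c s) (f d s)) hT hT
  have h3 : (cubicNorm ι u ∘ γ) = fun s => dot₃ (fun b c d => T u (γ s) (f b s) (f c s) (f d s))
      (fun b c d => T u (γ s) (f b s) (f c s) (f d s)) := by
    funext s
    simp only [Function.comp, h.cubicNorm_eq (hN s) hι (hf s), dot₃, sq]
  rw [h3] at h1
  rw [h1.unique h2]
  simp only [h0, hf0]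
  have hs := h.sym₃_T hx e
  rw [dot₃_add, dot₃_add_left, dot₃_smul, dot₃_smul_left, dot₃_comm (contrSum _ _),
    dot₃_contrSum hs, dot₃_comm fun b c d => Q u x w (e b) (e c) (e d)]
  ring

theorem HessianMetric.fderiv_fderiv_cubicNorm (h : HessianMetric N u)
    (hι : Fintype.card ι = Module.finrank ℝ E) (hx : x ∈ N) (he : IsFrame u x e) (w : E) :
    fderiv ℝ (fun y => fderiv ℝ (cubicNorm ι u) y w) x w
      = 2 * dot₃ (fun b c d => Q u x w (e b) (e c) (e d)) (fun b c d => Q u x w (e b) (e c) (e d))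
        - 12 * dot₃ (fun b c d => Q u x w (e b) (e c) (e d))
          (contr (fun b m => T u x w (e b) (e m)) fun b c d => T u x (e b) (e c) (e d))
        + 2 * dot₃ (fun b c d => T u x (e b) (e c) (e d))
          (fun b c d => P u x w w (e b) (e c) (e d))
        - 3 * dot₃ (fun b c d => T u x (e b) (e c) (e d))
          (contr (fun b m => Q u x w w (e b) (e m)) fun b c d => T u x (e b) (e c) (e d))
        + 6 * dot₃ (contr (fun b m => T u x w (e b) (e m)) fun b c d => T u x (e b) (e c) (e d))
          (contr (fun b m => T u x w (e b) (e m)) fun b c d => T u x (e b) (e c) (e d))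
        + 6 * dot₃ (contr (fun b m => T u x w (e b) (e m)) fun b c d => T u x (e b) (e c) (e d))
          (fun b c d => contr (fun b m => T u x w (e b) (e m))
            (fun b c d => T u x (e b) (e c) (e d)) c b d) := by
  obtain ⟨γ, f, h0, hγ, hN, hf, hf0, hfd⟩ := h.exists_frame_curve hι hx he w
  have hS : HasFDerivAt (fun y => fderiv ℝ (cubicNorm ι u) y w)
      (fderiv ℝ (fun y => fderiv ℝ (cubicNorm ι u) y w) x) (γ 0) := by
    rw [h0]
    have h1 : ContDiffAt ℝ 1 (fderiv ℝ (cubicNorm ι u)) x :=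
      (h.contDiffAt_cubicNorm hx hι).fderiv_right (WithTop.coe_le_coe.2 le_top)
    exact ((h1.clm_apply contDiffAt_const).differentiableAt (by simp)).hasFDerivAt
  have h1 := hS.comp_hasDerivAt 0 hγ
  have hT := fun b c d => h.hasDerivAt_T_frame h0 hγ hN hf0 hfd b c d
  have hQ := fun b c d => h.hasDerivAt_Q_frame w h0 hγ hN hf0 hfd b c d
  have hω : ∀ b m, HasDerivAt (fun s => T u (γ s) w (f b s) (f m s))
      (Q u x w w (e b) (e m) + -∑ k, T u x w (e b) (e k) * T u x w (e k) (e m)) 0 := by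
    intro b m
    refine (h.hasDerivAt_T hγ (hN 0) (hasDerivAt_const 0 w) (hfd b) (hfd m)).congr_deriv ?_
    simp only [h0, hf0, T_sum₂, T_sum₃, T_smul₂, T_smul₃, T_zero₁, mul_assoc, ← Finset.mul_sum]
    have e1 : ∀ k, T u x w (e m) (e k) * T u x w (e b) (e k)
        = T u x w (e b) (e k) * T u x w (e k) (e m) := fun k => by
      rw [h.T_symm₂₃ hx w (e m)]; ring
    simp only [e1]
    ring
  have h2 := ((hasDerivAt_dot₃ (τ := fun s b c d => T u (γ s) (f b s) (f c s) (f d s))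
    (κ := fun s b c d => Q u (γ s) w (f b s) (f c s) (f d s)) hT hQ).const_mul 2).sub
    ((hasDerivAt_dot₃ (τ := fun s b c d => T u (γ s) (f b s) (f c s) (f d s)) hT
    (hasDerivAt_contr (ω := fun s b m => T u (γ s) w (f b s) (f m s)) hω
      (τ := fun s b c d => T u (γ s) (f b s) (f c s) (f d s)) hT)).const_mul 3)
  have h3 : ((fun y => fderiv ℝ (cubicNorm ι u) y w) ∘ γ) = fun s =>
      2 * dot₃ (fun b c d => T u (γ s) (f b s) (f c s) (f d s))
        (fun b c d => Q u (γ s) w (f b s) (f c s) (f d s))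
      - 3 * dot₃ (fun b c d => T u (γ s) (f b s) (f c s) (f d s))
        (contr (fun b m => T u (γ s) w (f b s) (f m s))
          fun b c d => T u (γ s) (f b s) (f c s) (f d s)) := by
    funext s
    exact h.fderiv_cubicNorm hι (hN s) (hf s) w
  rw [h3] at h1
  rw [h1.unique h2]
  simp only [h0, hf0]
  rw [← second_variation_algebra (fun _ _ => h.T_symm₂₃ hx _ _ _) (h.sym₃_T hx e)
    (h.sym₃_Q hx w e)]

end CalabiInequality

section CalabiInequality

open Set Filter Topology

variable {E : Type*} [NormedAddCommGroup E] [NormedSpace ℝ E] [FiniteDimensional ℝ E]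
variable {ι : Type*} [Fintype ι] [DecidableEq ι]
variable {N : Set E} {u : E → ℝ} {x : E} {e : ι → E} {α : E →L[ℝ] ℝ} {ξ : E}

omit [DecidableEq ι] in
theorem sum_dot₃ (τ : ι → ι → ι → ℝ) (κ : ι → ι → ι → ι → ℝ) :
    ∑ a, dot₃ τ (κ a) = dot₃ τ (fun b c d => ∑ a, κ a b c d) := by
  simp only [dot₃, Finset.mul_sum]
  rw [sum₄_cycle]

omit [DecidableEq ι] in
theorem sum_contr (ω : ι → ι → ι → ℝ) (τ : ι → ι → ι → ℝ) (b c d : ι) :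
    ∑ a, contr (ω a) τ b c d = contr (fun b m => ∑ a, ω a b m) τ b c d := by
  simp only [contr, Finset.sum_mul]
  rw [Finset.sum_comm]

omit [DecidableEq ι] in
theorem dot₃_contr_self (ω : ι → ι → ℝ) (τ : ι → ι → ι → ℝ) :
    dot₃ τ (contr ω τ) = ∑ b, ∑ m, ω b m * gram₃ τ b m := by
  simp only [dot₃, contr, gram₃, Finset.mul_sum]
  refine Finset.sum_congr rfl fun b _ => ?_
  rw [sum_cyclic]
  refine Finset.sum_congr rfl fun m _ => Finset.sum_congr rfl fun c _ =>
    Finset.sum_congr rfl fun d _ => ?_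
  ring

omit [DecidableEq ι] in
theorem calabi_algebra {τ : ι → ι → ι → ℝ} (hτ : Sym₃ τ) {q : ι → ι → ι → ι → ℝ} (hq : Sym₄ q)
    (ω : ι → ι → ℝ) (r : ι → ι → ι → ℝ) :
    dot₃ τ τ ^ 2 ≤ 2 * Fintype.card ι *
      (2 * ∑ a, dot₃ (q a) (q a) - 12 * ∑ a, dot₃ (q a) (contr (τ a) τ)
        + 2 * dot₃ τ (fun b c d =>
          ∑ i, ∑ j, (τ b i j * q c d i j + τ c i j * q b d i j + τ d i j * q b c i j)
          + (-2 * (∑ i, ∑ j, ∑ k, τ b i j * τ c j k * τ d k i) + r b c d))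
        - 3 * dot₃ τ (contr (fun b m => gram₃ τ b m + ω b m) τ)
        + 6 * ∑ a, dot₃ (contr (τ a) τ) (contr (τ a) τ)
        + 6 * ∑ a, dot₃ (contr (τ a) τ) (fun b c d => contr (τ a) τ c b d)
        - (2 * dot₃ τ r - 3 * dot₃ τ (contr ω τ))) := by
  have A5 := sum_csq_sq hτ
  have A6 := sum_csq_cross hτ
  have A7 := sum_csq_dot hτ q
  have A8 := sum_csq_lower hτ hq
  have A9 := dot₃_self_sq_le (τ := τ)
  have B1 : ∑ a, dot₃ (q a) (q a) = ∑ a, ∑ b, ∑ c, ∑ d, q a b c d ^ 2 := by simp only [dot₃, sq]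
  have B2 : ∑ a, dot₃ (q a) (contr (τ a) τ) = ∑ a, ∑ b, ∑ c, ∑ d, q a b c d * csq τ a b c d := rfl
  have B3 : ∑ a, dot₃ (contr (τ a) τ) (contr (τ a) τ) = ∑ a, ∑ b, ∑ c, ∑ d, csq τ a b c d ^ 2 := by
    simp only [dot₃, sq, csq]
  have B4 : ∑ a, dot₃ (contr (τ a) τ) (fun b c d => contr (τ a) τ c b d)
      = ∑ a, ∑ b, ∑ c, ∑ d, csq τ a b c d * csq τ a c b d := rfl
  have B5 : dot₃ τ (contr (gram₃ τ) τ) = ∑ m, ∑ p, gram₃ τ m p ^ 2 := by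
    simp only [dot₃_contr_self, sq]
  rw [dot₃_add τ (fun b c d =>
      ∑ i, ∑ j, (τ b i j * q c d i j + τ c i j * q b d i j + τ d i j * q b c i j)),
    dot₃_add τ (fun b c d => -2 * (∑ i, ∑ j, ∑ k, τ b i j * τ c j k * τ d k i)), dot₃_smul, A6, A7,
    contr_add_left, dot₃_add τ (contr (gram₃ τ) τ), B5, ← A5, B4, B3, B2, B1]
  rw [← A5] at A9
  have hc : (0 : ℝ) ≤ Fintype.card ι := Nat.cast_nonneg _
  generalize ∑ a, ∑ b, ∑ c, ∑ d, csq τ a b c d ^ 2 = K at *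
  generalize ∑ a, ∑ b, ∑ c, ∑ d, csq τ a b c d * csq τ a c b d = X at *
  generalize ∑ a, ∑ b, ∑ c, ∑ d, q a b c d * csq τ a b c d = Z at *
  generalize ∑ a, ∑ b, ∑ c, ∑ d, q a b c d ^ 2 = Y at *
  nlinarith [mul_le_mul_of_nonneg_left A8 hc]

/-- The Bochner-type differential inequality for the squared norm of the cubic form. -/
theorem IsSoliton.cubicNorm_sq_le (h : IsSoliton ι N u α ξ) (hx : x ∈ N) (he : IsFrame u x e) :
    cubicNorm ι u x ^ 2 ≤ 2 * Fintype.card ι *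
      (∑ a, fderiv ℝ (fun y => fderiv ℝ (cubicNorm ι u) y (e a)) x (e a)
        - fderiv ℝ (cubicNorm ι u) x ξ) := by
  have hh := h.toHessianMetric
  have hι := h.card_eq
  have hτ : Sym₃ fun b c d => T u x (e b) (e c) (e d) := hh.sym₃_T hx e
  have hq : Sym₄ fun a b c d => Q u x (e a) (e b) (e c) (e d) :=
    ⟨fun a b c d => hh.Q_symm₁₂ hx _ _ _ _, fun a => hh.sym₃_Q hx (e a) e⟩
  have hP : ∀ b c d, ∑ a, P u x (e a) (e a) (e b) (e c) (e d)
      = ∑ i, ∑ j, (T u x (e b) (e i) (e j) * Q u x (e c) (e d) (e i) (e j)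
        + T u x (e c) (e i) (e j) * Q u x (e b) (e d) (e i) (e j)
        + T u x (e d) (e i) (e j) * Q u x (e b) (e c) (e i) (e j))
        + (-2 * (∑ i, ∑ j, ∑ k, T u x (e b) (e i) (e j) * T u x (e c) (e j) (e k)
            * T u x (e d) (e k) (e i)) + Q u x ξ (e b) (e c) (e d)) := by
    intro b c d
    have h1 := h.trace_P hx he (e b) (e c) (e d)
    have h2 : ∀ a, P u x (e a) (e a) (e b) (e c) (e d) = P u x (e b) (e c) (e d) (e a) (e a) := by
      intro a
      rw [hh.P_symm₂₃ hx, hh.P_symm₁₂ hx, hh.P_symm₃₄ hx, hh.P_symm₂₃ hx, hh.P_symm₄₅ hx,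
        hh.P_symm₃₄ hx]
    have h3 : Q u x ξ (e b) (e c) (e d) = Q u x (e b) (e c) (e d) ξ := by
      rw [hh.Q_symm₁₂ hx, hh.Q_symm₂₃ hx, hh.Q_symm₃₄ hx]
    simp only [h2]
    rw [h1, h3]
    ring
  have hQ : ∀ b m, ∑ a, Q u x (e a) (e a) (e b) (e m)
      = gram₃ (fun b c d => T u x (e b) (e c) (e d)) b m + T u x ξ (e b) (e m) := by
    intro b m
    have h1 := h.trace_Q hx he (e b) (e m)
    have h2 : ∀ a, Q u x (e a) (e a) (e b) (e m) = Q u x (e b) (e m) (e a) (e a) := by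
      intro a
      rw [hh.Q_symm₂₃ hx, hh.Q_symm₁₂ hx, hh.Q_symm₃₄ hx, hh.Q_symm₂₃ hx]
    have h3 : T u x ξ (e b) (e m) = T u x (e b) (e m) ξ := by
      rw [hh.T_symm₁₂ hx, hh.T_symm₂₃ hx]
    simp only [h2, gram₃]
    rw [h1, h3]
    simp only [mul_comm]
  have hS : cubicNorm ι u x = dot₃ (fun b c d => T u x (e b) (e c) (e d))
      (fun b c d => T u x (e b) (e c) (e d)) := by
    rw [hh.cubicNorm_eq hx hι he]
    simp only [dot₃, sq]
  have A3 := sum_dot₃ (fun b c d => T u x (e b) (e c) (e d))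
    (fun a b c d => P u x (e a) (e a) (e b) (e c) (e d))
  simp only [hP] at A3
  have A4 := sum_dot₃ (fun b c d => T u x (e b) (e c) (e d))
    (fun a => contr (fun b m => Q u x (e a) (e a) (e b) (e m))
      fun b c d => T u x (e b) (e c) (e d))
  simp only [sum_contr, hQ] at A4
  have hD := fun a => hh.fderiv_fderiv_cubicNorm hι hx he (e a)
  have hξ := hh.fderiv_cubicNorm hι hx he ξ
  rw [hS]
  simp only [hD, hξ, Finset.sum_add_distrib, Finset.sum_sub_distrib, ← Finset.mul_sum, A3, A4]
  have key := calabi_algebra hτ hq (fun b m => T u x ξ (e b) (e m))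
    fun b c d => Q u x ξ (e b) (e c) (e d)
  simp only [Finset.sum_add_distrib] at key
  exact key

end CalabiInequality

section Ramp

theorem hasDerivAt_max_sq (s : ℝ) : HasDerivAt (fun s : ℝ => max s 0 ^ 2) (2 * max s 0) s := by
  rcases lt_trichotomy s 0 with h | h | h
  · have h1 : (fun s : ℝ => max s 0 ^ 2) =ᶠ[nhds s] fun _ => 0 := by
      filter_upwards [eventually_lt_nhds h] with t ht
      simp [max_eq_right ht.le]
    rw [max_eq_right h.le, mul_zero]
    exact (hasDerivAt_const s (0 : ℝ)).congr_of_eventuallyEq h1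
  · subst h
    simp only [max_self, mul_zero]
    rw [hasDerivAt_iff_isLittleO_nhds_zero]
    have h1 : (fun h : ℝ => max (0 + h) 0 ^ 2 - max (0 : ℝ) 0 ^ 2 - h • (0 : ℝ))
        =O[nhds 0] fun h : ℝ => h ^ 2 := by
      refine Asymptotics.IsBigO.of_bound 1 (Filter.Eventually.of_forall fun h => ?_)
      simp only [zero_add, max_self, smul_zero, sub_zero, one_mul, Real.norm_eq_abs, abs_pow]
      rw [zero_pow two_ne_zero, sub_zero, abs_pow]
      refine pow_le_pow_left₀ (abs_nonneg _) ?_ 2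
      rw [abs_of_nonneg (le_max_right h 0)]
      exact max_le (le_abs_self h) (abs_nonneg h)
    refine h1.trans_isLittleO ?_
    simpa using Asymptotics.isLittleO_pow_id (𝕜 := ℝ) (one_lt_two)
  · have h1 : (fun s : ℝ => max s 0 ^ 2) =ᶠ[nhds s] fun s => s ^ 2 := by
      filter_upwards [eventually_gt_nhds h] with t ht
      simp [max_eq_left ht.le]
    rw [max_eq_left h.le]
    exact ((hasDerivAt_pow 2 s).congr_of_eventuallyEq h1).congr_deriv (by simp)

/-- A continuously differentiable ramp which vanishes for `s ≤ 0` and has slope `1` for `ε ≤ s`. -/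
def ramp (ε s : ℝ) : ℝ := (max s 0 ^ 2 - max (s - ε) 0 ^ 2) / (2 * ε)

/-- The slope of `ramp`. -/
def rampSlope (ε s : ℝ) : ℝ := (max s 0 - max (s - ε) 0) / ε

theorem hasDerivAt_ramp (ε s : ℝ) : HasDerivAt (ramp ε) (rampSlope ε s) s := by
  have h2 := (hasDerivAt_max_sq (s - ε)).comp s ((hasDerivAt_id s).sub_const ε)
  refine (((hasDerivAt_max_sq s).sub h2).div_const (2 * ε)).congr_deriv ?_
  rw [rampSlope, mul_one, ← mul_sub, mul_div_mul_left _ _ two_ne_zero]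

theorem continuous_rampSlope (ε : ℝ) : Continuous (rampSlope ε) := by
  unfold rampSlope; fun_prop

theorem rampSlope_mono {ε : ℝ} (hε : 0 < ε) : Monotone (rampSlope ε) := by
  intro s t hst
  unfold rampSlope
  gcongr ?_ / _
  rcases le_total s 0 with h1 | h1 <;> rcases le_total t 0 with h2 | h2 <;>
  rcases le_total (s - ε) 0 with h3 | h3 <;> rcases le_total (t - ε) 0 with h4 | h4 <;>
  simp only [max_eq_left, max_eq_right, h1, h2, h3, h4] <;> linarith

theorem rampSlope_nonneg {ε : ℝ} (hε : 0 < ε) (s : ℝ) : 0 ≤ rampSlope ε s := by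
  unfold rampSlope
  refine div_nonneg (sub_nonneg.2 (max_le_max_right 0 (by linarith))) hε.le

theorem rampSlope_le_one {ε : ℝ} (hε : 0 < ε) (s : ℝ) : rampSlope ε s ≤ 1 := by
  unfold rampSlope
  rw [div_le_one hε]
  rcases le_total s 0 with h1 | h1 <;> rcases le_total (s - ε) 0 with h3 | h3 <;>
  simp only [max_eq_left, max_eq_right, h1, h3] <;> linarith

theorem ramp_of_nonpos {ε s : ℝ} (hε : 0 < ε) (hs : s ≤ 0) : ramp ε s = 0 := by
  rw [ramp, max_eq_right hs, max_eq_right (by linarith)]; simp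

theorem ramp_of_le {ε s : ℝ} (hε : 0 < ε) (hs : ε ≤ s) : ramp ε s = s - ε / 2 := by
  rw [ramp, max_eq_left (by linarith), max_eq_left (by linarith)]
  field_simp
  ring

/-- A change of time which is `a` for `t ≤ 0`, is `b` for `b - a + ε ≤ t`, with slope at most `1`. -/
def timeChange (a b ε t : ℝ) : ℝ := a + ramp ε t - ramp ε (t - (b - a))

/-- The slope of `timeChange`. -/
def timeSlope (a b ε t : ℝ) : ℝ := rampSlope ε t - rampSlope ε (t - (b - a))

variable {a b ε : ℝ}

theorem hasDerivAt_timeChange (a b ε t : ℝ) :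
    HasDerivAt (timeChange a b ε) (timeSlope a b ε t) t := by
  have h2 := (hasDerivAt_ramp ε (t - (b - a))).comp t ((hasDerivAt_id t).sub_const (b - a))
  exact (((hasDerivAt_ramp ε t).const_add a).sub h2).congr_deriv (by simp [timeSlope])

theorem continuous_timeSlope (a b ε : ℝ) : Continuous (timeSlope a b ε) :=
  (continuous_rampSlope ε).sub ((continuous_rampSlope ε).comp (by fun_prop))

theorem timeSlope_nonneg (hab : a ≤ b) (hε : 0 < ε) (t : ℝ) : 0 ≤ timeSlope a b ε t :=
  sub_nonneg.2 (rampSlope_mono hε (by linarith))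

theorem timeSlope_le_one (hε : 0 < ε) (t : ℝ) : timeSlope a b ε t ≤ 1 := by
  have := rampSlope_le_one hε t
  have := rampSlope_nonneg hε (t - (b - a))
  unfold timeSlope; linarith

theorem timeChange_of_nonpos (hab : a ≤ b) (hε : 0 < ε) {t : ℝ} (ht : t ≤ 0) :
    timeChange a b ε t = a := by
  rw [timeChange, ramp_of_nonpos hε ht, ramp_of_nonpos hε (by linarith)]; ring

theorem timeChange_of_le (hab : a ≤ b) (hε : 0 < ε) {t : ℝ} (ht : b - a + ε ≤ t) :
    timeChange a b ε t = b := by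
  rw [timeChange, ramp_of_le hε (by linarith), ramp_of_le hε (by linarith)]; ring

end Ramp

section Taylor

open Set Filter Topology

variable {E : Type*} [NormedAddCommGroup E] [NormedSpace ℝ E]

/-- Second order Taylor expansion along lines, uniformly on compact sets. -/
theorem uniform_taylor {F : E → ℝ} {D₁ D₂ : E → E → ℝ} {Ω K W : Set E} (hΩ : IsOpen Ω)
    (h₁ : ∀ z w (t : ℝ), z + t • w ∈ Ω →
      HasDerivAt (fun s : ℝ => F (z + s • w)) (D₁ (z + t • w) w) t)
    (h₂ : ∀ z w (t : ℝ), z + t • w ∈ Ω →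
      HasDerivAt (fun s : ℝ => D₁ (z + s • w) w) (D₂ (z + t • w) w) t)
    (hc : ∀ z ∈ Ω, ∀ w, ContinuousAt (fun q : E × E => D₂ q.1 q.2) (z, w))
    (hK : IsCompact K) (hKΩ : K ⊆ Ω) (hW : IsCompact W) {ε : ℝ} (hε : 0 < ε) :
    ∃ s₀ > 0, ∀ z ∈ K, ∀ w ∈ W, ∀ s : ℝ, |s| ≤ s₀ → z + s • w ∈ Ω ∧
      |F (z + s • w) - F z - s * D₁ z w - s ^ 2 / 2 * D₂ z w| ≤ ε * s ^ 2 := by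
  have h3 : ∀ᶠ s : ℝ in 𝓝 0, ∀ q ∈ K ×ˢ W, q.1 + s • q.2 ∈ Ω ∧
      |D₂ (q.1 + s • q.2) q.2 - D₂ q.1 q.2| < ε := by
    refine (hK.prod hW).eventually_forall_of_forall_eventually fun q hq => ?_
    have hΩq : q.1 ∈ Ω := hKΩ hq.1
    have c1 : ContinuousAt (fun z : ℝ × (E × E) => z.2.1 + z.1 • z.2.2) ((0 : ℝ), q) := by fun_prop
    have e1 := c1.eventually_mem (s := Ω) (hΩ.mem_nhds (by simpa using hΩq))
    have c2 : ContinuousAt (fun z : ℝ × (E × E) => D₂ (z.2.1 + z.1 • z.2.2) z.2.2)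
        ((0 : ℝ), q) := by
      have c3 : ContinuousAt (fun z : ℝ × (E × E) => (z.2.1 + z.1 • z.2.2, z.2.2))
        ((0 : ℝ), q) := by fun_prop
      refine ContinuousAt.comp (g := fun q : E × E => D₂ q.1 q.2) ?_ c3
      simpa using hc q.1 hΩq q.2
    have c4 : ContinuousAt (fun z : ℝ × (E × E) => D₂ z.2.1 z.2.2) ((0 : ℝ), q) :=
      ContinuousAt.comp (g := fun q : E × E => D₂ q.1 q.2) (hc q.1 hΩq q.2) continuousAt_snd
    have e2 := (c2.sub c4).abs.tendsto.eventually_lt_const (u := ε) (by simpa using hε)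
    filter_upwards [e1, e2] with z hz1 hz2 using ⟨hz1, hz2⟩
  obtain ⟨s₀, hs₀, hs⟩ := Metric.eventually_nhds_iff.1 h3
  refine ⟨s₀ / 2, half_pos hs₀, fun z hz w hw s hs' => ?_⟩
  have key : ∀ t : ℝ, |t| ≤ |s| → z + t • w ∈ Ω ∧ |D₂ (z + t • w) w - D₂ z w| ≤ ε := fun t ht => by
    have := hs (y := t) (by rw [Real.dist_eq, sub_zero]; linarith) (z, w) ⟨hz, hw⟩
    exact ⟨this.1, this.2.le⟩
  refine ⟨(key s le_rfl).1, ?_⟩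
  have d1 : ∀ t : ℝ, |t| ≤ |s| → HasDerivAt (fun r : ℝ => D₁ (z + r • w) w - r * D₂ z w)
      (D₂ (z + t • w) w - D₂ z w) t := fun t ht => by
    refine ((h₂ z w t (key t ht).1).sub ((hasDerivAt_id t).mul_const (D₂ z w))).congr_deriv ?_
    rw [one_mul]
  have b1 : ∀ t : ℝ, |t| ≤ |s| → |D₁ (z + t • w) w - D₁ z w - t * D₂ z w| ≤ ε * |s| := by
    intro t ht
    have := (convex_Icc (-|s|) |s|).norm_image_sub_le_of_norm_hasDerivWithin_le (C := ε)
      (fun r hr => (d1 r (abs_le.2 hr)).hasDerivWithinAt) (fun r hr => (key r (abs_le.2 hr)).2)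
      (show (0 : ℝ) ∈ Icc (-|s|) |s| by simp) (y := t) (abs_le.1 ht)
    simp only [Real.norm_eq_abs, zero_smul, add_zero, zero_mul, sub_zero] at this
    rw [sub_right_comm]
    exact this.trans (by gcongr)
  have d2 : ∀ t : ℝ, |t| ≤ |s| →
      HasDerivAt (fun r : ℝ => F (z + r • w) - r * D₁ z w - r ^ 2 / 2 * D₂ z w)
      (D₁ (z + t • w) w - D₁ z w - t * D₂ z w) t := fun t ht => by
    refine (((h₁ z w t (key t ht).1).sub ((hasDerivAt_id t).mul_const (D₁ z w))).sub
      (((hasDerivAt_pow 2 t).div_const 2).mul_const (D₂ z w))).congr_deriv ?_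
    simp
  have := (convex_Icc (-|s|) |s|).norm_image_sub_le_of_norm_hasDerivWithin_le (C := ε * |s|)
      (fun r hr => (d2 r (abs_le.2 hr)).hasDerivWithinAt) (fun r hr => b1 r (abs_le.2 hr))
      (show (0 : ℝ) ∈ Icc (-|s|) |s| by simp) (y := s) (abs_le.1 le_rfl)
  simp only [Real.norm_eq_abs, zero_smul, add_zero, zero_mul, sub_zero] at this
  rw [mul_assoc, ← sq, sq_abs] at this
  refine le_trans (le_of_eq ?_) this
  congr 1
  ring

/-- First order Taylor expansion along lines, uniformly on compact sets. -/
theorem uniform_taylor_one {F : E → ℝ} {D₁ : E → E → ℝ} {Ω K W : Set E} (hΩ : IsOpen Ω)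
    (h₁ : ∀ z w (t : ℝ), z + t • w ∈ Ω →
      HasDerivAt (fun s : ℝ => F (z + s • w)) (D₁ (z + t • w) w) t)
    (hc : ∀ z ∈ Ω, ∀ w, ContinuousAt (fun q : E × E => D₁ q.1 q.2) (z, w))
    (hK : IsCompact K) (hKΩ : K ⊆ Ω) (hW : IsCompact W) {ε : ℝ} (hε : 0 < ε) :
    ∃ s₀ > 0, ∀ z ∈ K, ∀ w ∈ W, ∀ s : ℝ, |s| ≤ s₀ → z + s • w ∈ Ω ∧
      |F (z + s • w) - F z - s * D₁ z w| ≤ ε * |s| := by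
  have h3 : ∀ᶠ s : ℝ in 𝓝 0, ∀ q ∈ K ×ˢ W, q.1 + s • q.2 ∈ Ω ∧
      |D₁ (q.1 + s • q.2) q.2 - D₁ q.1 q.2| < ε := by
    refine (hK.prod hW).eventually_forall_of_forall_eventually fun q hq => ?_
    have hΩq : q.1 ∈ Ω := hKΩ hq.1
    have c1 : ContinuousAt (fun z : ℝ × (E × E) => z.2.1 + z.1 • z.2.2) ((0 : ℝ), q) := by fun_prop
    have e1 := c1.eventually_mem (s := Ω) (hΩ.mem_nhds (by simpa using hΩq))
    have c2 : ContinuousAt (fun z : ℝ × (E × E) => D₁ (z.2.1 + z.1 • z.2.2) z.2.2)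
        ((0 : ℝ), q) := by
      have c3 : ContinuousAt (fun z : ℝ × (E × E) => (z.2.1 + z.1 • z.2.2, z.2.2))
        ((0 : ℝ), q) := by fun_prop
      refine ContinuousAt.comp (g := fun q : E × E => D₁ q.1 q.2) ?_ c3
      simpa using hc q.1 hΩq q.2
    have c4 : ContinuousAt (fun z : ℝ × (E × E) => D₁ z.2.1 z.2.2) ((0 : ℝ), q) :=
      ContinuousAt.comp (g := fun q : E × E => D₁ q.1 q.2) (hc q.1 hΩq q.2) continuousAt_snd
    have e2 := (c2.sub c4).abs.tendsto.eventually_lt_const (u := ε) (by simpa using hε)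
    filter_upwards [e1, e2] with z hz1 hz2 using ⟨hz1, hz2⟩
  obtain ⟨s₀, hs₀, hs⟩ := Metric.eventually_nhds_iff.1 h3
  refine ⟨s₀ / 2, half_pos hs₀, fun z hz w hw s hs' => ?_⟩
  have key : ∀ t : ℝ, |t| ≤ |s| → z + t • w ∈ Ω ∧ |D₁ (z + t • w) w - D₁ z w| ≤ ε := fun t ht => by
    have := hs (y := t) (by rw [Real.dist_eq, sub_zero]; linarith) (z, w) ⟨hz, hw⟩
    exact ⟨this.1, this.2.le⟩
  refine ⟨(key s le_rfl).1, ?_⟩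
  have d1 : ∀ t : ℝ, |t| ≤ |s| → HasDerivAt (fun r : ℝ => F (z + r • w) - r * D₁ z w)
      (D₁ (z + t • w) w - D₁ z w) t := fun t ht => by
    refine ((h₁ z w t (key t ht).1).sub ((hasDerivAt_id t).mul_const (D₁ z w))).congr_deriv ?_
    rw [one_mul]
  have := (convex_Icc (-|s|) |s|).norm_image_sub_le_of_norm_hasDerivWithin_le (C := ε)
      (fun r hr => (d1 r (abs_le.2 hr)).hasDerivWithinAt) (fun r hr => (key r (abs_le.2 hr)).2)
      (show (0 : ℝ) ∈ Icc (-|s|) |s| by simp) (y := s) (abs_le.1 le_rfl)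
  simp only [Real.norm_eq_abs, zero_smul, add_zero, zero_mul, sub_zero] at this
  rwa [sub_right_comm]

end Taylor

section Expansion

open Set Filter Topology

variable {E : Type*} [NormedAddCommGroup E] [NormedSpace ℝ E]
  {N : Set E} {u : E → ℝ}

namespace HessianMetric

variable {X : Type*} [TopologicalSpace X] {p a b c d : X → E} {y : X}

theorem continuousAt_G (h : HessianMetric N u) (hy : p y ∈ N) (hp : ContinuousAt p y)
    (ha : ContinuousAt a y) (hb : ContinuousAt b y) :
    ContinuousAt (fun z => G u (p z) (a z) (b z)) y := by
  have := (h.contDiffAt_G (p := fun z : E × E × E => z.1) (a := fun z => z.2.1)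
    (b := fun z => z.2.2) (y := (p y, a y, b y)) hy (by fun_prop) (by fun_prop)
    (by fun_prop)).continuousAt
  exact ContinuousAt.comp (f := fun z => (p z, a z, b z)) this (hp.prodMk (ha.prodMk hb))

theorem continuousAt_T (h : HessianMetric N u) (hy : p y ∈ N) (hp : ContinuousAt p y)
    (ha : ContinuousAt a y) (hb : ContinuousAt b y) (hc : ContinuousAt c y) :
    ContinuousAt (fun z => T u (p z) (a z) (b z) (c z)) y := by
  have := (h.contDiffAt_T (p := fun z : E × E × E × E => z.1) (a := fun z => z.2.1)
    (b := fun z => z.2.2.1) (c := fun z => z.2.2.2) (y := (p y, a y, b y, c y)) hy (by fun_prop)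
    (by fun_prop) (by fun_prop) (by fun_prop)).continuousAt
  exact ContinuousAt.comp (f := fun z => (p z, a z, b z, c z)) this
    (hp.prodMk (ha.prodMk (hb.prodMk hc)))

theorem continuousAt_Q (h : HessianMetric N u) (hy : p y ∈ N) (hp : ContinuousAt p y)
    (ha : ContinuousAt a y) (hb : ContinuousAt b y) (hc : ContinuousAt c y)
    (hd : ContinuousAt d y) :
    ContinuousAt (fun z => Q u (p z) (a z) (b z) (c z) (d z)) y := by
  have := (h.contDiffAt_Q (p := fun z : E × E × E × E × E => z.1) (a := fun z => z.2.1)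
    (b := fun z => z.2.2.1) (c := fun z => z.2.2.2.1) (d := fun z => z.2.2.2.2)
    (y := (p y, a y, b y, c y, d y)) hy (by fun_prop)
    (by fun_prop) (by fun_prop) (by fun_prop) (by fun_prop)).continuousAt
  exact ContinuousAt.comp (f := fun z => (p z, a z, b z, c z, d z)) this
    (hp.prodMk (ha.prodMk (hb.prodMk (hc.prodMk hd))))

theorem hasDerivAt_energy_line (h : HessianMetric N u) (z w p q : E) (t : ℝ)
    (ht : z + t • w ∈ N) :
    HasDerivAt (fun s : ℝ => G u (z + s • w) (p + s • q) (p + s • q))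
      (T u (z + t • w) w (p + t • q) (p + t • q) + 2 * G u (z + t • w) (p + t • q) q) t := by
  refine (h.hasDerivAt_G (hasDerivAt_line z w t) ht (hasDerivAt_line p q t)
    (hasDerivAt_line p q t)).congr_deriv ?_
  rw [h.G_symm ht q]; ring

theorem continuousAt_energyDeriv (h : HessianMetric N u) {z : E} (hz : z ∈ N) (w p q : E) :
    ContinuousAt (fun y : (E × E) × E × E => T u y.1.1 y.2.1 y.1.2 y.1.2 + 2 * G u y.1.1 y.1.2 y.2.2)
      ((z, p), (w, q)) := by
  have h1 := h.continuousAt_T (p := fun y : (E × E) × E × E => y.1.1) (a := fun y => y.2.1)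
    (b := fun y => y.1.2) (c := fun y => y.1.2) (y := ((z, p), (w, q))) hz (by fun_prop)
    (by fun_prop) (by fun_prop) (by fun_prop)
  have h2 := h.continuousAt_G (p := fun y : (E × E) × E × E => y.1.1) (a := fun y => y.1.2)
    (b := fun y => y.2.2) (y := ((z, p), (w, q))) hz (by fun_prop) (by fun_prop) (by fun_prop)
  exact h1.add (h2.const_mul 2)

theorem continuousAt_energyDeriv₂ (h : HessianMetric N u) {z : E} (hz : z ∈ N) (w p q : E) :
    ContinuousAt (fun y : (E × E) × E × E => Q u y.1.1 y.2.1 y.2.1 y.1.2 y.1.2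
      + 4 * T u y.1.1 y.2.1 y.1.2 y.2.2 + 2 * G u y.1.1 y.2.2 y.2.2) ((z, p), (w, q)) := by
  have h0 := h.continuousAt_Q (p := fun y : (E × E) × E × E => y.1.1) (a := fun y => y.2.1)
    (b := fun y => y.2.1) (c := fun y => y.1.2) (d := fun y => y.1.2) (y := ((z, p), (w, q))) hz
    (by fun_prop) (by fun_prop) (by fun_prop) (by fun_prop) (by fun_prop)
  have h1 := h.continuousAt_T (p := fun y : (E × E) × E × E => y.1.1) (a := fun y => y.2.1)
    (b := fun y => y.1.2) (c := fun y => y.2.2) (y := ((z, p), (w, q))) hz (by fun_prop)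
    (by fun_prop) (by fun_prop) (by fun_prop)
  have h2 := h.continuousAt_G (p := fun y : (E × E) × E × E => y.1.1) (a := fun y => y.2.2)
    (b := fun y => y.2.2) (y := ((z, p), (w, q))) hz (by fun_prop) (by fun_prop) (by fun_prop)
  exact (h0.add (h1.const_mul 4)).add (h2.const_mul 2)

variable {K W : Set (E × E)}

/-- Second order expansion of the kinetic energy `G u x p p`, uniformly on compact sets. -/
theorem taylor_energy (h : HessianMetric N u) (hK : IsCompact K) (hKN : ∀ z ∈ K, z.1 ∈ N)
    (hW : IsCompact W) {ε : ℝ} (hε : 0 < ε) :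
    ∃ s₀ > 0, ∀ z ∈ K, ∀ w ∈ W, ∀ s : ℝ, |s| ≤ s₀ → z.1 + s • w.1 ∈ N ∧
      |G u (z.1 + s • w.1) (z.2 + s • w.2) (z.2 + s • w.2) - G u z.1 z.2 z.2
        - s * (T u z.1 w.1 z.2 z.2 + 2 * G u z.1 z.2 w.2)
        - s ^ 2 / 2 * (Q u z.1 w.1 w.1 z.2 z.2 + 4 * T u z.1 w.1 z.2 w.2 + 2 * G u z.1 w.2 w.2)|
        ≤ ε * s ^ 2 := by
  have hd : ∀ (z w : E × E) (t : ℝ), z + t • w ∈ N ×ˢ (univ : Set E) →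
      HasDerivAt (fun s : ℝ => T u (z + s • w).1 w.1 (z + s • w).2 (z + s • w).2
        + 2 * G u (z + s • w).1 (z + s • w).2 w.2)
      (Q u (z + t • w).1 w.1 w.1 (z + t • w).2 (z + t • w).2
        + 4 * T u (z + t • w).1 w.1 (z + t • w).2 w.2 + 2 * G u (z + t • w).1 w.2 w.2) t := by
    intro z w t ht
    have ht' : z.1 + t • w.1 ∈ N := ht.1
    refine ((h.hasDerivAt_T (hasDerivAt_line z.1 w.1 t) ht' (hasDerivAt_const t w.1)
      (hasDerivAt_line z.2 w.2 t) (hasDerivAt_line z.2 w.2 t)).add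
      ((h.hasDerivAt_G (hasDerivAt_line z.1 w.1 t) ht'
      (hasDerivAt_line z.2 w.2 t) (hasDerivAt_const t w.2)).const_mul 2)).congr_deriv ?_
    rw [T_zero₁, G_zero₂, h.T_symm₂₃ ht' w.1 w.2]
    simp only [Prod.fst_add, Prod.snd_add, Prod.smul_fst, Prod.smul_snd]
    ring
  obtain ⟨s₀, hs₀, H⟩ := uniform_taylor (F := fun z : E × E => G u z.1 z.2 z.2)
    (D₁ := fun z w => T u z.1 w.1 z.2 z.2 + 2 * G u z.1 z.2 w.2)
    (D₂ := fun z w => Q u z.1 w.1 w.1 z.2 z.2 + 4 * T u z.1 w.1 z.2 w.2 + 2 * G u z.1 w.2 w.2)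
    (Ω := N ×ˢ univ) (h.isOpen.prod isOpen_univ)
    (fun z w t ht => h.hasDerivAt_energy_line z.1 w.1 z.2 w.2 t ht.1) hd
    (fun z hz w => h.continuousAt_energyDeriv₂ hz.1 w.1 z.2 w.2) hK
    (fun z hz => ⟨hKN z hz, trivial⟩) hW hε
  exact ⟨s₀, hs₀, fun z hz w hw s hs => ⟨(H z hz w hw s hs).1.1, (H z hz w hw s hs).2⟩⟩

/-- First order expansion of the kinetic energy `G u x p p`, uniformly on compact sets. -/
theorem taylor_energy_one (h : HessianMetric N u) (hK : IsCompact K) (hKN : ∀ z ∈ K, z.1 ∈ N)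
    (hW : IsCompact W) {ε : ℝ} (hε : 0 < ε) :
    ∃ s₀ > 0, ∀ z ∈ K, ∀ w ∈ W, ∀ s : ℝ, |s| ≤ s₀ → z.1 + s • w.1 ∈ N ∧
      |G u (z.1 + s • w.1) (z.2 + s • w.2) (z.2 + s • w.2) - G u z.1 z.2 z.2
        - s * (T u z.1 w.1 z.2 z.2 + 2 * G u z.1 z.2 w.2)| ≤ ε * |s| := by
  obtain ⟨s₀, hs₀, H⟩ := uniform_taylor_one (F := fun z : E × E => G u z.1 z.2 z.2)
    (D₁ := fun z w => T u z.1 w.1 z.2 z.2 + 2 * G u z.1 z.2 w.2)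
    (Ω := N ×ˢ univ) (h.isOpen.prod isOpen_univ)
    (fun z w t ht => h.hasDerivAt_energy_line z.1 w.1 z.2 w.2 t ht.1)
    (fun z hz w => h.continuousAt_energyDeriv hz.1 w.1 z.2 w.2) hK
    (fun z hz => ⟨hKN z hz, trivial⟩) hW hε
  exact ⟨s₀, hs₀, fun z hz w hw s hs => ⟨(H z hz w hw s hs).1.1, (H z hz w hw s hs).2⟩⟩

end HessianMetric

end Expansion

section Paths

open Set Filter Topology

variable {E : Type*} [NormedAddCommGroup E] [NormedSpace ℝ E] {N : Set E} {u : E → ℝ}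

/-- On compact sets, the metric `G u x` is uniformly equivalent to the norm. -/
theorem HessianMetric.exists_norm_bound [FiniteDimensional ℝ E] (h : HessianMetric N u) {K : Set E}
    (hK : IsCompact K) (hKN : K ⊆ N) :
    ∃ C > 0, ∀ x ∈ K, ∀ v, ‖v‖ ^ 2 ≤ C * G u x v v ∧ G u x v v ≤ C * ‖v‖ ^ 2 := by
  have := FiniteDimensional.proper_real E
  have hS : IsCompact (K ×ˢ Metric.sphere (0 : E) 1) := hK.prod (isCompact_sphere 0 1)
  have hc : ContinuousOn (fun q : E × E => G u q.1 q.2 q.2) (K ×ˢ Metric.sphere (0 : E) 1) :=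
    fun q hq => (h.continuousAt_G (hKN hq.1) continuousAt_fst continuousAt_snd
      continuousAt_snd).continuousWithinAt
  have hp : ∀ q ∈ K ×ˢ Metric.sphere (0 : E) 1, 0 < G u q.1 q.2 q.2 := fun q hq =>
    h.pos q.1 (hKN hq.1) q.2 (by rintro h0; simpa [h0] using hq.2)
  obtain ⟨C₁, hC₁⟩ := (hS.image_of_continuousOn hc).bddAbove
  obtain ⟨C₂, hC₂⟩ := (hS.image_of_continuousOn (hc.inv₀ fun q hq => (hp q hq).ne')).bddAbove
  refine ⟨max 1 (max C₁ C₂), by positivity, fun x hx v => ?_⟩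
  rcases eq_or_ne v 0 with rfl | hv
  · simp [G_zero₁]
  have hv' : 0 < ‖v‖ := norm_pos_iff.2 hv
  set e := ‖v‖⁻¹ • v with he
  have hve : v = ‖v‖ • e := by rw [he, smul_smul, mul_inv_cancel₀ hv'.ne', one_smul]
  have hes : (x, e) ∈ K ×ˢ Metric.sphere (0 : E) 1 := by
    refine ⟨hx, ?_⟩
    simp [he, norm_smul, inv_mul_cancel₀ hv'.ne']
  have hGe : G u x v v = ‖v‖ ^ 2 * G u x e e := by
    conv_lhs => rw [hve]
    rw [G_smul₁, G_smul₂]; ring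
  have h1 : G u x e e ≤ C₁ := hC₁ ⟨_, hes, rfl⟩
  have h2 : (G u x e e)⁻¹ ≤ C₂ := hC₂ ⟨_, hes, rfl⟩
  have h3 := hp _ hes
  rw [hGe]
  constructor
  · have : 1 ≤ max 1 (max C₁ C₂) * G u x e e := by
      have h4 : (G u x e e)⁻¹ ≤ max 1 (max C₁ C₂) := h2.trans (by simp)
      calc 1 = (G u x e e)⁻¹ * G u x e e := (inv_mul_cancel₀ h3.ne').symm
        _ ≤ _ := by gcongr
    nlinarith [sq_nonneg ‖v‖]
  · rw [mul_comm]
    have h4 : G u x e e ≤ max 1 (max C₁ C₂) := h1.trans (by simp)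
    gcongr

/-- A `C¹` curve in `N`, with velocity `γ'`, of speed at most one for the Hessian metric. -/
structure IsPath (N : Set E) (u : E → ℝ) (γ γ' : ℝ → E) : Prop where
  hasDerivAt : ∀ t, HasDerivAt γ (γ' t) t
  continuous_deriv : Continuous γ'
  mem : ∀ t, γ t ∈ N
  speed : ∀ t, G u (γ t) (γ' t) (γ' t) ≤ 1

/-- The point `y` can be reached from `x` in time `r` at speed at most one. -/
def Reach (N : Set E) (u : E → ℝ) (x y : E) (r : ℝ) : Prop :=
  ∃ γ γ' : ℝ → E, IsPath N u γ γ' ∧ (∀ t ≤ 0, γ t = x) ∧ ∀ t, r ≤ t → γ t = y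

namespace IsPath

variable {γ γ' : ℝ → E} {a b r ε : ℝ} {x y : E}

theorem continuous (h : IsPath N u γ γ') : Continuous γ :=
  continuous_iff_continuousAt.2 fun t => (h.hasDerivAt t).continuousAt

theorem deriv_eq_zero_of_le (h : IsPath N u γ γ') (h0 : ∀ t ≤ a, γ t = x) {t : ℝ} (ht : t ≤ a) :
    γ' t = 0 := by
  have h1 : HasDerivWithinAt γ (γ' t) (Iic t) t := (h.hasDerivAt t).hasDerivWithinAt
  have h2 : HasDerivWithinAt γ 0 (Iic t) t :=
    (hasDerivWithinAt_const t (Iic t) x).congr (fun s hs => h0 s (le_trans hs ht)) (h0 t ht)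
  exact (uniqueDiffOn_Iic t t self_mem_Iic).eq_deriv _ h1 h2

theorem deriv_eq_zero_of_ge (h : IsPath N u γ γ') (h0 : ∀ t, a ≤ t → γ t = x) {t : ℝ}
    (ht : a ≤ t) : γ' t = 0 := by
  have h1 : HasDerivWithinAt γ (γ' t) (Ici t) t := (h.hasDerivAt t).hasDerivWithinAt
  have h2 : HasDerivWithinAt γ 0 (Ici t) t :=
    (hasDerivWithinAt_const t (Ici t) x).congr (fun s hs => h0 s (le_trans ht hs)) (h0 t ht)
  exact (uniqueDiffOn_Ici t t self_mem_Ici).eq_deriv _ h1 h2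

theorem reach (h : IsPath N u γ γ') (hab : a ≤ b) (hε : 0 < ε) :
    Reach N u (γ a) (γ b) (b - a + ε) := by
  refine ⟨fun t => γ (timeChange a b ε t), fun t => timeSlope a b ε t • γ' (timeChange a b ε t),
    ⟨fun t => (h.hasDerivAt _).scomp t (hasDerivAt_timeChange a b ε t), ?_, fun t => h.mem _,
      fun t => ?_⟩, fun t ht => ?_, fun t ht => ?_⟩
  · have : Continuous (timeChange a b ε) :=
      continuous_iff_continuousAt.2 fun t => (hasDerivAt_timeChange a b ε t).continuousAt
    exact (continuous_timeSlope a b ε).smul (h.continuous_deriv.comp this)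
  · rw [G_smul₁, G_smul₂, ← mul_assoc]
    have h0 := timeSlope_nonneg hab hε t
    have h1 := timeSlope_le_one (a := a) (b := b) hε t
    have h2 := h.speed (timeChange a b ε t)
    calc _ ≤ timeSlope a b ε t * timeSlope a b ε t * 1 := by gcongr
      _ ≤ 1 := by nlinarith
  · simp only [timeChange_of_nonpos hab hε ht]
  · simp only [timeChange_of_le hab hε ht]

/-- Concatenation of paths. -/
theorem concat (h : IsPath N u γ γ') (ha : ∀ t, a ≤ t → γ t = x) {η η' : ℝ → E}
    (h' : IsPath N u η η') (h0 : ∀ t ≤ 0, η t = x) :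
    IsPath N u (fun t => γ t + (η (t - a) - x)) (fun t => γ' t + η' (t - a)) ∧
      (∀ t ≤ a, γ t + (η (t - a) - x) = γ t) ∧ ∀ t, a ≤ t → γ t + (η (t - a) - x) = η (t - a) := by
  have e1 : ∀ t ≤ a, γ t + (η (t - a) - x) = γ t := fun t ht => by
    rw [h0 (t - a) (by linarith), sub_self, add_zero]
  have e2 : ∀ t, a ≤ t → γ t + (η (t - a) - x) = η (t - a) := fun t ht => by
    rw [ha t ht, add_sub_cancel]
  refine ⟨⟨fun t => ?_, ?_, fun t => ?_, fun t => ?_⟩, e1, e2⟩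
  · have := (h'.hasDerivAt (t - a)).scomp t ((hasDerivAt_id t).sub_const a)
    rw [one_smul] at this
    exact (h.hasDerivAt t).add (this.sub_const x)
  · exact h.continuous_deriv.add (h'.continuous_deriv.comp (continuous_sub_right a))
  · rcases le_total t a with ht | ht
    · rw [e1 t ht]; exact h.mem t
    · rw [e2 t ht]; exact h'.mem _
  · rcases le_total t a with ht | ht
    · rw [e1 t ht, h'.deriv_eq_zero_of_le h0 (by linarith : t - a ≤ 0), add_zero]; exact h.speed t
    · rw [e2 t ht, h.deriv_eq_zero_of_ge ha ht, zero_add]; exact h'.speed _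

end IsPath

namespace Reach

variable {x y z : E} {a b r : ℝ}

theorem refl (hx : x ∈ N) (r : ℝ) : Reach N u x x r :=
  ⟨fun _ => x, fun _ => 0, ⟨fun t => hasDerivAt_const t x, continuous_const, fun _ => hx,
    fun _ => by simp [G_zero₁]⟩, fun _ _ => rfl, fun _ _ => rfl⟩

theorem mono (h : Reach N u x y a) (hab : a ≤ b) : Reach N u x y b := by
  obtain ⟨γ, γ', hγ, h0, h1⟩ := h
  exact ⟨γ, γ', hγ, h0, fun t ht => h1 t (hab.trans ht)⟩

theorem trans (h : Reach N u x y a) (h' : Reach N u y z b) (ha : 0 ≤ a) (hb : 0 ≤ b) :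
    Reach N u x z (a + b) := by
  obtain ⟨γ, γ', hγ, h0, h1⟩ := h
  obtain ⟨η, η', hη, h0', h1'⟩ := h'
  obtain ⟨hp, e1, e2⟩ := hγ.concat h1 hη h0'
  refine ⟨_, _, hp, fun t ht => (e1 t (ht.trans ha)).trans (h0 t ht), fun t ht => ?_⟩
  exact (e2 t (by linarith)).trans (h1' _ (by linarith))

end Reach

/-- Nearby points can be joined in a short time. -/
theorem HessianMetric.exists_ball_reach [FiniteDimensional ℝ E] (h : HessianMetric N u) {z : E}
    (hz : z ∈ N) {ε : ℝ} (hε : 0 < ε) :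
    ∃ δ > 0, Metric.ball z δ ⊆ N ∧ ∀ y ∈ Metric.ball z δ, ∀ y' ∈ Metric.ball z δ,
      Reach N u y y' ε := by
  have := FiniteDimensional.proper_real E
  obtain ⟨ρ, hρ, hρN⟩ := Metric.isOpen_iff.1 h.isOpen z hz
  obtain ⟨C, hC, hCb⟩ := h.exists_norm_bound (isCompact_closedBall z (ρ / 2))
    ((Metric.closedBall_subset_ball (half_lt_self hρ)).trans hρN)
  obtain ⟨δ, hδ, hδ'⟩ : ∃ δ > 0, C * (4 * δ / ε) ^ 2 ≤ 1 := by
    have hc : ContinuousAt (fun δ : ℝ => C * (4 * δ / ε) ^ 2) 0 := by fun_prop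
    have := hc.eventually_lt_const (u := 1) (by simp)
    obtain ⟨δ, hδ, H⟩ := Metric.eventually_nhds_iff.1 this
    exact ⟨δ / 2, by positivity, (H (by rw [Real.dist_eq, sub_zero, abs_of_pos] <;> linarith)).le⟩
  have hsub : Metric.ball z (min δ (ρ / 2)) ⊆ Metric.closedBall z (ρ / 2) :=
    (Metric.ball_subset_ball (min_le_right _ _)).trans Metric.ball_subset_closedBall
  have hsubN := hsub.trans ((Metric.closedBall_subset_ball (half_lt_self hρ)).trans hρN)
  refine ⟨min δ (ρ / 2), by positivity, hsubN, fun y hy y' hy' => ?_⟩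
  have hε2 : (2 / ε) * ε = 2 := by field_simp
  have hd : ∀ t, HasDerivAt (fun t => y + timeChange 0 1 1 (2 / ε * t) • (y' - y))
      ((2 / ε * timeSlope 0 1 1 (2 / ε * t)) • (y' - y)) t := fun t => by
    have h1 : HasDerivAt (fun t : ℝ => 2 / ε * t) (2 / ε) t := by
      simpa using (hasDerivAt_id t).const_mul (2 / ε)
    have h2 := ((hasDerivAt_timeChange 0 1 1 (2 / ε * t)).comp t h1).smul_const (y' - y)
    rw [mul_comm (2 / ε)]
    exact h2.const_add y
  have hmem : ∀ t, y + timeChange 0 1 1 (2 / ε * t) • (y' - y) ∈ Metric.ball z (min δ (ρ / 2)) := by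
    intro t
    have h0 : 0 ≤ timeChange 0 1 1 (2 / ε * t) ∧ timeChange 0 1 1 (2 / ε * t) ≤ 1 := by
      have hm : Monotone (timeChange 0 1 1) := monotone_of_hasDerivAt_nonneg
        (hasDerivAt_timeChange 0 1 1) fun t => timeSlope_nonneg zero_le_one one_pos t
      constructor
      · exact (timeChange_of_nonpos zero_le_one one_pos (min_le_right (2 / ε * t) 0)).ge.trans
          (hm (min_le_left _ _))
      · exact (hm (le_max_left _ _)).trans
          (timeChange_of_le zero_le_one one_pos (le_max_right (2 / ε * t) (1 - 0 + 1))).le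
    exact (convex_ball z _).add_smul_sub_mem hy hy' h0
  refine ⟨_, _, ⟨hd, ?_, fun t => hsubN (hmem t), fun t => ?_⟩, fun t ht => ?_, fun t ht => ?_⟩
  · exact (((continuous_timeSlope 0 1 1).comp (continuous_const.mul continuous_id)).const_mul
      _).smul continuous_const
  · refine ((hCb _ (hsub (hmem t)) _).2).trans (le_trans ?_ hδ')
    gcongr
    rw [norm_smul, norm_mul, Real.norm_eq_abs, Real.norm_eq_abs, abs_of_pos (by positivity : 0 < 2 / ε),
      abs_of_nonneg (timeSlope_nonneg zero_le_one one_pos _)]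
    have h1 : ‖y' - y‖ ≤ 2 * δ := by
      have h2 := dist_triangle_right y' y z
      have h3 := (Metric.mem_ball.1 hy).trans_le (min_le_left δ _)
      have h4 := (Metric.mem_ball.1 hy').trans_le (min_le_left δ _)
      rw [← dist_eq_norm]; linarith
    calc 2 / ε * timeSlope 0 1 1 (2 / ε * t) * ‖y' - y‖ ≤ 2 / ε * 1 * (2 * δ) := by
          gcongr; exact timeSlope_le_one one_pos _
      _ = 4 * δ / ε := by ring
  · rw [timeChange_of_nonpos zero_le_one one_pos, zero_smul, add_zero]
    exact mul_nonpos_of_nonneg_of_nonpos (by positivity) ht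
  · rw [timeChange_of_le zero_le_one one_pos, one_smul, add_sub_cancel]
    calc (1 : ℝ) - 0 + 1 = 2 / ε * ε := by rw [hε2]; norm_num
      _ ≤ _ := by gcongr

/-- The points reached in time `r` from `x` stay in a compact subset of `N`. -/
def Bounded (N : Set E) (u : E → ℝ) (x : E) (r : ℝ) : Prop :=
  ∃ K, IsCompact K ∧ K ⊆ N ∧ ∀ y, Reach N u x y r → y ∈ K

theorem HessianMetric.exists_bounded [FiniteDimensional ℝ E] (h : HessianMetric N u) {z : E}
    (hz : z ∈ N) : ∃ ε > 0, Bounded N u z ε := by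
  have := FiniteDimensional.proper_real E
  obtain ⟨ρ, hρ, hρN⟩ := Metric.isOpen_iff.1 h.isOpen z hz
  have hsub := (Metric.closedBall_subset_ball (half_lt_self hρ)).trans hρN
  obtain ⟨C, hC, hCb⟩ := h.exists_norm_bound (isCompact_closedBall z (ρ / 2)) hsub
  set D := C + 1 with hD
  have hDpos : 0 < D := by positivity
  refine ⟨ρ / 2 / D, by positivity, _, isCompact_closedBall z (ρ / 2), hsub, ?_⟩
  rintro y ⟨γ, γ', hγ, h0, h1⟩
  have key : ∀ ⦃t⦄, t ∈ Icc 0 (ρ / 2 / D) → ‖γ t - z‖ ≤ D * t := image_norm_le_of_norm_deriv_right_lt_deriv_boundary (f := fun t => γ t - z)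
    (f' := γ') (a := 0) (b := ρ / 2 / D) (B := fun t => D * t) (B' := fun _ => D)
    (hγ.continuous.sub continuous_const).continuousOn
    (fun t _ => ((hγ.hasDerivAt t).sub_const z).hasDerivWithinAt) (by simp [h0])
    (fun t => by simpa using (hasDerivAt_id t).const_mul D) ?_
  · have h2 := key (right_mem_Icc.2 (by positivity))
    rw [h1 _ le_rfl, mul_div_cancel₀ _ hDpos.ne'] at h2
    simpa [dist_eq_norm] using h2
  · rintro t ⟨ht0, ht1⟩ ht
    have hm : γ t ∈ Metric.closedBall z (ρ / 2) := by
      rw [Metric.mem_closedBall, dist_eq_norm, ht]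
      rw [lt_div_iff₀ hDpos] at ht1
      linarith
    have h3 := (hCb _ hm (γ' t)).1
    have h4 := hγ.speed t
    have h5 : ‖γ' t‖ ^ 2 ≤ C := h3.trans (by nlinarith)
    nlinarith [norm_nonneg (γ' t)]

end Paths

section HopfRinow

open Set Filter Topology

variable {E : Type*} [NormedAddCommGroup E] [NormedSpace ℝ E] {N : Set E} {u : E → ℝ}

/-- Curves defined for `t < 1` of bounded speed cannot leave every compact subset of `N`. -/
def CurveComplete (N : Set E) (u : E → ℝ) : Prop :=
  ∀ (γ γ' : ℝ → E) (C : ℝ), ContinuousOn γ' (Iio 1) → (∀ t < 1, HasDerivAt γ (γ' t) t) →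
    (∀ t < 1, γ t ∈ N) → (∀ t < 1, G u (γ t) (γ' t) (γ' t) ≤ C) →
    ∃ K, IsCompact K ∧ K ⊆ N ∧ ∀ a < 1, ∃ t ∈ Ioo a 1, γ t ∈ K

namespace Bounded

variable {x y : E} {a r : ℝ}

theorem anti (h : Bounded N u x r) (har : a ≤ r) : Bounded N u x a := by
  obtain ⟨K, hK, hKN, H⟩ := h
  exact ⟨K, hK, hKN, fun y hy => H y (hy.mono har)⟩

theorem of_reach (h : Bounded N u x (a + r)) (hxy : Reach N u x y a) (ha : 0 ≤ a) (hr : 0 ≤ r) :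
    Bounded N u y r := by
  obtain ⟨K, hK, hKN, H⟩ := h
  exact ⟨K, hK, hKN, fun z hz => H z (hxy.trans hz ha hr)⟩

end Bounded

variable [FiniteDimensional ℝ E]

theorem HessianMetric.exists_bounded_uniform (h : HessianMetric N u) {K : Set E}
    (hK : IsCompact K) (hKN : K ⊆ N) : ∃ ε > 0, ∀ z ∈ K, Bounded N u z ε := by
  refine hK.induction_on (p := fun s => ∃ ε > 0, ∀ z ∈ s, Bounded N u z ε) ⟨1, one_pos, by simp⟩
    ?_ ?_ ?_
  · rintro s t hst ⟨ε, hε, H⟩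
    exact ⟨ε, hε, fun z hz => H z (hst hz)⟩
  · rintro s t ⟨ε, hε, H⟩ ⟨ε', hε', H'⟩
    refine ⟨min ε ε', lt_min hε hε', fun z hz => ?_⟩
    rcases hz with hz | hz
    · exact (H z hz).anti (min_le_left _ _)
    · exact (H' z hz).anti (min_le_right _ _)
  · intro z hz
    obtain ⟨ε, hε, H⟩ := h.exists_bounded (hKN hz)
    obtain ⟨δ, hδ, -, H'⟩ := h.exists_ball_reach (hKN hz) (half_pos hε)
    refine ⟨_, mem_nhdsWithin_of_mem_nhds (Metric.ball_mem_nhds z hδ), ε / 2, half_pos hε,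
      fun y hy => ?_⟩
    refine Bounded.of_reach (a := ε / 2) ?_ (H' z (Metric.mem_ball_self hδ) y hy) (by positivity)
      (by positivity)
    rwa [add_halves]

theorem HessianMetric.exists_not_bounded (h : HessianMetric N u) {x : E} {r : ℝ} (hr : 0 < r)
    (hx : x ∈ N) (hb : ¬ Bounded N u x r) :
    ∃ x', Reach N u x x' r ∧ ¬ Bounded N u x' (2 / 3 * r) := by
  by_contra! H
  apply hb
  obtain ⟨K, hK, hKN, hKx⟩ := H x (Reach.refl hx r)
  set A := {y | Reach N u x y (r / 2)} with hA
  have hAK : A ⊆ K := fun y hy => hKx y (Reach.mono hy (by linarith))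
  have hcA : IsCompact (closure A) := hK.closure_of_subset hAK
  have hcAK : closure A ⊆ K := closure_minimal hAK hK.isClosed
  have hind := hcA.induction_on (p := fun s => ∃ K', IsCompact K' ∧ K' ⊆ N ∧
    ∀ z ∈ s, ∀ y, Reach N u z y (7 / 12 * r) → y ∈ K') ⟨∅, isCompact_empty, empty_subset _, by simp⟩
    (fun s t hst ⟨K', h1, h2, h3⟩ => ⟨K', h1, h2, fun z hz => h3 z (hst hz)⟩)
    (fun s t ⟨K₁, h1, h2, h3⟩ ⟨K₂, h1', h2', h3'⟩ => ⟨K₁ ∪ K₂, h1.union h1', union_subset h2 h2',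
      fun z hz y hy => hz.elim (fun hz => .inl (h3 z hz y hy)) fun hz => .inr (h3' z hz y hy)⟩) ?_
  · obtain ⟨K', hK', hKN', H'⟩ := hind
    refine ⟨K', hK', hKN', ?_⟩
    rintro y ⟨γ, γ', hγ, h0, h1⟩
    have e1 := hγ.reach (a := 0) (b := 11 / 24 * r) (ε := r / 24) (by positivity) (by positivity)
    have e2 := hγ.reach (a := 11 / 24 * r) (b := r) (ε := r / 24) (by linarith) (by positivity)
    rw [h0 0 le_rfl] at e1
    rw [h1 r le_rfl] at e2
    exact H' _ (subset_closure (e1.mono (by linarith))) y (e2.mono (by linarith))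
  · intro z hz
    obtain ⟨δ, hδ, -, H'⟩ := h.exists_ball_reach (hKN (hcAK hz)) (ε := r / 12) (by positivity)
    obtain ⟨y, hyA, hy⟩ := Metric.mem_closure_iff.1 hz δ hδ
    have hxz : Reach N u x z r :=
      (Reach.trans hyA (H' y (by rwa [Metric.mem_ball, dist_comm]) z (Metric.mem_ball_self hδ))
        (by positivity) (by positivity)).mono (by linarith)
    obtain ⟨K', hK', hKN', H''⟩ := H z hxz
    refine ⟨_, mem_nhdsWithin_of_mem_nhds (Metric.ball_mem_nhds z hδ), K', hK', hKN',
      fun z' hz' y hy => H'' y ?_⟩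
    exact ((H' z (Metric.mem_ball_self hδ) z' hz').trans hy (by positivity) (by positivity)).mono
      (by linarith)

/-- A sequence of longer and longer paths, each extending the previous one, ending at points from
which small balls are not relatively compact. -/
theorem HessianMetric.exists_seq_not_bounded (h : HessianMetric N u) {x : E} {r : ℝ} (hr : 0 < r)
    (hx : x ∈ N) (hb : ¬ Bounded N u x r) :
    ∃ γ γ' : ℕ → ℝ → E, (∀ k, IsPath N u (γ k) (γ' k)) ∧
      (∀ k, ¬ Bounded N u (γ k (3 * r * (1 - (2 / 3) ^ k))) ((2 / 3) ^ k * r)) ∧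
      ∀ k, ∀ t ≤ 3 * r * (1 - (2 / 3) ^ k), γ (k + 1) t = γ k t ∧ γ' (k + 1) t = γ' k t := by
  set τ : ℕ → ℝ := fun k => 3 * r * (1 - (2 / 3) ^ k) with hτ
  have hτs : ∀ k, τ (k + 1) = τ k + (2 / 3) ^ k * r := fun k => by simp only [hτ, pow_succ]; ring
  let Pr : ℕ → (ℝ → E) × (ℝ → E) → Prop := fun k p => IsPath N u p.1 p.2 ∧
    (∀ t, τ k ≤ t → p.1 t = p.1 (τ k)) ∧ ¬ Bounded N u (p.1 (τ k)) ((2 / 3) ^ k * r)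
  have step : ∀ k (p : {p // Pr k p}), ∃ q : {p // Pr (k + 1) p}, ∀ t ≤ τ k,
      q.1.1 t = p.1.1 t ∧ q.1.2 t = p.1.2 t := by
    rintro k ⟨⟨γ, γ'⟩, hγ, h1, h2⟩
    have hk : (0 : ℝ) < (2 / 3) ^ k * r := by positivity
    obtain ⟨x', ⟨η, η', hη, h0', h1'⟩, hx'⟩ := h.exists_not_bounded hk (hγ.mem _) h2
    obtain ⟨c1, c2, c3⟩ := hγ.concat h1 hη h0'
    have e1 : ∀ t, τ (k + 1) ≤ t → γ t + (η (t - τ k) - γ (τ k)) = x' := fun t ht => by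
      rw [hτs] at ht
      rw [c3 t (by linarith), h1' _ (by linarith)]
    refine ⟨⟨⟨_, _⟩, c1, fun t ht => ?_, ?_⟩, fun t ht => ⟨c2 t ht, ?_⟩⟩
    · exact (e1 t ht).trans (e1 _ le_rfl).symm
    · change ¬ Bounded N u (γ (τ (k + 1)) + (η (τ (k + 1) - τ k) - γ (τ k))) _
      rw [e1 _ le_rfl, pow_succ, mul_right_comm, mul_comm]
      exact hx'
    · change γ' t + η' (t - τ k) = γ' t
      rw [hη.deriv_eq_zero_of_le h0' (sub_nonpos.2 ht), add_zero]
  choose next hnext using step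
  let F : ∀ k, {p // Pr k p} := fun k => Nat.rec
    ⟨(fun _ => x, fun _ => 0), ⟨fun t => hasDerivAt_const t x, continuous_const, fun _ => hx,
      fun _ => by simp [G_zero₁]⟩, fun _ _ => rfl, by simpa using hb⟩ (fun k p => next k p) k
  exact ⟨fun k => (F k).1.1, fun k => (F k).1.2, fun k => (F k).2.1, fun k => (F k).2.2.2, fun k => hnext k (F k)⟩

/-- Hopf–Rinow: if curves of finite length cannot leave `N`, balls are relatively compact. -/
theorem HessianMetric.bounded_of_curveComplete (h : HessianMetric N u) (hc : CurveComplete N u)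
    {x : E} (hx : x ∈ N) (r : ℝ) : Bounded N u x r := by
  suffices H : ∀ r > 0, Bounded N u x r from
    (H (max r 1) (by positivity)).anti (le_max_left _ _)
  intro r hr
  by_contra hb
  obtain ⟨γ, γ', hp, hbad, hext⟩ := h.exists_seq_not_bounded hr hx hb
  set τ : ℕ → ℝ := fun k => 3 * r * (1 - (2 / 3) ^ k) with hτ
  have hτm : Monotone τ := fun j k hjk => by
    simp only [hτ]
    have : (2 / 3 : ℝ) ^ k ≤ (2 / 3) ^ j := pow_le_pow_of_le_one (by norm_num) (by norm_num) hjk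
    gcongr
  have hτl : Tendsto τ atTop (𝓝 (3 * r)) := by
    have := tendsto_pow_atTop_nhds_zero_of_lt_one (r := (2 / 3 : ℝ)) (by norm_num) (by norm_num)
    simpa using (this.const_sub 1).const_mul (3 * r)
  have hext' : ∀ k j, k ≤ j → ∀ t ≤ τ k, γ j t = γ k t ∧ γ' j t = γ' k t := by
    intro k j hkj
    induction j, hkj using Nat.le_induction with
    | base => exact fun t _ => ⟨rfl, rfl⟩
    | succ j hkj ih =>
      intro t ht
      have h1 := hext j t (ht.trans (hτm hkj))
      exact ⟨h1.1.trans (ih t ht).1, h1.2.trans (ih t ht).2⟩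
  have hex : ∀ t < 3 * r, ∃ k, t < τ k := fun t ht => (hτl.eventually_const_lt ht).exists
  classical
  let κ : ℝ → ℕ := fun t => if ht : ∃ k, t < τ k then Nat.find ht else 0
  have hκ : ∀ t k, t < τ k → t < τ (κ t) := fun t k ht => by
    have h1 : ∃ k, t < τ k := ⟨k, ht⟩
    simp only [κ, h1, dif_pos]
    exact Nat.find_spec h1
  have hΓ : ∀ t k, t < τ k → γ (κ t) t = γ k t ∧ γ' (κ t) t = γ' k t := fun t k ht => by
    rcases le_total (κ t) k with h1 | h1
    · have := hext' _ _ h1 t (hκ t k ht).le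
      exact ⟨this.1.symm, this.2.symm⟩
    · exact hext' _ _ h1 t ht.le
  have h3r : 0 < 3 * r := by positivity
  have hlt : ∀ t < 1, 3 * r * t < 3 * r := fun t ht => by nlinarith
  have hcex := hc (fun t => γ (κ (3 * r * t)) (3 * r * t))
    (fun t => (3 * r) • γ' (κ (3 * r * t)) (3 * r * t)) ((3 * r) ^ 2) ?_ ?_ (fun t _ => (hp _).mem _)
    ?_
  · obtain ⟨K, hK, hKN, H⟩ := hcex
    obtain ⟨ε, hε, hεb⟩ := h.exists_bounded_uniform hK hKN
    obtain ⟨k, hk⟩ : ∃ k, 3 * r - τ k < ε / 3 := by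
      have : Tendsto (fun k => 3 * r - τ k) atTop (𝓝 0) := by
        simpa using hτl.const_sub (3 * r)
      exact (this.eventually_lt_const (by positivity)).exists
    have hτk : τ k < 3 * r := by
      simp only [hτ]
      have : (0 : ℝ) < (2 / 3) ^ k := by positivity
      nlinarith
    obtain ⟨t, ⟨ht1, ht2⟩, htK⟩ := H (τ k / (3 * r)) ((div_lt_one h3r).2 hτk)
    rw [div_lt_iff₀ h3r, mul_comm] at ht1
    obtain ⟨j, hj⟩ := hex _ (hlt t ht2)
    rw [(hΓ _ j hj).1] at htK
    have hkj : k ≤ j := by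
      by_contra! hh
      have := hτm hh.le
      linarith
    have h1 := (hp j).reach hj.le (ε := ε / 3) (by positivity)
    have hjl : τ j ≤ 3 * r := hτm.ge_of_tendsto hτl j
    have hsmall : (2 / 3) ^ j * r ≤ ε / 3 := by
      have e1 : 3 * r - τ j = 3 * ((2 / 3) ^ j * r) := by simp only [hτ]; ring
      have e2 : 0 < (2 / 3 : ℝ) ^ j * r := by positivity
      have := hτm hkj
      linarith
    refine hbad j (Bounded.of_reach (a := τ j - 3 * r * t + ε / 3) ?_ h1 (by linarith)
      (by positivity))
    exact (hεb _ htK).anti (by linarith)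
  · intro t ht
    obtain ⟨k, hk⟩ := hex _ (hlt t ht)
    have hev : ∀ᶠ s in 𝓝 t, 3 * r * s < τ k :=
      (by fun_prop : ContinuousAt (fun s : ℝ => 3 * r * s) t).eventually_lt_const hk
    refine ContinuousAt.continuousWithinAt (ContinuousAt.congr
      (f := fun s => (3 * r) • γ' k (3 * r * s)) ?_ ?_)
    · exact (((hp k).continuous_deriv.comp (continuous_const.mul continuous_id)).const_smul
        _).continuousAt
    · filter_upwards [hev] with s hs
      rw [(hΓ _ k hs).2]
  · intro t ht
    obtain ⟨k, hk⟩ := hex _ (hlt t ht)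
    have hev : ∀ᶠ s in 𝓝 t, 3 * r * s < τ k :=
      (by fun_prop : ContinuousAt (fun s : ℝ => 3 * r * s) t).eventually_lt_const hk
    rw [(hΓ _ k hk).2]
    refine HasDerivAt.congr_of_eventuallyEq (f := fun s => γ k (3 * r * s)) ?_ ?_
    · have h1 : HasDerivAt (fun s : ℝ => 3 * r * s) (3 * r) t := by
        simpa using (hasDerivAt_id t).const_mul (3 * r)
      exact ((hp k).hasDerivAt _).scomp t h1
    · filter_upwards [hev] with s hs
      rw [(hΓ _ k hs).1]
  · intro t _
    rw [G_smul₁, G_smul₂, ← mul_assoc, ← sq]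
    have := (hp (κ (3 * r * t))).speed (3 * r * t)
    nlinarith [sq_nonneg (3 * r)]

end HopfRinow

section Energy

open Set Filter Topology

variable {E : Type*} [NormedAddCommGroup E] [NormedSpace ℝ E] {N : Set E} {u : E → ℝ}

/-- The inverse of a `C¹` change of time with slope at least `1 / 2`. -/
theorem exists_inverse_time {m : ℝ → ℝ} (hm : Continuous m) (hm' : ∀ t, 1 / 2 ≤ m t) :
    ∃ ρ : ℝ → ℝ, Continuous ρ ∧ StrictMono ρ ∧ (∀ t, ρ (∫ r in (0 : ℝ)..t, m r) = t) ∧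
      ∀ s, HasDerivAt ρ (m (ρ s))⁻¹ s := by
  set σ : ℝ → ℝ := fun t => ∫ r in (0 : ℝ)..t, m r with hσ
  have hd : ∀ t, HasDerivAt σ (m t) t := fun t =>
    intervalIntegral.integral_hasDerivAt_right (hm.intervalIntegrable _ _)
      hm.aestronglyMeasurable.stronglyMeasurableAtFilter hm.continuousAt
  have hσm : StrictMono σ := strictMono_of_hasDerivAt_pos hd fun t => by linarith [hm' t]
  have hσc : Continuous σ := continuous_iff_continuousAt.2 fun t => (hd t).continuousAt
  have hmon : Monotone fun t => σ t - t / 2 :=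
    monotone_of_hasDerivAt_nonneg (fun t => (hd t).sub ((hasDerivAt_id t).div_const 2))
      fun t => by simpa using hm' t
  have hσ0 : σ 0 = 0 := by simp [hσ]
  have hs : Function.Surjective σ := by
    refine hσc.surjective ?_ ?_
    · refine tendsto_atTop_mono' atTop ?_ (tendsto_id.atTop_div_const (zero_lt_two' ℝ))
      filter_upwards [eventually_ge_atTop 0] with t ht
      have := hmon ht
      simp only [hσ0, id] at this ⊢
      linarith
    · refine tendsto_atBot_mono' atBot ?_ (tendsto_id.atBot_div_const (zero_lt_two' ℝ))
      filter_upwards [eventually_le_atBot 0] with t ht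
      have := hmon ht
      simp only [hσ0, id] at this ⊢
      linarith
  set Φ := hσm.orderIsoOfSurjective σ hs with hΦ
  have hΦσ : ∀ t, Φ t = σ t := fun t => rfl
  have hl : ∀ t, Φ.symm (σ t) = t := fun t => by rw [← hΦσ, Φ.symm_apply_apply]
  refine ⟨Φ.symm, Φ.symm.continuous, Φ.symm.strictMono, hl, fun s => ?_⟩
  refine HasDerivAt.of_local_left_inverse Φ.symm.continuous.continuousAt (hd _) ?_
    (Eventually.of_forall fun y => Φ.apply_symm_apply y)
  linarith [hm' (Φ.symm s)]

/-- A curve with kinetic energy density `G u (γ t) (γ' t) (γ' t)` can be reparametrised into a path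
whose duration is controlled by the energy. -/
theorem HessianMetric.reach_of_energy (h : HessianMetric N u) {γ γ' : ℝ → E}
    (hγ : ∀ t, HasDerivAt γ (γ' t) t) (hγ' : Continuous γ') (hN : ∀ t, γ t ∈ N) {x y : E} {τ : ℝ}
    (h0 : ∀ t ≤ 0, γ t = x) (h1 : ∀ t, τ ≤ t → γ t = y) :
    Reach N u x y (∫ t in (0 : ℝ)..τ, (1 + G u (γ t) (γ' t) (γ' t)) / 2) := by
  have hγc : Continuous γ := continuous_iff_continuousAt.2 fun t => (hγ t).continuousAt
  have hG : ∀ t, 0 ≤ G u (γ t) (γ' t) (γ' t) := fun t => by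
    rcases eq_or_ne (γ' t) 0 with h2 | h2
    · rw [h2, G_zero₁]
    · exact (h.pos _ (hN t) _ h2).le
  obtain ⟨ρ, hρ, hρm, hρ1, hρ2⟩ := exists_inverse_time
    (m := fun t => (1 + G u (γ t) (γ' t) (γ' t)) / 2) (continuous_iff_continuousAt.2 fun t =>
      (continuousAt_const.add (h.continuousAt_G (hN t) hγc.continuousAt hγ'.continuousAt
        hγ'.continuousAt)).div_const 2) (fun t => by linarith [hG t])
  have hm : Continuous fun t => (1 + G u (γ t) (γ' t) (γ' t)) / 2 :=
    continuous_iff_continuousAt.2 fun t => (continuousAt_const.add (h.continuousAt_G (hN t)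
      hγc.continuousAt hγ'.continuousAt hγ'.continuousAt)).div_const 2
  refine ⟨fun s => γ (ρ s), fun s => ((1 + G u (γ (ρ s)) (γ' (ρ s)) (γ' (ρ s))) / 2)⁻¹ • γ' (ρ s),
    ⟨fun s => (hγ _).scomp s (hρ2 s), ?_, fun s => hN _, fun s => ?_⟩, fun s hs => h0 _ ?_,
    fun s hs => h1 _ ?_⟩
  · refine ((hm.comp hρ).inv₀ fun s => ?_).smul (hγ'.comp hρ)
    have := hG (ρ s)
    simp only [Function.comp]
    positivity
  · rw [G_smul₁, G_smul₂]
    have := hG (ρ s)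
    set g := G u (γ (ρ s)) (γ' (ρ s)) (γ' (ρ s))
    rw [← mul_assoc, ← mul_inv, inv_mul_le_iff₀ (by positivity)]
    nlinarith [sq_nonneg (1 - g)]
  · have := hρ1 0
    rw [intervalIntegral.integral_same] at this
    exact (hρm.monotone hs).trans this.le
  · have := hρm.monotone hs
    rwa [hρ1] at this

end Energy

section VariationAlgebra

variable {E : Type*} [NormedAddCommGroup E] [NormedSpace ℝ E]
variable {ι : Type*} [Fintype ι] [DecidableEq ι]

/-- The velocity of the variation field `f • e a`, where `e` is a parallel frame along a curve of
velocity `w`. -/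
def fieldVelocity (u : E → ℝ) (x w : E) (e : ι → E) (f f' : ℝ) (a : ι) : E :=
  f' • e a + f • ∑ b, (-(1 / 2 : ℝ) * T u x w (e a) (e b)) • e b

/-- The second variation of the kinetic energy in the direction `f • e a`. -/
def energyHess (u : E → ℝ) (x w : E) (e : ι → E) (f f' : ℝ) (a : ι) : ℝ :=
  Q u x (f • e a) (f • e a) w w + 4 * T u x (f • e a) w (fieldVelocity u x w e f f' a)
    + 2 * G u x (fieldVelocity u x w e f f' a) (fieldVelocity u x w e f f' a)

variable [FiniteDimensional ℝ E]
variable {N : Set E} {u : E → ℝ} {x : E} {α : E →L[ℝ] ℝ} {ξ : E} {e : ι → E}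

theorem HessianMetric.energyDeriv_eq (h : HessianMetric N u)
    (hι : Fintype.card ι = Module.finrank ℝ E) (hx : x ∈ N) (he : IsFrame u x e) (w : E)
    (f f' : ℝ) (a : ι) :
    T u x (f • e a) w w + 2 * G u x w (fieldVelocity u x w e f f' a) = 2 * f' * G u x w (e a) := by
  have h1 : T u x (e a) w w = ∑ b, T u x w (e a) (e b) * G u x w (e b) := by
    rw [h.T_symm₁₂ hx]
    conv_lhs => enter [5]; rw [he.expand hι w]
    rw [T_sum₃]
    refine Finset.sum_congr rfl fun b _ => ?_
    rw [T_smul₃, h.G_symm hx, mul_comm]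
  rw [fieldVelocity, G_add₂, G_smul₂, G_smul₂, G_sum₂, T_smul₁, h1]
  simp only [G_smul₂]
  have : ∑ b, -(1 / 2 : ℝ) * T u x w (e a) (e b) * G u x w (e b)
      = -(1 / 2) * ∑ b, T u x w (e a) (e b) * G u x w (e b) := by
    rw [Finset.mul_sum]; exact Finset.sum_congr rfl fun b _ => by ring
  rw [this]; ring

omit [FiniteDimensional ℝ E] in
theorem HessianMetric.energyHess_eq (h : HessianMetric N u) (hx : x ∈ N) (he : IsFrame u x e)
    (w : E) (f f' : ℝ) (a : ι) :
    energyHess u x w e f f' a = f ^ 2 * Q u x w w (e a) (e a)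
      + 2 * f * f' * T u x w (e a) (e a) - 3 / 2 * f ^ 2 * ∑ b, T u x w (e a) (e b) ^ 2
      + 2 * f' ^ 2 := by
  have hQ : Q u x (e a) (e a) w w = Q u x w w (e a) (e a) := by
    rw [h.Q_symm₂₃ hx, h.Q_symm₁₂ hx, h.Q_symm₃₄ hx, h.Q_symm₂₃ hx]
  set S := ∑ b, T u x w (e a) (e b) ^ 2 with hS
  have h1 : ∀ v, G u x v (∑ b, (-(1 / 2 : ℝ) * T u x w (e a) (e b)) • e b)
      = -(1 / 2) * ∑ b, T u x w (e a) (e b) * G u x v (e b) := fun v => by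
    rw [G_sum₂, Finset.mul_sum]
    exact Finset.sum_congr rfl fun b _ => by rw [G_smul₂]; ring
  have h2 : G u x (e a) (∑ b, (-(1 / 2 : ℝ) * T u x w (e a) (e b)) • e b)
      = -(1 / 2) * T u x w (e a) (e a) := by
    rw [h1]; simp [he a]
  have h3 : ∀ b, G u x (∑ b, (-(1 / 2 : ℝ) * T u x w (e a) (e b)) • e b) (e b)
      = -(1 / 2) * T u x w (e a) (e b) := fun b => by
    rw [h.G_symm hx, h1]; simp [he b]
  have h4 : G u x (∑ b, (-(1 / 2 : ℝ) * T u x w (e a) (e b)) • e b)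
      (∑ b, (-(1 / 2 : ℝ) * T u x w (e a) (e b)) • e b) = 1 / 4 * S := by
    rw [h1, hS, Finset.mul_sum, Finset.mul_sum]
    exact Finset.sum_congr rfl fun b _ => by rw [h3]; ring
  have h5 : T u x (e a) w (∑ b, (-(1 / 2 : ℝ) * T u x w (e a) (e b)) • e b) = -(1 / 2) * S := by
    rw [h.T_symm₁₂ hx, T_sum₃, hS, Finset.mul_sum]
    exact Finset.sum_congr rfl fun b _ => by rw [T_smul₃]; ring
  have h6 : T u x (e a) w (e a) = T u x w (e a) (e a) := h.T_symm₁₂ hx _ _ _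
  rw [energyHess, fieldVelocity, Q_smul₁, Q_smul₂, T_smul₁, T_add₃, T_smul₃, T_smul₃, h5, h6, hQ]
  simp only [G_add₁, G_add₂, G_smul₁, G_smul₂]
  rw [h2, h3 a, h4, he a a, if_pos rfl]
  ring

/-- The trace of the second variation, corrected by the first variation in the drift direction. -/
theorem IsSoliton.sum_energyHess (h : IsSoliton ι N u α ξ) (hx : x ∈ N) (he : IsFrame u x e)
    (w : E) (f f' : ℝ) :
    ∑ a, energyHess u x w e f f' a
        - (T u x (f ^ 2 • ξ) w w + 2 * G u x w ((2 * f * f') • ξ))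
      = -(1 / 2) * f ^ 2 * ∑ a, ∑ b, T u x w (e a) (e b) ^ 2
        + 2 * f * f' * (α w - G u x ξ w) + 2 * Fintype.card ι * f' ^ 2 := by
  have h1 := h.trace_Q hx he w w
  have h2 := h.trace_eq x hx e he w
  have h3 : T u x w w ξ = T u x ξ w w := by rw [h.T_symm₂₃ hx, h.T_symm₁₂ hx]
  have hh : ∀ a, energyHess u x w e f f' a = _ :=
    fun a => h.toHessianMetric.energyHess_eq hx he w f f' a
  simp only [hh, Finset.sum_add_distrib, Finset.sum_sub_distrib, ← Finset.mul_sum, h1, h2,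
    T_smul₁, G_smul₂, h3, h.G_symm hx w ξ]
  simp only [← sq, Finset.sum_const, Finset.card_univ, nsmul_eq_mul]
  ring

end VariationAlgebra

section Cutoff

open Set

/-- A `C¹` function equal to `0` for `t ≤ 0` and to `1` for `1 ≤ t`. -/
def cutoff (t : ℝ) : ℝ := 2 * timeChange 0 (1 / 2) (1 / 2) t

/-- The derivative of `cutoff`. -/
def cutoffSlope (t : ℝ) : ℝ := 2 * timeSlope 0 (1 / 2) (1 / 2) t

theorem hasDerivAt_cutoff (t : ℝ) : HasDerivAt cutoff (cutoffSlope t) t :=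
  (hasDerivAt_timeChange 0 (1 / 2) (1 / 2) t).const_mul 2

theorem continuous_cutoff : Continuous cutoff :=
  continuous_iff_continuousAt.2 fun t => (hasDerivAt_cutoff t).continuousAt

theorem continuous_cutoffSlope : Continuous cutoffSlope :=
  (continuous_timeSlope 0 (1 / 2) (1 / 2)).const_mul 2

theorem cutoffSlope_nonneg (t : ℝ) : 0 ≤ cutoffSlope t :=
  mul_nonneg zero_le_two (timeSlope_nonneg (by norm_num) (by norm_num) t)

theorem cutoffSlope_le (t : ℝ) : cutoffSlope t ≤ 2 := by
  have := timeSlope_le_one (a := 0) (b := 1 / 2) (ε := 1 / 2) (by norm_num) t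
  unfold cutoffSlope; linarith

theorem cutoff_of_nonpos {t : ℝ} (ht : t ≤ 0) : cutoff t = 0 := by
  rw [cutoff, timeChange_of_nonpos (by norm_num) (by norm_num) ht, mul_zero]

theorem cutoff_of_one_le {t : ℝ} (ht : 1 ≤ t) : cutoff t = 1 := by
  rw [cutoff, timeChange_of_le (by norm_num) (by norm_num) (by linarith)]; norm_num

theorem monotone_cutoff : Monotone cutoff :=
  monotone_of_hasDerivAt_nonneg hasDerivAt_cutoff cutoffSlope_nonneg

theorem cutoff_nonneg (t : ℝ) : 0 ≤ cutoff t :=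
  (cutoff_of_nonpos (min_le_right t 0)).ge.trans (monotone_cutoff (min_le_left t 0))

theorem cutoff_le_one (t : ℝ) : cutoff t ≤ 1 :=
  (monotone_cutoff (le_max_left t 1)).trans (cutoff_of_one_le (le_max_right t 1)).le

theorem cutoffSlope_of_one_le {t : ℝ} (ht : 1 ≤ t) : cutoffSlope t = 0 := by
  have h1 : HasDerivWithinAt cutoff (cutoffSlope t) (Ici t) t :=
    (hasDerivAt_cutoff t).hasDerivWithinAt
  have h2 : HasDerivWithinAt cutoff 0 (Ici t) t := (hasDerivWithinAt_const t (Ici t) 1).congr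
    (fun s hs => cutoff_of_one_le (ht.trans hs)) (cutoff_of_one_le ht)
  exact (uniqueDiffOn_Ici t t self_mem_Ici).eq_deriv _ h1 h2

theorem integral_cutoffSlope {τ : ℝ} (hτ : 1 ≤ τ) : ∫ t in (0 : ℝ)..τ, cutoffSlope t = 1 := by
  rw [intervalIntegral.integral_eq_sub_of_hasDerivAt (fun t _ => hasDerivAt_cutoff t)
    (continuous_cutoffSlope.intervalIntegrable _ _), cutoff_of_one_le hτ, cutoff_of_nonpos le_rfl,
    sub_zero]

end Cutoff

section Variation

open Set Filter Topology

variable {E : Type*} [NormedAddCommGroup E] [NormedSpace ℝ E] [FiniteDimensional ℝ E]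
variable {ι : Type*} [Fintype ι] [DecidableEq ι]
variable {N : Set E} {u : E → ℝ}

theorem HessianMetric.exists_tensor_bound (h : HessianMetric N u) {K : Set E} (hK : IsCompact K)
    (hKN : K ⊆ N) (B : ℝ) : ∃ M > 0, ∀ x ∈ K, ∀ v w z, ‖v‖ ≤ B → ‖w‖ ≤ B → ‖z‖ ≤ B →
      |Q u x v v w w| ≤ M ∧ |T u x v w z| ≤ M ∧ |G u x v w| ≤ M := by
  have := FiniteDimensional.proper_real E
  have hB := isCompact_closedBall (0 : E) B
  have hS := hK.prod (hB.prod (hB.prod hB))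
  set S := K ×ˢ Metric.closedBall (0 : E) B ×ˢ Metric.closedBall (0 : E) B ×ˢ
    Metric.closedBall (0 : E) B with hSdef
  have c1 : ContinuousOn (fun q : E × E × E × E => |Q u q.1 q.2.1 q.2.1 q.2.2.1 q.2.2.1|) S :=
    fun q hq => (h.continuousAt_Q (hKN hq.1) (by fun_prop) (by fun_prop)
      (by fun_prop) (by fun_prop) (by fun_prop)).abs.continuousWithinAt
  have c2 : ContinuousOn (fun q : E × E × E × E => |T u q.1 q.2.1 q.2.2.1 q.2.2.2|) S :=
    fun q hq => (h.continuousAt_T (hKN hq.1) (by fun_prop) (by fun_prop)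
      (by fun_prop) (by fun_prop)).abs.continuousWithinAt
  have c3 : ContinuousOn (fun q : E × E × E × E => |G u q.1 q.2.1 q.2.2.1|) S :=
    fun q hq => (h.continuousAt_G (hKN hq.1) (by fun_prop) (by fun_prop)
      (by fun_prop)).abs.continuousWithinAt
  obtain ⟨M₁, h1⟩ := (hS.image_of_continuousOn c1).bddAbove
  obtain ⟨M₂, h2⟩ := (hS.image_of_continuousOn c2).bddAbove
  obtain ⟨M₃, h3⟩ := (hS.image_of_continuousOn c3).bddAbove
  refine ⟨max 1 (max M₁ (max M₂ M₃)), by positivity, fun x hx v w z hv hw hz => ?_⟩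
  have hq : (x, v, w, z) ∈ S := by simp [hSdef, hx, hv, hw, hz]
  exact ⟨(h1 ⟨_, hq, rfl⟩).trans (by simp), (h2 ⟨_, hq, rfl⟩).trans (by simp),
    (h3 ⟨_, hq, rfl⟩).trans (by simp)⟩

theorem HessianMetric.exists_velocity_bound (h : HessianMetric N u) {K : Set E} (hK : IsCompact K)
    (hKN : K ⊆ N) : ∃ B > 0, ∀ x ∈ K, ∀ w, G u x w w ≤ 1 → ∀ e : ι → E, IsFrame u x e →
      ∀ f f' : ℝ, 0 ≤ f → f ≤ 1 → 0 ≤ f' → f' ≤ 2 →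
        ‖w‖ ≤ B ∧ ∀ a, ‖f • e a‖ ≤ B ∧ ‖fieldVelocity u x w e f f' a‖ ≤ B := by
  obtain ⟨C, hC, hCb⟩ := h.exists_norm_bound hK hKN
  obtain ⟨M, hM, hMb⟩ := h.exists_tensor_bound hK hKN (C + 1)
  have hunit : ∀ x ∈ K, ∀ w, G u x w w ≤ 1 → ‖w‖ ≤ C + 1 := fun x hx w hw => by
    have := (hCb x hx w).1
    nlinarith [norm_nonneg w]
  have hsum : 0 ≤ (Fintype.card ι : ℝ) * (M * (C + 1)) := by positivity
  refine ⟨2 * (C + 1) + Fintype.card ι * (M * (C + 1)), by positivity,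
    fun x hx w hw e he f f' hf hf1 hf' hf2 => ?_⟩
  have hea : ∀ b, ‖e b‖ ≤ C + 1 := fun b => hunit x hx _ (by rw [he b b, if_pos rfl])
  have hwC := hunit x hx w hw
  refine ⟨by linarith, fun a => ⟨?_, ?_⟩⟩
  · rw [norm_smul, Real.norm_of_nonneg hf]
    nlinarith [norm_nonneg (e a), hea a]
  · have h1 : ‖f' • e a‖ ≤ 2 * (C + 1) := by
      rw [norm_smul, Real.norm_of_nonneg hf']
      exact mul_le_mul hf2 (hea a) (norm_nonneg _) zero_le_two
    have h2 : ‖∑ b, (-(1 / 2 : ℝ) * T u x w (e a) (e b)) • e b‖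
        ≤ Fintype.card ι * (M * (C + 1)) := by
      refine (norm_sum_le _ _).trans ?_
      rw [← nsmul_eq_mul]
      refine Finset.sum_le_card_nsmul _ _ _ fun b _ => ?_
      rw [norm_smul, norm_mul, Real.norm_eq_abs, Real.norm_eq_abs]
      have h3 := (hMb x hx w (e a) (e b) hwC (hea a) (hea b)).2.1
      have h4 : |-(1 / 2 : ℝ)| = 1 / 2 := by norm_num
      rw [h4]
      exact mul_le_mul (by linarith [abs_nonneg (T u x w (e a) (e b))]) (hea b) (norm_nonneg _) hM.le
    refine (norm_add_le _ _).trans (add_le_add h1 ?_)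
    rw [norm_smul, Real.norm_of_nonneg hf]
    exact (mul_le_of_le_one_left (norm_nonneg _) hf1).trans h2

omit [FiniteDimensional ℝ E] in
theorem HessianMetric.reach_of_energy_le (h : HessianMetric N u) {γ γ' : ℝ → E}
    (hγ : ∀ t, HasDerivAt γ (γ' t) t) (hγ' : Continuous γ') (hN : ∀ t, γ t ∈ N) {x y : E} {τ : ℝ}
    (h0 : ∀ t ≤ 0, γ t = x) (h1 : ∀ t, τ ≤ t → γ t = y) (hτ : 0 ≤ τ) {g : ℝ → ℝ}
    (hg : Continuous g) (hle : ∀ t, (1 + G u (γ t) (γ' t) (γ' t)) / 2 ≤ g t) :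
    Reach N u x y (∫ t in (0 : ℝ)..τ, g t) := by
  refine (h.reach_of_energy hγ hγ' hN h0 h1).mono ?_
  refine intervalIntegral.integral_mono hτ ?_ (hg.intervalIntegrable _ _) hle
  refine Continuous.intervalIntegrable (continuous_iff_continuousAt.2 fun t => ?_) _ _
  exact (continuousAt_const.add (h.continuousAt_G (hN t) (hγ t).continuousAt hγ'.continuousAt
    hγ'.continuousAt)).div_const 2

section Field

variable {γ γ' : ℝ → E} {x₀ x : E} {τ : ℝ} {e : ι → ℝ → E}

omit [FiniteDimensional ℝ E] [DecidableEq ι] in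
theorem IsPath.continuous_fieldVelocity (hp : IsPath N u γ γ') (h : HessianMetric N u)
    (he : ∀ a, Continuous (e a)) (a : ι) : Continuous fun t =>
      fieldVelocity u (γ t) (γ' t) (fun b => e b t) (cutoff t) (cutoffSlope t) a := by
  refine (continuous_cutoffSlope.smul (he a)).add (continuous_cutoff.smul
    (continuous_finsetSum _ fun b _ => Continuous.smul (continuous_const.mul ?_) (he b)))
  exact continuous_iff_continuousAt.2 fun t => h.continuousAt_T (hp.mem t)
    hp.continuous.continuousAt hp.continuous_deriv.continuousAt (he a).continuousAt
    (he b).continuousAt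

theorem IsPath.continuous_energyHess (hp : IsPath N u γ γ') (h : HessianMetric N u)
    (he : ∀ a, Continuous (e a)) (a : ι) : Continuous fun t =>
      energyHess u (γ t) (γ' t) (fun b => e b t) (cutoff t) (cutoffSlope t) a := by
  refine continuous_iff_continuousAt.2 fun t => ?_
  have c1 := hp.continuous.continuousAt (x := t)
  have c2 := hp.continuous_deriv.continuousAt (x := t)
  have c3 := (continuous_cutoff.smul (he a)).continuousAt (x := t)
  have c4 := (hp.continuous_fieldVelocity h he a).continuousAt (x := t)
  exact ((h.continuousAt_Q (hp.mem t) c1 c3 c3 c2 c2).add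
    ((h.continuousAt_T (hp.mem t) c1 c3 c2 c4).const_mul 4)).add
    ((h.continuousAt_G (hp.mem t) c1 c4 c4).const_mul 2)

omit [FiniteDimensional ℝ E] [DecidableEq ι] in
theorem IsPath.frame_eq_of_ge (hp : IsPath N u γ γ') (h1 : ∀ t, τ ≤ t → γ t = x)
    (he : ∀ a t, HasDerivAt (e a)
      (∑ b, (-(1 / 2 : ℝ) * T u (γ t) (γ' t) (e a t) (e b t)) • e b t) t) (a : ι) {t : ℝ}
    (ht : τ ≤ t) : e a t = e a τ := by
  refine constant_of_has_deriv_right_zero (a := τ) (b := t)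
    (fun s _ => (he a s).continuousAt.continuousWithinAt) (fun s hs => ?_) t (right_mem_Icc.2 ht)
  have h2 := (he a s).hasDerivWithinAt (s := Ici s)
  have h3 : γ' s = 0 := hp.deriv_eq_zero_of_ge h1 hs.1
  simpa [h3, T_zero₁] using h2

/-- The reach of the endpoint of the variation of a path in the direction of a parallel field. -/
theorem IsPath.reach_variation (hp : IsPath N u γ γ') (h : HessianMetric N u)
    (hι : Fintype.card ι = Module.finrank ℝ E) (h0 : ∀ t ≤ 0, γ t = x₀)
    (h1 : ∀ t, τ ≤ t → γ t = x) (hτ : 1 ≤ τ) (hf : ∀ t, IsFrame u (γ t) fun a => e a t)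
    (he : ∀ a t, HasDerivAt (e a)
      (∑ b, (-(1 / 2 : ℝ) * T u (γ t) (γ' t) (e a t) (e b t)) • e b t) t)
    {s ε : ℝ} (a : ι)
    (hT : ∀ t, γ t + s • (cutoff t • e a t) ∈ N ∧
      |G u (γ t + s • (cutoff t • e a t))
          (γ' t + s • fieldVelocity u (γ t) (γ' t) (fun b => e b t) (cutoff t) (cutoffSlope t) a)
          (γ' t + s • fieldVelocity u (γ t) (γ' t) (fun b => e b t) (cutoff t) (cutoffSlope t) a)
        - G u (γ t) (γ' t) (γ' t)
        - s * (T u (γ t) (cutoff t • e a t) (γ' t) (γ' t) + 2 * G u (γ t) (γ' t)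
          (fieldVelocity u (γ t) (γ' t) (fun b => e b t) (cutoff t) (cutoffSlope t) a))
        - s ^ 2 / 2 * energyHess u (γ t) (γ' t) (fun b => e b t) (cutoff t) (cutoffSlope t) a|
        ≤ ε * s ^ 2) :
    Reach N u x₀ (x + s • e a τ)
      (τ + (s * (∫ t in (0 : ℝ)..τ, cutoffSlope t * G u (γ t) (γ' t) (e a t))
        + s ^ 2 * (1 / 4 * (∫ t in (0 : ℝ)..τ,
          energyHess u (γ t) (γ' t) (fun b => e b t) (cutoff t) (cutoffSlope t) a)
          + ε * τ / 2))) := by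
  have hec : ∀ a, Continuous (e a) := fun a =>
    continuous_iff_continuousAt.2 fun t => (he a t).continuousAt
  have c1 : Continuous fun t => cutoffSlope t * G u (γ t) (γ' t) (e a t) :=
    continuous_cutoffSlope.mul (continuous_iff_continuousAt.2 fun t =>
      h.continuousAt_G (hp.mem t) hp.continuous.continuousAt hp.continuous_deriv.continuousAt
        (hec a).continuousAt)
  have c2 := hp.continuous_energyHess h hec a
  have c3 := hp.continuous_fieldVelocity h hec a
  have key := h.reach_of_energy_le (γ := fun t => γ t + s • (cutoff t • e a t))
    (γ' := fun t => γ' t + s • fieldVelocity u (γ t) (γ' t) (fun b => e b t) (cutoff t)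
      (cutoffSlope t) a) (x := x₀) (y := x + s • e a τ) (τ := τ)
    (g := fun t => 1 + (s * (cutoffSlope t * G u (γ t) (γ' t) (e a t)) + s ^ 2 * (1 / 4 *
      energyHess u (γ t) (γ' t) (fun b => e b t) (cutoff t) (cutoffSlope t) a + ε / 2)))
    (fun t => ?_) (hp.continuous_deriv.add (c3.const_smul s)) (fun t => (hT t).1)
    (fun t ht => by simp [h0 t ht, cutoff_of_nonpos ht])
    (fun t ht => by
      simp [h1 t ht, cutoff_of_one_le (hτ.trans ht), hp.frame_eq_of_ge h1 he a ht])
    (by linarith) (by fun_prop) (fun t => ?_)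
  · refine key.mono (le_of_eq ?_)
    have i1 := c1.intervalIntegrable (μ := MeasureTheory.volume) 0 τ
    have i2 := c2.intervalIntegrable (μ := MeasureTheory.volume) 0 τ
    rw [intervalIntegral.integral_add (by simp) (by
        exact Continuous.intervalIntegrable (by fun_prop) _ _),
      intervalIntegral.integral_add (i1.const_mul _) (by
        exact Continuous.intervalIntegrable (by fun_prop) _ _),
      intervalIntegral.integral_const_mul, intervalIntegral.integral_const_mul,
      intervalIntegral.integral_add (i2.const_mul _) (by simp),
      intervalIntegral.integral_const_mul, intervalIntegral.integral_const,
      intervalIntegral.integral_const]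
    simp only [smul_eq_mul]; ring
  · refine ((hp.hasDerivAt t).add (((hasDerivAt_cutoff t).smul (he a t)).const_smul s)).congr_deriv ?_
    rw [fieldVelocity, add_comm (cutoffSlope t • e a t)]
  · have h2 := (abs_le.1 (hT t).2).2
    rw [h.energyDeriv_eq hι (hp.mem t) (hf t)] at h2
    have h3 := hp.speed t
    linarith

/-- The reach of the endpoint of the variation of a path in a constant direction. -/
theorem IsPath.reach_drift (hp : IsPath N u γ γ') (h : HessianMetric N u) (h0 : ∀ t ≤ 0, γ t = x₀)
    (h1 : ∀ t, τ ≤ t → γ t = x) (hτ : 1 ≤ τ) (ξ : E) {s ε : ℝ}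
    (hT : ∀ t, γ t + s • (cutoff t ^ 2 • ξ) ∈ N ∧
      |G u (γ t + s • (cutoff t ^ 2 • ξ))
          (γ' t + s • ((2 * cutoff t * cutoffSlope t) • ξ))
          (γ' t + s • ((2 * cutoff t * cutoffSlope t) • ξ))
        - G u (γ t) (γ' t) (γ' t)
        - s * (T u (γ t) (cutoff t ^ 2 • ξ) (γ' t) (γ' t)
          + 2 * G u (γ t) (γ' t) ((2 * cutoff t * cutoffSlope t) • ξ))| ≤ ε * |s|) :
    Reach N u x₀ (x + s • ξ)
      (τ + (s * (1 / 2 * (∫ t in (0 : ℝ)..τ, (T u (γ t) (cutoff t ^ 2 • ξ) (γ' t) (γ' t)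
          + 2 * G u (γ t) (γ' t) ((2 * cutoff t * cutoffSlope t) • ξ)))) + |s| * (ε * τ / 2))) := by
  have c0 := continuous_cutoff
  have c0' := continuous_cutoffSlope
  have c1 : Continuous fun t => T u (γ t) (cutoff t ^ 2 • ξ) (γ' t) (γ' t)
          + 2 * G u (γ t) (γ' t) ((2 * cutoff t * cutoffSlope t) • ξ) :=
    continuous_iff_continuousAt.2 fun t =>
      (h.continuousAt_T (hp.mem t) hp.continuous.continuousAt (by fun_prop)
        hp.continuous_deriv.continuousAt hp.continuous_deriv.continuousAt).add
      ((h.continuousAt_G (hp.mem t) hp.continuous.continuousAt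
        hp.continuous_deriv.continuousAt (by fun_prop)).const_mul 2)
  have c2 := hp.continuous_deriv
  have key := h.reach_of_energy_le (γ := fun t => γ t + s • (cutoff t ^ 2 • ξ))
    (γ' := fun t => γ' t + s • ((2 * cutoff t * cutoffSlope t) • ξ)) (x := x₀) (y := x + s • ξ)
    (τ := τ)
    (g := fun t => 1 + (s * (1 / 2 * (T u (γ t) (cutoff t ^ 2 • ξ) (γ' t) (γ' t)
          + 2 * G u (γ t) (γ' t) ((2 * cutoff t * cutoffSlope t) • ξ))) + |s| * (ε / 2)))
    (fun t => ?_) (by fun_prop) (fun t => (hT t).1)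
    (fun t ht => by simp [h0 t ht, cutoff_of_nonpos ht])
    (fun t ht => by simp [h1 t ht, cutoff_of_one_le (hτ.trans ht)])
    (by linarith) (by fun_prop) (fun t => ?_)
  · refine key.mono (le_of_eq ?_)
    have i1 := c1.intervalIntegrable (μ := MeasureTheory.volume) 0 τ
    rw [intervalIntegral.integral_add (by simp) (by
        exact Continuous.intervalIntegrable (by fun_prop) _ _),
      intervalIntegral.integral_add ((i1.const_mul _).const_mul _) (by simp),
      intervalIntegral.integral_const_mul, intervalIntegral.integral_const_mul,
      intervalIntegral.integral_const, intervalIntegral.integral_const]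
    simp only [smul_eq_mul]; ring
  · refine ((hp.hasDerivAt t).add ((((hasDerivAt_cutoff t).pow 2).smul_const ξ).const_smul
      s)).congr_deriv ?_
    simp
  · have h2 := (abs_le.1 (hT t).2).2
    have h3 := hp.speed t
    linarith

end Field

end Variation

section VariationExistence

open Set Filter Topology

variable {E : Type*} [NormedAddCommGroup E] [NormedSpace ℝ E] [FiniteDimensional ℝ E]
variable {ι : Type*} [Fintype ι] [DecidableEq ι]
variable {N : Set E} {u : E → ℝ} {α : E →L[ℝ] ℝ} {ξ x₀ : E}

theorem HessianMetric.abs_le_one_of_frame (h : HessianMetric N u)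
    (hι : Fintype.card ι = Module.finrank ℝ E) {x : E} (hx : x ∈ N) {e : ι → E}
    (he : IsFrame u x e) {w : E} (hw : G u x w w ≤ 1) (a : ι) : |G u x w (e a)| ≤ 1 := by
  have h1 : G u x w w = ∑ b, G u x w (e b) ^ 2 := by
    conv_lhs => enter [4]; rw [he.expand hι w]
    rw [G_sum₂]
    refine Finset.sum_congr rfl fun b _ => ?_
    rw [G_smul₂, h.G_symm hx (e b) w, sq]
  have h2 := Finset.single_le_sum (f := fun b => G u x w (e b) ^ 2)
    (fun b _ => sq_nonneg _) (Finset.mem_univ a)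
  exact (sq_le_one_iff_abs_le_one _).1 (h2.trans (h1 ▸ hw))

/-- Along a path which is parametrized by `[0, τ]`, the trace of the second variation with the
drift correction is bounded independently of `τ`. -/
theorem IsSoliton.integral_energyHess_le (h : IsSoliton ι N u α ξ) {γ γ' : ℝ → E}
    (hp : IsPath N u γ γ') {e : ι → ℝ → E} (hf : ∀ t, IsFrame u (γ t) fun a => e a t)
    (hec : ∀ a, Continuous (e a)) {τ C : ℝ} (hτ : 1 ≤ τ)
    (hC : ∀ t ∈ Icc (0 : ℝ) 1, |α (γ' t) - G u (γ t) ξ (γ' t)| ≤ C) :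
    (∑ a, ∫ t in (0 : ℝ)..τ,
        energyHess u (γ t) (γ' t) (fun b => e b t) (cutoff t) (cutoffSlope t) a)
      - (∫ t in (0 : ℝ)..τ, (T u (γ t) (cutoff t ^ 2 • ξ) (γ' t) (γ' t)
          + 2 * G u (γ t) (γ' t) ((2 * cutoff t * cutoffSlope t) • ξ)))
      ≤ 2 * (C + 2 * Fintype.card ι) := by
  have c0 := continuous_cutoff
  have c0' := continuous_cutoffSlope
  have c1 : Continuous fun t => T u (γ t) (cutoff t ^ 2 • ξ) (γ' t) (γ' t)
          + 2 * G u (γ t) (γ' t) ((2 * cutoff t * cutoffSlope t) • ξ) :=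
    continuous_iff_continuousAt.2 fun t =>
      (h.toHessianMetric.continuousAt_T (hp.mem t) hp.continuous.continuousAt (by fun_prop)
        hp.continuous_deriv.continuousAt hp.continuous_deriv.continuousAt).add
      ((h.toHessianMetric.continuousAt_G (hp.mem t) hp.continuous.continuousAt
        hp.continuous_deriv.continuousAt (by fun_prop)).const_mul 2)
  have c2 := fun a => hp.continuous_energyHess h.toHessianMetric hec a
  have c3 := continuous_finsetSum (Finset.univ : Finset ι) fun a _ => c2 a
  rw [← intervalIntegral.integral_finsetSum fun a _ => (c2 a).intervalIntegrable _ _,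
    ← intervalIntegral.integral_sub (c3.intervalIntegrable _ _) (c1.intervalIntegrable _ _)]
  have h2 : ∫ t in (0 : ℝ)..τ, (2 * (C + 2 * Fintype.card ι)) * cutoffSlope t
      = 2 * (C + 2 * Fintype.card ι) := by
    rw [intervalIntegral.integral_const_mul, integral_cutoffSlope hτ, mul_one]
  rw [← h2]
  refine intervalIntegral.integral_mono_on (by linarith) ((c3.sub c1).intervalIntegrable _ _)
    ((c0'.const_mul _).intervalIntegrable _ _) fun t ht => ?_
  rw [h.sum_energyHess (hp.mem t) (hf t)]
  have h3 : 0 ≤ ∑ a, ∑ b, T u (γ t) (γ' t) (e a t) (e b t) ^ 2 :=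
    Finset.sum_nonneg fun a _ => Finset.sum_nonneg fun b _ => sq_nonneg _
  have h4 := mul_nonneg (sq_nonneg (cutoff t)) h3
  have f1 := cutoffSlope_nonneg t
  rcases le_total 1 t with h1t | h1t
  · rw [cutoffSlope_of_one_le h1t]
    nlinarith
  · have h5 := hC t ⟨ht.1, h1t⟩
    have h6 : cutoff t * (α (γ' t) - G u (γ t) ξ (γ' t)) ≤ C := by
      refine (le_abs_self _).trans ?_
      rw [abs_mul, abs_of_nonneg (cutoff_nonneg t)]
      exact (mul_le_of_le_one_left (abs_nonneg _) (cutoff_le_one t)).trans h5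
    have h7 := mul_le_mul_of_nonneg_left h6 f1
    have h8 := mul_le_mul_of_nonneg_left (cutoffSlope_le t) f1
    have h9 := mul_le_mul_of_nonneg_left h8 (Nat.cast_nonneg (α := ℝ) (Fintype.card ι))
    nlinarith

omit [FiniteDimensional ℝ E] in
theorem IsPath.mem_of_reach {γ γ' : ℝ → E} (hp : IsPath N u γ γ') {x : E} {τ : ℝ}
    (h0 : ∀ t ≤ 0, γ t = x₀) (h1 : ∀ t, τ ≤ t → γ t = x) (hτ : 0 ≤ τ) {K : Set E}
    (hK : ∀ y, Reach N u x₀ y (τ + 1) → y ∈ K) (t : ℝ) : γ t ∈ K := by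
  have key : ∀ t ∈ Icc 0 τ, γ t ∈ K := fun t ht => by
    have h2 := hp.reach ht.1 one_pos
    rw [h0 0 le_rfl] at h2
    exact hK _ (h2.mono (by linarith [ht.2]))
  rcases le_total t 0 with h | h
  · rw [h0 t h, ← h0 0 le_rfl]; exact key 0 ⟨le_rfl, hτ⟩
  rcases le_total τ t with h' | h'
  · rw [h1 t h', ← h1 τ le_rfl]; exact key τ ⟨hτ, le_rfl⟩
  · exact key t ⟨h, h'⟩

/-- An upper bound for the drift Laplacian of the distance from `x₀`, in the sense of barriers. -/
theorem IsSoliton.exists_variation (h : IsSoliton ι N u α ξ)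
    (hb : ∀ r, Bounded N u x₀ r) :
    ∃ C > 0, ∀ R, ∀ ε > 0, ∃ s₀ > 0, ∀ s, 0 < s → s ≤ s₀ → ∀ x τ, 1 ≤ τ → τ ≤ R →
      Reach N u x₀ x τ → ∃ e : ι → E, IsFrame u x e ∧ ∃ (p q : ι → ℝ) (k : ℝ),
        (∀ a, Reach N u x₀ (x + s • e a) (τ + p a)) ∧
        (∀ a, Reach N u x₀ (x + (-s) • e a) (τ + q a)) ∧
        Reach N u x₀ (x + (-s ^ 2) • ξ) (τ + k) ∧
        ∑ a, (p a + q a) + k ≤ s ^ 2 * (C + ε) ∧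
        (∀ a, |p a| ≤ 3 * s ∧ |q a| ≤ 3 * s) ∧ |k| ≤ 3 * s := by
  have hM := h.toHessianMetric
  have hι := h.card_eq
  obtain ⟨K₁, hK₁, hK₁N, hK₁R⟩ := hb 2
  obtain ⟨D, hD, hDb⟩ := hM.exists_norm_bound hK₁ hK₁N
  obtain ⟨M₁, hM₁, hM₁b⟩ := hM.exists_tensor_bound hK₁ hK₁N (max (D + 1) ‖ξ‖)
  refine ⟨‖α‖ * (D + 1) + M₁ + 2 * Fintype.card ι, by positivity, fun R ε hε => ?_⟩
  set n : ℝ := (Fintype.card ι : ℝ) with hn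
  have hn0 : 0 ≤ n := Nat.cast_nonneg _
  set R' := |R| + 1 with hR'
  have hR'pos : 0 < R' := by positivity
  obtain ⟨K₀, hK₀, hK₀N, hK₀R⟩ := hb R'
  obtain ⟨B₀, hB₀, hB₀b⟩ := hM.exists_velocity_bound (ι := ι) hK₀ hK₀N
  set B := max B₀ (4 * ‖ξ‖) with hBdef
  obtain ⟨M, hMpos, hMb⟩ := hM.exists_tensor_bound hK₀ hK₀N B
  set ε' := ε / ((n + 1) * R') with hε'
  have hε'pos : 0 < ε' := by positivity
  have := FiniteDimensional.proper_real E
  have hBc := isCompact_closedBall (0 : E) B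
  obtain ⟨s₁, hs₁, H₁⟩ := hM.taylor_energy (hK₀.prod hBc) (fun z hz => hK₀N hz.1)
    (hBc.prod hBc) hε'pos
  obtain ⟨s₂, hs₂, H₂⟩ := hM.taylor_energy_one (hK₀.prod hBc) (fun z hz => hK₀N hz.1)
    (hBc.prod hBc) hε'pos
  set L := 2 * M * R' + ε with hL
  have hLpos : 0 < L := by positivity
  refine ⟨min (min s₁ s₂) (min 1 L⁻¹), by positivity, fun s hs hss x τ hτ hτR hreach => ?_⟩
  have hss₁ : s ≤ s₁ := hss.trans ((min_le_left _ _).trans (min_le_left _ _))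
  have hss₂ : s ≤ s₂ := hss.trans ((min_le_left _ _).trans (min_le_right _ _))
  have hs1 : s ≤ 1 := hss.trans ((min_le_right _ _).trans (min_le_left _ _))
  have hsL : s * L ≤ 1 := by
    have : s ≤ L⁻¹ := hss.trans ((min_le_right _ _).trans (min_le_right _ _))
    calc s * L ≤ L⁻¹ * L := by gcongr
      _ = 1 := inv_mul_cancel₀ hLpos.ne'
  have hτR' : τ + 1 ≤ R' := by linarith [le_abs_self R]
  obtain ⟨γ, γ', hp, h0, h1⟩ := hreach
  obtain ⟨e₀, he₀⟩ := hM.exists_frame (hp.mem 0) hι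
  obtain ⟨e, -, hf, he⟩ := hM.exists_parallel_frame hι hp.hasDerivAt hp.continuous_deriv hp.mem he₀
  have hec : ∀ a, Continuous (e a) := fun a =>
    continuous_iff_continuousAt.2 fun t => (he a t).continuousAt
  have hmem := hp.mem_of_reach h0 h1 (by linarith) fun y hy => hK₀R y (hy.mono hτR')
  have hvel := fun t => hB₀b _ (hmem t) _ (hp.speed t) _ (hf t) (cutoff t) (cutoffSlope t)
    (cutoff_nonneg t) (cutoff_le_one t) (cutoffSlope_nonneg t) (cutoffSlope_le t)
  have hB₀B : B₀ ≤ B := le_max_left _ _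
  have hξB : 4 * ‖ξ‖ ≤ B := le_max_right _ _
  have hw : ∀ t, ‖γ' t‖ ≤ B := fun t => (hvel t).1.trans hB₀B
  have hV : ∀ a t, ‖cutoff t • e a t‖ ≤ B := fun a t => ((hvel t).2 a).1.trans hB₀B
  have hV' : ∀ a t, ‖fieldVelocity u (γ t) (γ' t) (fun b => e b t) (cutoff t) (cutoffSlope t) a‖
      ≤ B := fun a t => ((hvel t).2 a).2.trans hB₀B
  have hX : ∀ t, ‖cutoff t ^ 2 • ξ‖ ≤ B := fun t => by
    have h2 := pow_le_one₀ (n := 2) (cutoff_nonneg t) (cutoff_le_one t)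
    rw [norm_smul, Real.norm_of_nonneg (sq_nonneg _)]
    nlinarith [norm_nonneg ξ]
  have hX' : ∀ t, ‖(2 * cutoff t * cutoffSlope t) • ξ‖ ≤ B := fun t => by
    have c1 := cutoff_nonneg t
    have c2 := cutoffSlope_nonneg t
    have h2 : cutoff t * cutoffSlope t ≤ 1 * 2 :=
      mul_le_mul (cutoff_le_one t) (cutoffSlope_le t) c2 zero_le_one
    rw [norm_smul, Real.norm_of_nonneg (by positivity)]
    nlinarith [norm_nonneg ξ]
  have hvar := fun (a : ι) (σ : ℝ) (hσ : |σ| ≤ s₁) =>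
    hp.reach_variation hM hι h0 h1 hτ hf he (s := σ) (ε := ε') a fun t =>
      H₁ (γ t, γ' t) ⟨hmem t, mem_closedBall_zero_iff.2 (hw t)⟩
        (cutoff t • e a t,
          fieldVelocity u (γ t) (γ' t) (fun b => e b t) (cutoff t) (cutoffSlope t) a)
        ⟨mem_closedBall_zero_iff.2 (hV a t), mem_closedBall_zero_iff.2 (hV' a t)⟩ σ hσ
  have hs2 : s ^ 2 ≤ s := by nlinarith
  have hdrift := hp.reach_drift hM h0 h1 hτ ξ (s := -s ^ 2) (ε := ε') fun t =>
    H₂ (γ t, γ' t) ⟨hmem t, mem_closedBall_zero_iff.2 (hw t)⟩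
      (cutoff t ^ 2 • ξ, (2 * cutoff t * cutoffSlope t) • ξ)
      ⟨mem_closedBall_zero_iff.2 (hX t), mem_closedBall_zero_iff.2 (hX' t)⟩ (-s ^ 2)
      (by rw [abs_neg, abs_of_nonneg (sq_nonneg s)]; exact hs2.trans hss₂)
  have hC : ∀ t ∈ Icc (0 : ℝ) 1, |α (γ' t) - G u (γ t) ξ (γ' t)| ≤ ‖α‖ * (D + 1) + M₁ := by
    intro t ht
    have h2 : γ t ∈ K₁ := by
      have h3 := hp.reach ht.1 one_pos
      rw [h0 0 le_rfl] at h3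
      exact hK₁R _ (h3.mono (by linarith [ht.2]))
    have h3 : ‖γ' t‖ ≤ D + 1 := by
      have h4 := (hDb _ h2 (γ' t)).1
      nlinarith [norm_nonneg (γ' t), hp.speed t]
    have h4 := (hM₁b _ h2 ξ (γ' t) 0 (le_max_right _ _) (h3.trans (le_max_left _ _))
      (by simp)).2.2
    have h5 : |α (γ' t)| ≤ ‖α‖ * (D + 1) :=
      (α.le_opNorm _).trans (mul_le_mul_of_nonneg_left h3 (norm_nonneg _))
    exact (abs_sub _ _).trans (add_le_add h5 h4)
  have hsum := h.integral_energyHess_le hp hf hec hτ hC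
  have hδ₁ : ∀ a, |∫ t in (0 : ℝ)..τ, cutoffSlope t * G u (γ t) (γ' t) (e a t)| ≤ 1 := fun a => by
    rw [← integral_cutoffSlope hτ, ← Real.norm_eq_abs]
    refine intervalIntegral.norm_integral_le_of_norm_le (by linarith)
      (Eventually.of_forall fun t _ => ?_) (continuous_cutoffSlope.intervalIntegrable _ _)
    rw [norm_mul, Real.norm_of_nonneg (cutoffSlope_nonneg t), Real.norm_eq_abs]
    exact mul_le_of_le_one_right (cutoffSlope_nonneg t)
      (hM.abs_le_one_of_frame hι (hp.mem t) (hf t) (hp.speed t) a)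
  have hδ₂ : ∀ a, |∫ t in (0 : ℝ)..τ,
      energyHess u (γ t) (γ' t) (fun b => e b t) (cutoff t) (cutoffSlope t) a| ≤ 7 * M * τ := by
    intro a
    have h2 := intervalIntegral.norm_integral_le_of_norm_le_const (a := 0) (b := τ) (C := 7 * M)
      (f := fun t => energyHess u (γ t) (γ' t) (fun b => e b t) (cutoff t) (cutoffSlope t) a)
      fun t _ => ?_
    · rwa [sub_zero, abs_of_nonneg (by linarith), Real.norm_eq_abs] at h2
    · have b1 := abs_le.1 (hMb _ (hmem t) _ _ _ (hV a t) (hw t) (hV' a t)).1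
      have b2 := abs_le.1 (hMb _ (hmem t) _ _ _ (hV a t) (hw t) (hV' a t)).2.1
      have b3 := abs_le.1 (hMb _ (hmem t) _ _ 0 (hV' a t) (hV' a t) (by simp; linarith)).2.2
      rw [Real.norm_eq_abs, energyHess]
      exact abs_le.2 ⟨by linarith [b1.1, b2.1, b3.1], by linarith [b1.2, b2.2, b3.2]⟩
  have hη : |∫ t in (0 : ℝ)..τ, (T u (γ t) (cutoff t ^ 2 • ξ) (γ' t) (γ' t)
      + 2 * G u (γ t) (γ' t) ((2 * cutoff t * cutoffSlope t) • ξ))| ≤ 3 * M * τ := by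
    have h2 := intervalIntegral.norm_integral_le_of_norm_le_const (a := 0) (b := τ) (C := 3 * M)
      (f := fun t => T u (γ t) (cutoff t ^ 2 • ξ) (γ' t) (γ' t)
        + 2 * G u (γ t) (γ' t) ((2 * cutoff t * cutoffSlope t) • ξ)) fun t _ => ?_
    · rwa [sub_zero, abs_of_nonneg (by linarith), Real.norm_eq_abs] at h2
    · have b2 := abs_le.1 (hMb _ (hmem t) _ _ _ (hX t) (hw t) (hw t)).2.1
      have b3 := abs_le.1 (hMb _ (hmem t) _ _ 0 (hw t) (hX' t) (by simp; linarith)).2.2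
      rw [Real.norm_eq_abs]
      exact abs_le.2 ⟨by linarith [b2.1, b3.1], by linarith [b2.2, b3.2]⟩
  set δ₁ := fun a => ∫ t in (0 : ℝ)..τ, cutoffSlope t * G u (γ t) (γ' t) (e a t) with hδ₁def
  set δ₂ := fun a => ∫ t in (0 : ℝ)..τ,
      energyHess u (γ t) (γ' t) (fun b => e b t) (cutoff t) (cutoffSlope t) a with hδ₂def
  set η := ∫ t in (0 : ℝ)..τ, (T u (γ t) (cutoff t ^ 2 • ξ) (γ' t) (γ' t)
      + 2 * G u (γ t) (γ' t) ((2 * cutoff t * cutoffSlope t) • ξ)) with hηdef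
  have hετ : (n + 1) * (ε' * τ) ≤ ε := by
    calc (n + 1) * (ε' * τ) ≤ (n + 1) * (ε' * R') := by gcongr; linarith
      _ = ε := by rw [hε']; field_simp
  have hετ0 : 0 ≤ ε' * τ := by positivity
  have hετ1 : ε' * τ ≤ ε := by nlinarith
  have hMτ : M * τ ≤ M * R' := by gcongr; linarith
  have hbound : ∀ a, ∀ σ : ℝ, |σ| = s →
      |σ * δ₁ a + σ ^ 2 * (1 / 4 * δ₂ a + ε' * τ / 2)| ≤ 3 * s := fun a σ hσ => by
    have b1 : |σ * δ₁ a| ≤ s := by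
      rw [abs_mul, hσ]; exact mul_le_of_le_one_right hs.le (hδ₁ a)
    have b2 : |1 / 4 * δ₂ a + ε' * τ / 2| ≤ L := by
      have := abs_le.1 (hδ₂ a)
      exact abs_le.2 ⟨by linarith [this.1], by linarith [this.2]⟩
    have b3 : |σ ^ 2 * (1 / 4 * δ₂ a + ε' * τ / 2)| ≤ s := by
      rw [abs_mul, abs_pow, hσ]
      calc s ^ 2 * |1 / 4 * δ₂ a + ε' * τ / 2| ≤ s ^ 2 * L := by gcongr
        _ = s * (s * L) := by ring
        _ ≤ s * 1 := by gcongr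
        _ = s := mul_one s
    linarith [abs_add_le (σ * δ₁ a) (σ ^ 2 * (1 / 4 * δ₂ a + ε' * τ / 2))]
  refine ⟨fun a => e a τ, h1 τ le_rfl ▸ hf τ,
    fun a => s * δ₁ a + s ^ 2 * (1 / 4 * δ₂ a + ε' * τ / 2),
    fun a => (-s) * δ₁ a + (-s) ^ 2 * (1 / 4 * δ₂ a + ε' * τ / 2),
    -s ^ 2 * (1 / 2 * η) + |-s ^ 2| * (ε' * τ / 2),
    fun a => hvar a s (by rwa [abs_of_pos hs]),
    fun a => hvar a (-s) (by rwa [abs_neg, abs_of_pos hs]), hdrift, ?_,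
    fun a => ⟨hbound a s (abs_of_pos hs), hbound a (-s) (by rw [abs_neg, abs_of_pos hs])⟩, ?_⟩
  · have h2 : ∑ a, (s * δ₁ a + s ^ 2 * (1 / 4 * δ₂ a + ε' * τ / 2)
        + ((-s) * δ₁ a + (-s) ^ 2 * (1 / 4 * δ₂ a + ε' * τ / 2)))
        = s ^ 2 * (1 / 2 * ∑ a, δ₂ a + n * (ε' * τ)) := by
      have : ∀ a, s * δ₁ a + s ^ 2 * (1 / 4 * δ₂ a + ε' * τ / 2)
        + ((-s) * δ₁ a + (-s) ^ 2 * (1 / 4 * δ₂ a + ε' * τ / 2))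
        = s ^ 2 * (1 / 2) * δ₂ a + s ^ 2 * (ε' * τ) := fun a => by ring
      simp only [this, Finset.sum_add_distrib, ← Finset.mul_sum, Finset.sum_const,
        Finset.card_univ, nsmul_eq_mul]
      ring
    rw [h2, abs_neg, abs_of_nonneg (sq_nonneg s)]
    have h3 : 1 / 2 * ∑ a, δ₂ a + n * (ε' * τ) - 1 / 2 * η + ε' * τ / 2
        ≤ ‖α‖ * (D + 1) + M₁ + 2 * n + ε := by
      linear_combination (1 / 2) * hsum + hετ + (1 / 2) * hετ0
    linear_combination mul_le_mul_of_nonneg_left h3 (sq_nonneg s)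
  · rw [abs_neg, abs_of_nonneg (sq_nonneg s)]
    have b2 : |-(1 / 2 * η) + ε' * τ / 2| ≤ L := by
      have := abs_le.1 hη
      exact abs_le.2 ⟨by linarith [this.1], by linarith [this.2]⟩
    have b3 : -s ^ 2 * (1 / 2 * η) + s ^ 2 * (ε' * τ / 2)
        = s ^ 2 * (-(1 / 2 * η) + ε' * τ / 2) := by ring
    rw [b3, abs_mul, abs_of_nonneg (sq_nonneg s)]
    calc s ^ 2 * |-(1 / 2 * η) + ε' * τ / 2| ≤ s ^ 2 * L := by gcongr
      _ = s * (s * L) := by ring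
      _ ≤ s * 1 := by gcongr
      _ ≤ 3 * s := by linarith

end VariationExistence

section Barrier

open Set Filter Topology

variable {E : Type*} [NormedAddCommGroup E] [NormedSpace ℝ E]

section SmoothTaylor

variable {F : E → ℝ} {Ω K W : Set E}

theorem hasDerivAt_fderiv_line {z w : E} {t : ℝ} (hF : ContDiffAt ℝ (⊤ : ℕ∞) F (z + t • w)) :
    HasDerivAt (fun s : ℝ => F (z + s • w)) (fderiv ℝ F (z + t • w) w) t :=
  ((hF.differentiableAt (by simp)).hasFDerivAt).comp_hasDerivAt t (hasDerivAt_line z w t)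

theorem contDiffAt_fderiv_apply {z : E} (hF : ContDiffAt ℝ (⊤ : ℕ∞) F z) (w : E) :
    ContDiffAt ℝ (⊤ : ℕ∞) (fun y => fderiv ℝ F y w) z :=
  (hF.fderiv_right (m := (⊤ : ℕ∞)) (by simp)).clm_apply contDiffAt_const

theorem uniform_taylor_smooth (hΩ : IsOpen Ω) (hF : ∀ z ∈ Ω, ContDiffAt ℝ (⊤ : ℕ∞) F z)
    (hK : IsCompact K) (hKΩ : K ⊆ Ω) (hW : IsCompact W) {ε : ℝ} (hε : 0 < ε) :
    ∃ s₀ > 0, ∀ z ∈ K, ∀ w ∈ W, ∀ s : ℝ, |s| ≤ s₀ → z + s • w ∈ Ω ∧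
      |F (z + s • w) - F z - s * fderiv ℝ F z w
        - s ^ 2 / 2 * fderiv ℝ (fun y => fderiv ℝ F y w) z w| ≤ ε * s ^ 2 := by
  refine uniform_taylor hΩ (D₁ := fun z w => fderiv ℝ F z w)
    (D₂ := fun z w => fderiv ℝ (fun y => fderiv ℝ F y w) z w)
    (fun z w t ht => hasDerivAt_fderiv_line (hF _ ht))
    (fun z w t ht => hasDerivAt_fderiv_line (contDiffAt_fderiv_apply (hF _ ht) w))
    (fun z hz w => ?_) hK hKΩ hW hε
  have h2 : ∀ y ∈ Ω, ∀ w, fderiv ℝ (fun y => fderiv ℝ F y w) y w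
      = fderiv ℝ (fderiv ℝ F) y w w := fun y hy w => by
    have h3 : DifferentiableAt ℝ (fderiv ℝ F) y :=
      ((hF y hy).fderiv_right (m := (⊤ : ℕ∞)) (by simp)).differentiableAt (by simp)
    rw [fderiv_clm_apply h3 (differentiableAt_const w)]
    simp
  have h3 : ContinuousAt (fun q : E × E => fderiv ℝ (fderiv ℝ F) q.1 q.2 q.2) (z, w) := by
    have h4 : ContinuousAt (fderiv ℝ (fderiv ℝ F)) z :=
      (((hF z hz).fderiv_right (m := (⊤ : ℕ∞)) (by simp)).fderiv_right
        (m := (⊤ : ℕ∞)) (by simp)).continuousAt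
    have h5 : ContinuousAt (fun q : E × E => fderiv ℝ (fderiv ℝ F) q.1) (z, w) :=
      ContinuousAt.comp (f := Prod.fst) (x := (z, w)) h4 continuousAt_fst
    exact (h5.clm_apply continuousAt_snd).clm_apply continuousAt_snd
  refine h3.congr ?_
  filter_upwards [continuousAt_fst.eventually_mem (hΩ.mem_nhds hz)] with q hq
  exact (h2 q.1 hq q.2).symm

theorem uniform_taylor_smooth_one (hΩ : IsOpen Ω) (hF : ∀ z ∈ Ω, ContDiffAt ℝ (⊤ : ℕ∞) F z)
    (hK : IsCompact K) (hKΩ : K ⊆ Ω) (hW : IsCompact W) {ε : ℝ} (hε : 0 < ε) :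
    ∃ s₀ > 0, ∀ z ∈ K, ∀ w ∈ W, ∀ s : ℝ, |s| ≤ s₀ → z + s • w ∈ Ω ∧
      |F (z + s • w) - F z - s * fderiv ℝ F z w| ≤ ε * |s| := by
  refine uniform_taylor_one hΩ (D₁ := fun z w => fderiv ℝ F z w)
    (fun z w t ht => hasDerivAt_fderiv_line (hF _ ht)) (fun z hz w => ?_) hK hKΩ hW hε
  have h4 : ContinuousAt (fderiv ℝ F) z :=
    ((hF z hz).fderiv_right (m := (⊤ : ℕ∞)) (by simp)).continuousAt
  have h5 : ContinuousAt (fun q : E × E => fderiv ℝ F q.1) (z, w) :=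
    ContinuousAt.comp (f := Prod.fst) (x := (z, w)) h4 continuousAt_fst
  exact h5.clm_apply continuousAt_snd

end SmoothTaylor

variable [FiniteDimensional ℝ E] {ι : Type*} [Fintype ι] [DecidableEq ι]
variable {N : Set E} {u : E → ℝ} {α : E →L[ℝ] ℝ} {ξ x₀ : E}

set_option maxHeartbeats 1000000 in
/-- The maximum principle for the cubic norm, with a barrier `φ` of the distance from `x₀`. -/
theorem IsSoliton.exists_barrier (h : IsSoliton ι N u α ξ) (hb : ∀ r, Bounded N u x₀ r) :
    ∃ C > 0, ∀ (φ φ' φ'' : ℝ → ℝ) (R c : ℝ), 0 < c →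
      (∀ t < R, HasDerivAt φ (φ' t) t) → (∀ t < R, HasDerivAt φ' (φ'' t) t) →
      ContinuousOn φ'' (Iio R) → (∀ t < R, 0 ≤ φ' t) → (∀ t < R, 0 ≤ φ'' t) →
      (∀ x τ, 1 ≤ τ → τ < R → Reach N u x₀ x τ → cubicNorm ι u x ≤ φ τ) →
      (∀ ε > 0, ∃ x τ, 2 ≤ τ ∧ τ ≤ R - c ∧ Reach N u x₀ x τ ∧ φ τ - ε ≤ cubicNorm ι u x) →
      ∀ ε > 0, ∃ τ, 2 ≤ τ ∧ τ ≤ R - c ∧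
        φ τ ^ 2 ≤ 2 * Fintype.card ι * (C * (φ' τ + φ'' τ)) + ε := by
  have hM := h.toHessianMetric
  have hι := h.card_eq
  have := FiniteDimensional.proper_real E
  obtain ⟨C, hC, hvar⟩ := h.exists_variation hb
  set n : ℝ := (Fintype.card ι : ℝ) with hn
  have hn0 : 0 ≤ n := Nat.cast_nonneg _
  refine ⟨C + 9 * (n + 1), by positivity, ?_⟩
  intro φ φ' φ'' R c hc hφ hφ' hφ'' hpos hpos' hle hne ε hε
  have hIcc : Icc 2 (R - c) ⊆ Iio R := fun t ht => by
    have := ht.2; simp only [mem_Iio]; linarith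
  obtain ⟨P₀, hP₀⟩ := (isCompact_Icc.image_of_continuousOn (s := Icc 2 (R - c))
    (f := φ) fun t ht => (hφ t (hIcc ht)).continuousAt.continuousWithinAt).bddAbove
  obtain ⟨P₁, hP₁⟩ := (isCompact_Icc.image_of_continuousOn (s := Icc 2 (R - c))
    (f := φ') fun t ht => (hφ' t (hIcc ht)).continuousAt.continuousWithinAt).bddAbove
  set P := max 1 (max P₀ P₁) with hPdef
  have hP1 : 1 ≤ P := le_max_left _ _
  have hPφ : ∀ t ∈ Icc 2 (R - c), φ t ≤ P := fun t ht =>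
    (hP₀ (mem_image_of_mem φ ht)).trans (by simp [hPdef])
  have hPφ' : ∀ t ∈ Icc 2 (R - c), φ' t ≤ P := fun t ht =>
    (hP₁ (mem_image_of_mem φ' ht)).trans (by simp [hPdef])
  set L := 2 * n * (P + 22 * (n + 1)) + 3 * P with hLdef
  have hL : 0 < L := by positivity
  set ε₁ := min 1 (ε / L) with hε₁
  have hε₁pos : 0 < ε₁ := by positivity
  have hε₁1 : ε₁ ≤ 1 := min_le_left _ _
  have hε₁L : ε₁ * L ≤ ε := by
    calc ε₁ * L ≤ ε / L * L := by gcongr; exact min_le_right _ _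
      _ = ε := div_mul_cancel₀ _ hL.ne'
  obtain ⟨s₀, hs₀, Hvar⟩ := hvar (R - c) ε₁ hε₁pos
  obtain ⟨K, hK, hKN, hKR⟩ := hb (R - c)
  obtain ⟨D, hD, hDb⟩ := hM.exists_norm_bound hK hKN
  set B := max (D + 1) ‖ξ‖ with hB
  have hS : ∀ z ∈ N, ContDiffAt ℝ (⊤ : ℕ∞) (cubicNorm ι u) z := fun z hz =>
    hM.contDiffAt_cubicNorm hz hι
  obtain ⟨s₁, hs₁, H₁⟩ := uniform_taylor_smooth hM.isOpen hS hK hKN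
    (isCompact_closedBall (0 : E) B) hε₁pos
  obtain ⟨s₂, hs₂, H₂⟩ := uniform_taylor_smooth_one hM.isOpen hS hK hKN
    (isCompact_closedBall (0 : E) B) hε₁pos
  obtain ⟨s₃, hs₃, H₃⟩ := uniform_taylor (F := φ) (D₁ := fun t w => φ' t * w)
    (D₂ := fun t w => φ'' t * w * w) (Ω := Iio R) (K := Icc 2 (R - c)) (W := {1}) isOpen_Iio
    (fun z w t ht => by
      have := (hφ _ ht).comp t (hasDerivAt_line z w t)
      simpa [Function.comp_def] using this)
    (fun z w t ht => by
      have := ((hφ' _ ht).comp t (hasDerivAt_line z w t)).mul_const w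
      simpa [Function.comp_def] using this)
    (fun z hz w => by
      have h1 : ContinuousAt (fun q : ℝ × ℝ => φ'' q.1) (z, w) :=
        ContinuousAt.comp (f := Prod.fst) (x := (z, w))
          (hφ''.continuousAt (isOpen_Iio.mem_nhds hz)) continuousAt_fst
      exact (h1.mul continuousAt_snd).mul continuousAt_snd)
    isCompact_Icc hIcc isCompact_singleton hε₁pos
  set s := min (min s₀ s₁) (min (min s₂ (s₃ / 3)) (min (1 / 3) (c / 4))) with hsdef
  have hs : 0 < s := by positivity
  have hss₀ : s ≤ s₀ := by simp [hsdef]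
  have hss₁ : s ≤ s₁ := by simp [hsdef]
  have hss₂ : s ≤ s₂ := by simp [hsdef]
  have hss₃ : s ≤ s₃ / 3 := by simp [hsdef]
  have hs1 : s ≤ 1 / 3 := by simp [hsdef]
  have hsc : s ≤ c / 4 := by simp [hsdef]
  have hs2 : s ^ 2 ≤ s := by nlinarith
  obtain ⟨x, τ, hτ2, hτR, hreach, hnear⟩ := hne (ε₁ * s ^ 2) (by positivity)
  have hτ : τ ∈ Icc 2 (R - c) := ⟨hτ2, hτR⟩
  obtain ⟨e, he, p, q, k, hp, hq, hk, hsum, hpq, hk3⟩ :=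
    Hvar s hs hss₀ x τ (by linarith) hτR hreach
  have hxK : x ∈ K := hKR x (hreach.mono hτR)
  have hxN := hKN hxK
  refine ⟨τ, hτ2, hτR, ?_⟩
  have hφτ : cubicNorm ι u x ≤ φ τ := hle x τ (by linarith) (by linarith) hreach
  have hupper : ∀ r y, |r| ≤ 3 * s → Reach N u x₀ y (τ + r) →
      cubicNorm ι u y ≤ φ τ + r * φ' τ + s ^ 2 * (9 / 2 * φ'' τ + 9 * ε₁) := by
    intro r y hr hy
    have h2 := abs_le.1 hr
    refine (hle y (τ + r) (by linarith) (by linarith) hy).trans ?_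
    have h3 := (abs_le.1 (H₃ τ hτ 1 rfl r (by linarith)).2).2
    simp only [smul_eq_mul, mul_one] at h3
    have h4 : r ^ 2 ≤ 9 * s ^ 2 := by nlinarith [sq_abs r, abs_nonneg r]
    have h5 := mul_le_mul_of_nonneg_right h4 (hpos' τ (hIcc hτ))
    have h6 := mul_le_mul_of_nonneg_right h4 hε₁pos.le
    linarith
  have hen : ∀ a, e a ∈ Metric.closedBall (0 : E) B := fun a => by
    rw [mem_closedBall_zero_iff]
    refine le_trans ?_ (le_max_left _ _)
    have h2 := (hDb x hxK (e a)).1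
    rw [he a a, if_pos rfl] at h2
    nlinarith [norm_nonneg (e a)]
  set S := cubicNorm ι u with hSdef
  have hdir : ∀ a, s ^ 2 * fderiv ℝ (fun y => fderiv ℝ S y (e a)) x (e a)
      ≤ (p a + q a) * φ' τ + s ^ 2 * (9 * φ'' τ + 22 * ε₁) := by
    intro a
    have t1 := (abs_le.1 (H₁ x hxK (e a) (hen a) s (by rwa [abs_of_pos hs])).2).1
    have t2 := (abs_le.1 (H₁ x hxK (e a) (hen a) (-s) (by rwa [abs_neg, abs_of_pos hs])).2).1
    have u1 := hupper _ _ (hpq a).1 (hp a)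
    have u2 := hupper _ _ (hpq a).2 (hq a)
    rw [neg_sq] at t2
    linarith
  have hξ : -s ^ 2 * fderiv ℝ S x ξ ≤ k * φ' τ + s ^ 2 * (9 / 2 * φ'' τ + 11 * ε₁) := by
    have habs : |-s ^ 2| = s ^ 2 := by rw [abs_neg, abs_of_nonneg (sq_nonneg s)]
    have t1 := (abs_le.1 (H₂ x hxK ξ (mem_closedBall_zero_iff.2 (le_max_right _ _)) (-s ^ 2)
      (by rw [habs]; exact hs2.trans hss₂)).2).1
    have u1 := hupper _ _ hk3 hk
    rw [habs] at t1
    have : 0 ≤ ε₁ * s ^ 2 := by positivity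
    linarith
  have htot : s ^ 2 * (∑ a, fderiv ℝ (fun y => fderiv ℝ S y (e a)) x (e a) - fderiv ℝ S x ξ)
      ≤ s ^ 2 * ((C + 9 * (n + 1)) * (φ' τ + φ'' τ) + ε₁ * (P + 22 * (n + 1))) := by
    have h2 := Finset.sum_le_sum fun a (_ : a ∈ Finset.univ) => hdir a
    rw [← Finset.mul_sum, Finset.sum_add_distrib, ← Finset.sum_mul, Finset.sum_const,
      Finset.card_univ, nsmul_eq_mul] at h2
    have g1 := hpos τ (hIcc hτ)
    have g2 := hpos' τ (hIcc hτ)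
    have h3 := mul_le_mul_of_nonneg_right hsum g1
    have h4 : ε₁ * φ' τ ≤ ε₁ * P := by gcongr; exact hPφ' τ hτ
    have h5 : 0 ≤ C * φ'' τ := by positivity
    have h6 : 0 ≤ 9 * (n + 1) * φ' τ := by positivity
    have h7 : (φ' τ * (C + ε₁)) + (n * (9 * φ'' τ + 22 * ε₁) + (9 / 2 * φ'' τ + 11 * ε₁))
        ≤ (C + 9 * (n + 1)) * (φ' τ + φ'' τ) + ε₁ * (P + 22 * (n + 1)) := by
      linear_combination h4 + h5 + h6 + 9 / 2 * g2 + 11 * hε₁pos.le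
    have h8 := mul_le_mul_of_nonneg_left h7 (sq_nonneg s)
    linear_combination h2 + hξ + h3 + h8
  have hΔ := le_of_mul_le_mul_left htot (by positivity)
  have h2 := h.cubicNorm_sq_le hxN he
  have hS0 : 0 ≤ S x := cubicNorm_nonneg
  have h3 := mul_le_mul_of_nonneg_left hΔ (by positivity : 0 ≤ 2 * n)
  have h4 : φ τ ≤ S x + ε₁ := by
    have : ε₁ * s ^ 2 ≤ ε₁ * 1 := by gcongr; linarith
    linarith
  have h5 : φ τ ^ 2 ≤ S x ^ 2 + 3 * P * ε₁ := by
    have h6 : φ τ ^ 2 ≤ (S x + ε₁) ^ 2 := pow_le_pow_left₀ (hS0.trans hφτ) h4 2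
    have h7 : S x * ε₁ ≤ P * ε₁ := by gcongr; exact hφτ.trans (hPφ τ hτ)
    have h8 : ε₁ * ε₁ ≤ P * ε₁ := by gcongr; linarith
    linear_combination h6 + 2 * h7 + h8
  linear_combination h5 + h2 + h3 + hε₁L

end Barrier

section CubicNormVanishing

open Set Filter Topology

theorem hasDerivAt_div_sub_pow (M : ℝ) {R t : ℝ} (k : ℕ) (ht : t < R) :
    HasDerivAt (fun t => M / (R - t) ^ (k + 1)) ((k + 1) * M / (R - t) ^ (k + 2)) t := by
  have hD : R - t ≠ 0 := by linarith [ht] |> fun h : 0 < R - t => h.ne'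
  have h1 := ((((hasDerivAt_id t).const_sub R).pow (k + 1)).inv (pow_ne_zero _ hD)).const_mul M
  refine (h1.congr_of_eventuallyEq ?_).congr_deriv ?_
  · exact Eventually.of_forall fun s => by simp [div_eq_mul_inv]
  · simp only [id, Nat.add_sub_cancel, Pi.pow_apply]
    push_cast
    field_simp
    ring

theorem le_of_forall_sq_mul_le {s m a b τ : ℝ} (hs : 0 ≤ s) (ha : 0 ≤ a) (hb : 0 ≤ b) (hτ : 0 ≤ τ)
    (H : ∀ R, 3 ≤ R → τ ≤ R → (R - τ) ^ 2 * s ≤ R ^ 2 * m + a * R + b) : s ≤ m := by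
  by_contra! hlt
  have hδ : 0 < s - m := sub_pos.2 hlt
  set L := 2 * τ * s + a + b with hL
  have hL0 : 0 ≤ L := by positivity
  set R := max 3 (max τ (L / (s - m) + 1)) with hR
  have h3 : 3 ≤ R := le_max_left _ _
  have hτR : τ ≤ R := (le_max_left _ _).trans (le_max_right _ _)
  have h4 : L / (s - m) < R :=
    (lt_add_one _).trans_le ((le_max_right _ _).trans (le_max_right _ _))
  rw [div_lt_iff₀ hδ] at h4
  have h5 := H R h3 hτR
  have h6 : 0 ≤ τ ^ 2 * s := by positivity
  have h7 : b ≤ b * R := by nlinarith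
  nlinarith

variable {E : Type*} [NormedAddCommGroup E] [NormedSpace ℝ E] [FiniteDimensional ℝ E]
variable {ι : Type*} [Fintype ι] [DecidableEq ι]
variable {N : Set E} {u : E → ℝ} {α : E →L[ℝ] ℝ} {ξ x₀ : E}

theorem HessianMetric.exists_cubicNorm_le (h : HessianMetric N u)
    (hι : Fintype.card ι = Module.finrank ℝ E) {r : ℝ} (hb : Bounded N u x₀ r) :
    ∃ m > 0, ∀ x, Reach N u x₀ x r → cubicNorm ι u x ≤ m := by
  obtain ⟨K, hK, hKN, hKR⟩ := hb
  obtain ⟨m, hm⟩ := (hK.image_of_continuousOn (f := cubicNorm ι u) fun x hx =>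
    (h.contDiffAt_cubicNorm (hKN hx) hι).continuousAt.continuousWithinAt).bddAbove
  exact ⟨max m 1, by positivity, fun x hx =>
    (hm (mem_image_of_mem _ (hKR x hx))).trans (le_max_left _ _)⟩

/-- If the cubic norm is bounded by `m` on the unit-scale ball, the weighted cubic norm on a ball
of radius `R` is bounded by `R ^ 2 * m` up to a term which is linear in `R`. -/
theorem IsSoliton.exists_weighted_bound (h : IsSoliton ι N u α ξ) (hb : ∀ r, Bounded N u x₀ r)
    {m : ℝ} (hm0 : 0 ≤ m) (hm : ∀ x, Reach N u x₀ x 2 → cubicNorm ι u x ≤ m) :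
    ∃ a ≥ 0, ∃ b ≥ 0, ∀ R, 3 ≤ R → ∀ x τ, 1 ≤ τ → τ ≤ R → Reach N u x₀ x τ →
      (R - τ) ^ 2 * cubicNorm ι u x ≤ R ^ 2 * m + a * R + b := by
  obtain ⟨C, hC, hbar⟩ := h.exists_barrier hb
  set n : ℝ := (Fintype.card ι : ℝ) with hn
  have hn0 : 0 ≤ n := Nat.cast_nonneg _
  refine ⟨4 * n * C, by positivity, 12 * n * C, by positivity, fun R hR x τ hτ hτR hx => ?_⟩
  obtain ⟨m', hm'0, hm'⟩ := h.toHessianMetric.exists_cubicNorm_le (ι := ι) h.card_eq (hb R)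
  set A : Set ℝ := {y | ∃ x τ, 1 ≤ τ ∧ τ ≤ R ∧ Reach N u x₀ x τ ∧
    y = (R - τ) ^ 2 * cubicNorm ι u x} with hA
  have hAb : BddAbove A := by
    refine ⟨R ^ 2 * m', ?_⟩
    rintro _ ⟨x, τ, h1, h2, h3, rfl⟩
    have h4 : (R - τ) ^ 2 ≤ R ^ 2 := by nlinarith
    exact mul_le_mul h4 (hm' x (h3.mono h2)) cubicNorm_nonneg (sq_nonneg R)
  have hxA : (R - τ) ^ 2 * cubicNorm ι u x ∈ A := ⟨x, τ, hτ, hτR, hx, rfl⟩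
  set M := sSup A with hM
  refine (le_csSup hAb hxA).trans ?_
  by_contra! hlt
  have hnC : 0 ≤ 4 * n * C * R + 12 * n * C := by positivity
  have hMd : R ^ 2 * m < M := by linarith
  have hMpos : 0 < M := lt_of_le_of_lt (by positivity) hMd
  set c := √(M / (2 * m')) with hc
  have hcpos : 0 < c := Real.sqrt_pos.2 (by positivity)
  have hc2 : c ^ 2 = M / (2 * m') := Real.sq_sqrt (by positivity)
  have hmain : ∀ ε > 0, M ^ 2 ≤ 2 * n * (C * (M * (2 * R + 6))) + ε * R ^ 4 := by
    intro ε hε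
    obtain ⟨σ, hσ2, hσR, hσ⟩ := hbar (fun t => M / (R - t) ^ 2) (fun t => 2 * M / (R - t) ^ 3)
      (fun t => 6 * M / (R - t) ^ 4) R c hcpos
      (fun t ht => (hasDerivAt_div_sub_pow M 1 ht).congr_deriv (by norm_num))
      (fun t ht => (hasDerivAt_div_sub_pow (2 * M) 2 ht).congr_deriv (by norm_num; ring))
      (fun t ht => ContinuousAt.continuousWithinAt (by
        have : (R - t) ^ 4 ≠ 0 := pow_ne_zero _ (sub_pos.2 ht).ne'
        fun_prop (disch := assumption)))
      (fun t ht => by have := sub_pos.2 ht; positivity)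
      (fun t ht => by have := sub_pos.2 ht; positivity)
      (fun y σ h1 h2 h3 => by
        have h4 := sub_pos.2 h2
        rw [le_div_iff₀ (by positivity), mul_comm]
        exact le_csSup hAb ⟨y, σ, h1, h2.le, h3, rfl⟩)
      (fun δ hδ => by
        obtain ⟨_, ⟨y, σ, h1, h2, h3, rfl⟩, h4⟩ := exists_lt_of_lt_csSup ⟨_, hxA⟩
          (show M - min (min (M - R ^ 2 * m) (M / 2)) (δ * c ^ 2) < sSup A from
            sub_lt_self _ (lt_min (lt_min (sub_pos.2 hMd) (by positivity)) (by positivity)))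
        have g1 : R ^ 2 * m < (R - σ) ^ 2 * cubicNorm ι u y := by
          linarith [(min_le_left (min (M - R ^ 2 * m) (M / 2)) (δ * c ^ 2)).trans (min_le_left _ _)]
        have g2 : M / 2 < (R - σ) ^ 2 * cubicNorm ι u y := by
          linarith [(min_le_left (min (M - R ^ 2 * m) (M / 2)) (δ * c ^ 2)).trans
            (min_le_right _ _)]
        have g3 : M - δ * c ^ 2 < (R - σ) ^ 2 * cubicNorm ι u y := by
          linarith [min_le_right (min (M - R ^ 2 * m) (M / 2)) (δ * c ^ 2)]
        have g4 : 2 ≤ σ := by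
          by_contra! h5
          have h6 : (R - σ) ^ 2 ≤ R ^ 2 := by nlinarith
          exact absurd (mul_le_mul h6 (hm y (h3.mono h5.le)) cubicNorm_nonneg (sq_nonneg R))
            (not_le.2 g1)
        have g5 : c ^ 2 ≤ (R - σ) ^ 2 := by
          rw [hc2, div_le_iff₀ (by positivity)]
          have h6 := mul_le_mul_of_nonneg_left (hm' y (h3.mono h2)) (sq_nonneg (R - σ))
          linarith
        have g6 : c ≤ R - σ := le_of_sq_le_sq g5 (by linarith)
        refine ⟨y, σ, g4, by linarith, h3, ?_⟩
        have g7 : 0 < (R - σ) ^ 2 := pow_pos (hcpos.trans_le g6) 2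
        rw [sub_le_iff_le_add, div_le_iff₀ g7]
        nlinarith [mul_le_mul_of_nonneg_left g5 hδ.le])
      ε hε
    have hD : 0 < R - σ := by linarith
    have hDR : R - σ ≤ R := by linarith
    have h1 := mul_le_mul_of_nonneg_right hσ (pow_nonneg hD.le 4)
    have h2 : (M / (R - σ) ^ 2) ^ 2 * (R - σ) ^ 4 = M ^ 2 := by field_simp
    have h3 : (2 * n * (C * (2 * M / (R - σ) ^ 3 + 6 * M / (R - σ) ^ 4)) + ε) * (R - σ) ^ 4
        = 2 * n * (C * (M * (2 * (R - σ) + 6))) + ε * (R - σ) ^ 4 := by field_simp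
    refine (h2.symm.trans_le (h1.trans_eq h3)).trans ?_
    gcongr
  have hM2 : M ^ 2 ≤ 2 * n * (C * (M * (2 * R + 6))) := by
    refine le_of_forall_pos_le_add fun ε hε => ?_
    have hRpos : 0 < R := by linarith
    have := hmain (ε / R ^ 4) (by positivity)
    rwa [div_mul_cancel₀ _ (by positivity)] at this
  have hM3 : M ≤ 2 * n * (C * (2 * R + 6)) :=
    le_of_mul_le_mul_left (by nlinarith) hMpos
  have : 0 ≤ R ^ 2 * m := by positivity
  linarith

/-- A metric soliton of Hessian type with bounded balls has vanishing cubic form. -/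
theorem IsSoliton.cubicNorm_eq_zero (h : IsSoliton ι N u α ξ) (hx₀ : x₀ ∈ N)
    (hb : ∀ r, Bounded N u x₀ r) : cubicNorm ι u x₀ = 0 := by
  have hM := h.toHessianMetric
  set A : Set ℝ := cubicNorm ι u '' {x | Reach N u x₀ x 2} with hA
  obtain ⟨m', hm'0, hm'⟩ := hM.exists_cubicNorm_le (ι := ι) h.card_eq (hb 2)
  have hAb : BddAbove A := ⟨m', by rintro _ ⟨x, hx, rfl⟩; exact hm' x hx⟩
  have hxA : cubicNorm ι u x₀ ∈ A := ⟨x₀, Reach.refl hx₀ 2, rfl⟩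
  set m := sSup A with hm
  have hm1 : ∀ x, Reach N u x₀ x 2 → cubicNorm ι u x ≤ m := fun x hx =>
    le_csSup hAb ⟨x, hx, rfl⟩
  have hm0 : 0 ≤ m := cubicNorm_nonneg.trans (le_csSup hAb hxA)
  obtain ⟨a, ha, b, hb', hab⟩ := h.exists_weighted_bound hb hm0 hm1
  have hglobal : ∀ x τ, 1 ≤ τ → Reach N u x₀ x τ → cubicNorm ι u x ≤ m := fun x τ hτ hx =>
    le_of_forall_sq_mul_le cubicNorm_nonneg ha hb' (by linarith) fun R h3 hτR =>
      hab R h3 x τ hτ hτR hx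
  obtain ⟨C, hC, hbar⟩ := h.exists_barrier hb
  have hm2 : m ^ 2 ≤ 0 := by
    refine le_of_forall_pos_le_add fun ε hε => ?_
    obtain ⟨σ, -, -, hσ⟩ := hbar (fun _ => m) (fun _ => 0) (fun _ => 0) 4 2 two_pos
      (fun t _ => hasDerivAt_const t m) (fun t _ => hasDerivAt_const t 0) continuousOn_const
      (fun _ _ => le_rfl) (fun _ _ => le_rfl) (fun x τ hτ _ hx => hglobal x τ hτ hx)
      (fun δ hδ => by
        obtain ⟨_, ⟨y, hy, rfl⟩, h4⟩ := exists_lt_of_lt_csSup ⟨_, hxA⟩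
          (show m - δ < sSup A from sub_lt_self _ hδ)
        exact ⟨y, 2, le_rfl, by norm_num, hy, h4.le⟩) ε hε
    simpa using hσ
  have hm3 : m = 0 := pow_eq_zero_iff two_ne_zero |>.1 (le_antisymm hm2 (sq_nonneg m))
  exact le_antisymm (hm3 ▸ le_csSup hAb hxA) cubicNorm_nonneg

end CubicNormVanishing

section FlatCase

open Set Filter Topology

variable {E : Type*} [NormedAddCommGroup E] [NormedSpace ℝ E] [FiniteDimensional ℝ E]
variable {ι : Type*} [Fintype ι] [DecidableEq ι]
variable {N : Set E} {u : E → ℝ} {x : E} {α : E →L[ℝ] ℝ} {ξ : E}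

theorem HessianMetric.T_eq_zero_of_cubicNorm (h : HessianMetric N u) (hx : x ∈ N)
    (hι : Fintype.card ι = Module.finrank ℝ E) (h0 : cubicNorm ι u x = 0) (a b c : E) :
    T u x a b c = 0 := by
  obtain ⟨e, he⟩ := h.exists_frame hx hι
  rw [h.cubicNorm_eq hx hι he] at h0
  have hz : ∀ i j k, T u x (e i) (e j) (e k) = 0 := by
    intro i j k
    rw [Finset.sum_eq_zero_iff_of_nonneg fun _ _ => by positivity] at h0
    have h1 := h0 i (Finset.mem_univ _)
    rw [Finset.sum_eq_zero_iff_of_nonneg fun _ _ => by positivity] at h1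
    have h2 := h1 j (Finset.mem_univ _)
    rw [Finset.sum_eq_zero_iff_of_nonneg fun _ _ => by positivity] at h2
    exact pow_eq_zero_iff two_ne_zero |>.1 (h2 k (Finset.mem_univ _))
  rw [he.expand hι a, he.expand hι b, he.expand hι c]
  simp [T_sum₁, T_sum₂, T_sum₃, T_smul₁, T_smul₂, T_smul₃, hz]

omit [FiniteDimensional ℝ E] in
/-- If the third derivatives vanish, the Hessian is constant along segments in `N`. -/
theorem HessianMetric.G_line_eq (h : HessianMetric N u) (hT : ∀ y ∈ N, ∀ a b c, T u y a b c = 0)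
    {w : E} {s : ℝ} (hs : 0 ≤ s) (hN : ∀ t ∈ Icc 0 s, x + t • w ∈ N) (a b : E) :
    G u (x + s • w) a b = G u x a b := by
  have hd : ∀ t ∈ Icc 0 s, HasDerivAt (fun t => G u (x + t • w) a b) 0 t := by
    intro t ht
    have := h.hasDerivAt_G (hasDerivAt_line x w t) (hN t ht) (hasDerivAt_const t a)
      (hasDerivAt_const t b)
    simpa [hT _ (hN t ht), G_zero₁, G_zero₂] using this
  have := constant_of_has_deriv_right_zero (f := fun t => G u (x + t • w) a b) (a := 0) (b := s)
    (fun t ht => (hd t ht).continuousAt.continuousWithinAt)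
    (fun t ht => (hd t (Ico_subset_Icc_self ht)).hasDerivWithinAt) s ⟨hs, le_rfl⟩
  simpa using this

omit [FiniteDimensional ℝ E] in
theorem HessianMetric.eq_univ_of_T_eq_zero (h : HessianMetric N u) (hc : CurveComplete N u)
    (hT : ∀ y ∈ N, ∀ a b c, T u y a b c = 0) (hx : x ∈ N) : N = univ := by
  by_contra hne
  obtain ⟨z, hz⟩ := (ne_univ_iff_exists_notMem N).1 hne
  set w := z - x with hw
  set S : Set ℝ := {t | 0 ≤ t ∧ x + t • w ∉ N} with hS
  have hSc : IsClosed S := by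
    have h1 : IsClosed {t : ℝ | x + t • w ∉ N} :=
      h.isOpen.isClosed_compl.preimage (f := fun t : ℝ => x + t • w) (by fun_prop)
    exact isClosed_Ici.inter h1
  have hSn : S.Nonempty := ⟨1, zero_le_one, by simpa [hw] using hz⟩
  have hSb : BddBelow S := ⟨0, fun t ht => ht.1⟩
  set b := sInf S with hb
  have hbS : b ∈ S := hSc.csInf_mem hSn hSb
  have hbelow : ∀ t, 0 ≤ t → t < b → x + t • w ∈ N := by
    intro t h0 htb
    by_contra hN
    exact absurd (csInf_le hSb ⟨h0, hN⟩) (not_le.2 htb)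
  have hb0 : 0 < b := by
    refine lt_of_le_of_ne hbS.1 fun h0 => hbS.2 ?_
    rw [← h0]
    simpa using hx
  have hlt : ∀ t < (1 : ℝ), b * max t 0 ^ 2 < b := by
    intro t ht
    have h1 : max t 0 < 1 := max_lt ht one_pos
    have h2 : max t 0 ^ 2 < 1 := pow_lt_one₀ (le_max_right _ _) h1 two_ne_zero
    nlinarith
  have hnn : ∀ t : ℝ, 0 ≤ b * max t 0 ^ 2 := fun t => by positivity
  obtain ⟨K, hK, hKN, hfr⟩ := hc (fun t => x + (b * max t 0 ^ 2) • w)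
    (fun t => (b * (2 * max t 0)) • w) (4 * b ^ 2 * G u x w w) (by fun_prop)
    (fun t _ => (((hasDerivAt_max_sq t).const_mul b).smul_const w).const_add x)
    (fun t ht => hbelow _ (hnn t) (hlt t ht))
    (fun t ht => by
      simp only [G_smul₁, G_smul₂]
      rw [h.G_line_eq hT (hnn t) (fun s hs => hbelow s hs.1 (hs.2.trans_lt (hlt t ht)))]
      have h1 : max t 0 ≤ 1 := max_le ht.le zero_le_one
      have h2 : 0 ≤ max t 0 := le_max_right _ _
      have h3 : 0 ≤ G u x w w := by
        rcases eq_or_ne w 0 with h0 | h0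
        · simp [h0, G_zero₁]
        · exact (h.pos x hx w h0).le
      have h4 : b * (2 * max t 0) * (b * (2 * max t 0)) ≤ 4 * b ^ 2 := by
        have : max t 0 ^ 2 ≤ 1 := pow_le_one₀ h2 h1
        nlinarith [sq_nonneg b]
      nlinarith)
  have hcont : Tendsto (fun t : ℝ => x + (b * max t 0 ^ 2) • w) (𝓝[<] 1) (𝓝 (x + b • w)) := by
    have : Continuous fun t : ℝ => x + (b * max t 0 ^ 2) • w := by fun_prop
    have h1 := (this.tendsto 1).mono_left (nhdsWithin_le_nhds (s := Iio 1))
    simpa using h1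
  have hfr' : ∃ᶠ t in 𝓝[<] (1 : ℝ), x + (b * max t 0 ^ 2) • w ∈ K := by
    intro hev
    obtain ⟨a, ha, hH⟩ := (mem_nhdsLT_iff_exists_Ioo_subset (a := (1 : ℝ))).1 hev
    obtain ⟨t, ht, htK⟩ := hfr a ha
    exact hH ht htK
  exact hbS.2 (hKN (hK.isClosed.mem_of_frequently_of_tendsto hfr' hcont))

omit [FiniteDimensional ℝ E] in
/-- A function on the whole space with vanishing third derivatives is a quadratic polynomial. -/
theorem HessianMetric.eq_quadratic (h : HessianMetric univ u)
    (hT : ∀ y a b c, T u y a b c = 0) (x : E) :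
    u x = 1 / 2 * G u 0 x x + fderiv ℝ u 0 x + u 0 := by
  have hG : ∀ s : ℝ, 0 ≤ s → G u (s • x) x x = G u 0 x x := by
    intro s hs
    have := h.G_line_eq (x := 0) (w := x) (fun y _ => hT y) hs (fun _ _ => mem_univ _) x x
    simpa using this
  have hsm : ContDiff ℝ (⊤ : ℕ∞) u := contDiffOn_univ.1 h.smooth
  have hlin : ∀ s : ℝ, HasDerivAt (fun s : ℝ => s • x) x s := fun s => by
    simpa using (hasDerivAt_id s).smul_const x
  have hu0 : ∀ s : ℝ, HasDerivAt (fun s : ℝ => u (s • x)) (fderiv ℝ u (s • x) x) s := fun s =>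
    ((hsm.differentiable (by simp)) (s • x)).hasFDerivAt.comp_hasDerivAt s (hlin s)
  have hu1 : ∀ s : ℝ, HasDerivAt (fun s : ℝ => fderiv ℝ u (s • x) x) (G u (s • x) x x) s := by
    intro s
    have hd : DifferentiableAt ℝ (fderiv ℝ u) (s • x) :=
      (hsm.fderiv_right (m := 1) (by norm_cast)).differentiable (by simp) _
    have h1 := hd.hasFDerivAt.comp_hasDerivAt s (hlin s)
    have h2 := ((ContinuousLinearMap.apply ℝ ℝ x).hasFDerivAt
      (x := fderiv ℝ u (s • x))).comp_hasDerivAt s h1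
    exact h2
  have hf1 : ∀ s : ℝ, 0 ≤ s → fderiv ℝ u (s • x) x = fderiv ℝ u 0 x + s * G u 0 x x := by
    intro s hs
    have hd : ∀ t ∈ Icc 0 s,
        HasDerivAt (fun s : ℝ => fderiv ℝ u (s • x) x - s * G u 0 x x) 0 t := fun t ht =>
      ((hu1 t).sub ((hasDerivAt_id t).mul_const (G u 0 x x))).congr_deriv
        (by rw [hG t ht.1]; simp)
    have := constant_of_has_deriv_right_zero
      (fun t ht => (hd t ht).continuousAt.continuousWithinAt)
      (fun t ht => (hd t (Ico_subset_Icc_self ht)).hasDerivWithinAt) s ⟨hs, le_rfl⟩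
    simp only [zero_smul, zero_mul, sub_zero] at this
    linarith
  have hd : ∀ t ∈ Icc (0 : ℝ) 1, HasDerivAt
      (fun s : ℝ => u (s • x) - (s * fderiv ℝ u 0 x + 1 / 2 * (s ^ 2 * G u 0 x x))) 0 t := by
    intro t ht
    have h1 := ((hasDerivAt_id t).mul_const (fderiv ℝ u 0 x))
    have h2 := ((hasDerivAt_pow 2 t).mul_const (G u 0 x x)).const_mul (1 / 2 : ℝ)
    refine ((hu0 t).sub (h1.add h2)).congr_deriv ?_
    rw [hf1 t ht.1]
    push_cast
    ring
  have := constant_of_has_deriv_right_zero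
    (fun t ht => (hd t ht).continuousAt.continuousWithinAt)
    (fun t ht => (hd t (Ico_subset_Icc_self ht)).hasDerivWithinAt) 1 ⟨zero_le_one, le_rfl⟩
  simp only [zero_smul, one_smul, zero_mul, one_mul, one_pow, sub_zero, ne_eq, OfNat.ofNat_ne_zero,
    not_false_eq_true, zero_pow, mul_zero, add_zero] at this
  linarith

theorem IsSoliton.T_eq_zero (h : IsSoliton ι N u α ξ) (hc : CurveComplete N u)
    (hx : x ∈ N) (a b c : E) : T u x a b c = 0 :=
  h.toHessianMetric.T_eq_zero_of_cubicNorm hx h.card_eq (h.cubicNorm_eq_zero hx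
    fun r => h.toHessianMetric.bounded_of_curveComplete hc hx r) a b c

end FlatCase

section Coordinates

open Set Filter Topology MeasureTheory

variable {n : ℕ} {N : Set (Fin n → ℝ)} {u : (Fin n → ℝ) → ℝ} {x : Fin n → ℝ}

theorem hessian_apply (hN : IsOpen N) (hu : ContDiffOn ℝ (⊤ : ℕ∞) u N) (hx : x ∈ N)
    (i j : Fin n) : hessian u x i j = G u x (Pi.single i 1) (Pi.single j 1) := by
  have hd : DifferentiableAt ℝ (fderiv ℝ u) x :=
    ((hu.contDiffAt (hN.mem_nhds hx)).fderiv_right (m := 1) (by norm_cast)).differentiableAt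
      (by simp)
  have h1 := ((ContinuousLinearMap.apply ℝ ℝ (Pi.single j (1 : ℝ))).hasFDerivAt
    (x := fderiv ℝ u x)).comp x hd.hasFDerivAt
  exact congrArg (fun f => f (Pi.single i (1 : ℝ))) h1.fderiv

theorem sum_smul_single (a : Fin n → ℝ) : ∑ i, a i • (Pi.single i 1 : Fin n → ℝ) = a := by
  ext k
  simp [Pi.single_apply]

theorem G_eq_sum_hessian (hN : IsOpen N) (hu : ContDiffOn ℝ (⊤ : ℕ∞) u N) (hx : x ∈ N)
    (a b : Fin n → ℝ) : G u x a b = ∑ i, ∑ j, hessian u x i j * a i * b j := by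
  conv_lhs => rw [← sum_smul_single a, ← sum_smul_single b]
  simp only [G_sum₁, G_smul₁, G_sum₂, G_smul₂, hessian_apply hN hu hx, Finset.mul_sum]
  rw [Finset.sum_comm]
  exact Finset.sum_congr rfl fun i _ => Finset.sum_congr rfl fun j _ => by ring

theorem hessianMetric_of_posDef (hN : IsOpen N) (hu : ContDiffOn ℝ (⊤ : ℕ∞) u N)
    (hpos : ∀ x ∈ N, (hessian u x).PosDef) : HessianMetric N u where
  isOpen := hN
  smooth := hu
  pos x hx a ha := by
    have h1 := (hpos x hx).dotProduct_mulVec_pos ha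
    rw [G_eq_sum_hessian hN hu hx]
    simp only [dotProduct, Matrix.mulVec, Finset.mul_sum, Pi.star_apply, star_trivial] at h1
    refine h1.trans_eq (Finset.sum_congr rfl fun i _ => Finset.sum_congr rfl fun j _ => by ring)

/-- The derivative of the determinant at the identity is the trace. -/
theorem hasDerivAt_det_one {ι : Type*} [Fintype ι] [DecidableEq ι] {D : ℝ → Matrix ι ι ℝ}
    {D' : Matrix ι ι ℝ} {t : ℝ} (hD : ∀ i j, HasDerivAt (fun s => D s i j) (D' i j) t)
    (h1 : D t = 1) : HasDerivAt (fun s => (D s).det) D'.trace t := by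
  simp only [Matrix.det_apply']
  have h2 : HasDerivAt (fun s => ∑ σ : Equiv.Perm ι, ((Equiv.Perm.sign σ : ℤ) : ℝ) *
      ∏ i, D s (σ i) i) (∑ σ : Equiv.Perm ι, ((Equiv.Perm.sign σ : ℤ) : ℝ) *
      ∑ i, (∏ j ∈ Finset.univ.erase i, D t (σ j) j) • D' (σ i) i) t :=
    HasDerivAt.fun_sum fun σ _ =>
      (HasDerivAt.fun_finsetProd fun i _ => hD (σ i) i).const_mul _
  refine h2.congr_deriv ?_
  rw [Finset.sum_eq_single 1]
  · simp [h1, Matrix.trace]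
  · intro σ _ hσ
    rw [Finset.sum_eq_zero, mul_zero]
    intro i _
    obtain ⟨j, hji, hj⟩ : ∃ j, j ≠ i ∧ σ j ≠ j := by
      by_contra! H
      apply hσ
      ext k
      rcases eq_or_ne k i with rfl | hk
      · by_contra hne
        have h3 := H (σ k) hne
        exact hne (σ.injective h3)
      · exact H k hk
    rw [Finset.prod_eq_zero (Finset.mem_erase.2 ⟨hji, Finset.mem_univ _⟩), zero_smul]
    rw [h1, Matrix.one_apply_ne hj]
  · simp

theorem hasDerivAt_log_det_hessian (h : HessianMetric N u) (hx : x ∈ N)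
    (hpos : ∀ x ∈ N, (hessian u x).PosDef) {e : Fin n → Fin n → ℝ} (he : IsFrame u x e)
    (w : Fin n → ℝ) :
    HasDerivAt (fun t : ℝ => Real.log (hessian u (x + t • w)).det)
      (∑ a, T u x w (e a) (e a)) 0 := by
  set M : Matrix (Fin n) (Fin n) ℝ := Matrix.of fun i a => e a i with hM
  have hline : ∀ᶠ t in 𝓝 (0 : ℝ), x + t • w ∈ N := by
    have : Continuous fun t : ℝ => x + t • w := by fun_prop
    exact this.continuousAt.eventually (h.isOpen.mem_nhds (by simpa using hx))
  have hx0 : x + (0 : ℝ) • w ∈ N := by simpa using hx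
  set D : ℝ → Matrix (Fin n) (Fin n) ℝ := fun t => Matrix.of fun a b => G u (x + t • w) (e a) (e b)
    with hDdef
  have hprod : ∀ y ∈ N, (Matrix.of fun a b => G u y (e a) (e b)) = M.transpose * hessian u y * M := by
    intro y hy
    ext a b
    simp only [Matrix.of_apply, G_eq_sum_hessian h.isOpen h.smooth hy, Matrix.mul_apply,
      Matrix.transpose_apply, hM, Finset.sum_mul]
    rw [Finset.sum_comm]
    exact Finset.sum_congr rfl fun i _ => Finset.sum_congr rfl fun j _ => by ring
  have hD1 : D 0 = 1 := by
    ext a b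
    simp [hDdef, he a b, Matrix.one_apply]
  have hMdet : M.det * M.det * (hessian u x).det = 1 := by
    have h1 := congrArg Matrix.det hD1
    rw [hDdef] at h1
    simp only [zero_smul, add_zero] at h1
    rw [hprod x hx, Matrix.det_mul, Matrix.det_mul, Matrix.det_transpose, Matrix.det_one] at h1
    linarith
  have hM0 : M.det ≠ 0 := fun h0 => by simp [h0] at hMdet
  have hder : HasDerivAt (fun t => (D t).det)
      (Matrix.of fun a b => T u x w (e a) (e b)).trace 0 := by
    refine hasDerivAt_det_one (fun a b => ?_) hD1
    have := h.hasDerivAt_G (hasDerivAt_line x w 0) hx0 (hasDerivAt_const 0 (e a))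
      (hasDerivAt_const 0 (e b))
    simpa [hDdef, G_zero₁, G_zero₂] using this
  have hlog := (hder.log (by simp [hD1])).sub_const (Real.log (M.det * M.det))
  rw [hD1, Matrix.det_one, div_one] at hlog
  refine hlog.congr_of_eventuallyEq ?_
  filter_upwards [hline] with t ht
  have hdet : (D t).det = M.det * M.det * (hessian u (x + t • w)).det := by
    rw [hDdef]
    simp only [hprod _ ht, Matrix.det_mul, Matrix.det_transpose]
    ring
  rw [hdet, Real.log_mul (mul_ne_zero hM0 hM0) (hpos _ ht).det_pos.ne']
  ring

theorem isSoliton_of_MAeq (hN : IsOpen N) (hu : ContDiffOn ℝ (⊤ : ℕ∞) u N)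
    (hpos : ∀ x ∈ N, (hessian u x).PosDef) {v ξ : Fin n → ℝ} {c : ℝ} (hMA : MAeq u N v ξ c) :
    IsSoliton (Fin n) N u (-∑ p, v p • (ContinuousLinearMap.proj p : (Fin n → ℝ) →L[ℝ] ℝ)) ξ where
  toHessianMetric := hessianMetric_of_posDef hN hu hpos
  card_eq := by simp
  trace_eq x hx e he w := by
    have h := hessianMetric_of_posDef hN hu hpos
    have h1 := hasDerivAt_log_det_hessian h hx hpos he w
    have hline : ∀ᶠ t in 𝓝 (0 : ℝ), x + t • w ∈ N := by
      have : Continuous fun t : ℝ => x + t • w := by fun_prop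
      exact this.continuousAt.eventually (hN.mem_nhds (by simpa using hx))
    have hd : DifferentiableAt ℝ (fderiv ℝ u) (x + (0 : ℝ) • w) := by
      rw [zero_smul, add_zero]
      exact ((hu.contDiffAt (hN.mem_nhds hx)).fderiv_right (m := 1)
        (by norm_cast)).differentiableAt (by simp)
    have hξ : HasDerivAt (fun t : ℝ => fderiv ℝ u (x + t • w) ξ) (G u x w ξ) 0 := by
      have h2 := hd.hasFDerivAt.comp_hasDerivAt 0 (hasDerivAt_line x w 0)
      have h3 := ((ContinuousLinearMap.apply ℝ ℝ ξ).hasFDerivAt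
        (x := fderiv ℝ u (x + (0 : ℝ) • w))).comp_hasDerivAt 0 h2
      rw [zero_smul, add_zero] at h3
      exact h3
    have hv : HasDerivAt (fun t : ℝ => ∑ p, v p * (x + t • w) p) (∑ p, v p * w p) 0 :=
      HasDerivAt.fun_sum fun p _ =>
        ((hasDerivAt_pi.1 (hasDerivAt_line x w 0)) p).const_mul (v p)
    have h4 := (hv.neg.add hξ).add_const c
    have h5 := h4.congr_of_eventuallyEq (f₁ := fun t : ℝ => Real.log (hessian u (x + t • w)).det) (by
      filter_upwards [hline] with t ht
      rw [hMA _ ht]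
      have : ∑ q, pd q u (x + t • w) * ξ q = fderiv ℝ u (x + t • w) ξ := by
        conv_rhs => rw [← sum_smul_single ξ]
        simp [pd, mul_comm]
      rw [this]
      rfl)
    rw [h1.unique h5, h.G_symm hx]
    simp

theorem curveComplete_of_hessComplete (h : HessianMetric N u) (hc : HessComplete u N) :
    CurveComplete N u := by
  intro γ γ' C hγ' hγ hγN hC
  by_contra! H
  have hIco : Ico (0 : ℝ) 1 ⊆ Iio 1 := fun t ht => ht.2
  have hcd : ContDiffOn ℝ 1 γ (Iio 1) := by
    rw [contDiffOn_one_iff_derivWithin isOpen_Iio.uniqueDiffOn]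
    refine ⟨fun t ht => (hγ t ht).differentiableAt.differentiableWithinAt, hγ'.congr fun t ht => ?_⟩
    rw [derivWithin_of_isOpen isOpen_Iio ht, (hγ t ht).deriv]
  have hinf := hc γ (hcd.mono hIco) (fun t ht => hγN t ht.2) fun K hK hKN => by
    obtain ⟨a, ha, hH⟩ := H K hK hKN
    exact ⟨max a 0, ⟨le_max_right _ _, max_lt ha one_pos⟩,
      fun t ht => hH t ⟨(le_max_left _ _).trans_lt ht.1, ht.2⟩⟩
  have hle : ∫⁻ t in Ioo (0 : ℝ) 1, ENNReal.ofReal (√(∑ i, ∑ j,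
      hessian u (γ t) i j * deriv γ t i * deriv γ t j)) ≤
      ∫⁻ _ in Ioo (0 : ℝ) 1, ENNReal.ofReal (√C) := by
    refine setLIntegral_mono measurable_const fun t ht => ENNReal.ofReal_le_ofReal ?_
    rw [← G_eq_sum_hessian h.isOpen h.smooth (hγN t ht.2), (hγ t ht.2).deriv]
    exact Real.sqrt_le_sqrt (hC t ht.2)
  rw [hinf] at hle
  simp at hle

end Coordinates

theorem generalized_calabi_rigidity {n : ℕ} (hn : 1 ≤ n) (N : Set (Fin n → ℝ)) (hNopen : IsOpen N)
    (hNne : N.Nonempty) (u : (Fin n → ℝ) → ℝ) (hu : ContDiffOn ℝ (⊤ : ℕ∞) u N)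
    (hpos : ∀ x ∈ N, (hessian u x).PosDef)
    (v ξ : Fin n → ℝ) (c : ℝ) (hMA : MAeq u N v ξ c) (hcomplete : HessComplete u N) :
    N = Set.univ ∧
      ∃ A : Matrix (Fin n) (Fin n) ℝ, A.IsSymm ∧ A.PosDef ∧
        ∃ b : Fin n → ℝ, ∃ a₀ : ℝ,
          ∀ x : Fin n → ℝ,
            u x = (1/2) * (∑ i, ∑ j, A i j * x i * x j) + (∑ i, b i * x i) + a₀ := by
  have hM := hessianMetric_of_posDef hNopen hu hpos
  have hS := isSoliton_of_MAeq hNopen hu hpos hMA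
  have hC := curveComplete_of_hessComplete hM hcomplete
  obtain ⟨x₀, hx₀⟩ := hNne
  have hT : ∀ y ∈ N, ∀ a b c, T u y a b c = 0 := fun y hy => hS.T_eq_zero hC hy
  have hNu : N = Set.univ := hM.eq_univ_of_T_eq_zero hC hT hx₀
  subst hNu
  refine ⟨rfl, hessian u 0, ?_, hpos 0 (Set.mem_univ _), fun i => fderiv ℝ u 0 (Pi.single i 1), u 0,
    fun x => ?_⟩
  · ext i j
    simp only [Matrix.transpose_apply, hessian_apply hNopen hu (Set.mem_univ _)]
    exact hM.G_symm (Set.mem_univ _) _ _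
  · rw [hM.eq_quadratic (fun y => hT y (Set.mem_univ _)) x,
      G_eq_sum_hessian hNopen hu (Set.mem_univ _)]
    conv_lhs => enter [1, 2]; rw [← sum_smul_single x]
    simp [mul_comm]

end KRS
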